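/- arXiv:2401.00937 — 2 statements merged into one kernel-verified Lean document; each statement's English description precedes it below -/
import Mathlib

section
/- Let 0 < α ≤ 1 and let φ : S³ → ℝ be of class C^{2,α} (the 0-homogeneous extension y ↦ φ(y/‖y‖) is twice continuously differentiable with α-Hölder continuous second derivatives on a neighborhood of S³ in ℝ⁴). Then for any 0 < β < α there exists u, smooth on the open unit ball B⁴ and of class C^{3,β} up to the closed ball (all partial derivatives of order ≤ 3 extend continuously with β-Hölder continuous third derivatives), such that Δ²u = 0 in the open ball, P₃^{S³}u = 0 on S³, and μ u = φ on S³. It may be chosen with u|_{S³} = 0, and among C³(B⁴) solutions it is then unique. -/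
noncomputable section

open Real Set
open scoped RealInnerProductSpace Topology

abbrev E4 := EuclideanSpace ℝ (Fin 4)

def e4 (i : Fin 4) : E4 := EuclideanSpace.single i 1

/-- Euclidean Laplacian on `ℝ⁴`. -/
def lap (u : E4 → ℝ) (x : E4) : ℝ :=
  ∑ i : Fin 4, fderiv ℝ (fun y => fderiv ℝ u y (e4 i)) x (e4 i)

/-- Laplacian in the first three variables. -/
def lap3 (u : E4 → ℝ) (x : E4) : ℝ :=
  ∑ i : Fin 3, fderiv ℝ (fun y => fderiv ℝ u y (e4 i.castSucc)) x (e4 i.castSucc)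

/-- Spherical Laplacian of (the restriction to `S³` of) `f`, via the `0`-homogeneous
extension `y ↦ f (y / ‖y‖)`. -/
def sphLap (f : E4 → ℝ) (x : E4) : ℝ := lap (fun y => f (‖y‖⁻¹ • y)) x

/-- Inward normal derivative at a point of the unit sphere: `μ_M u x = -⟨∇u x, x⟩`. -/
def muM (u : E4 → ℝ) (x : E4) : ℝ := -(fderiv ℝ u x x)

/-- Inward normal derivative at a point of the flat boundary `B³ ⊂ {x₄ = 0}`. -/
def muN (u : E4 → ℝ) (x : E4) : ℝ := fderiv ℝ u x (e4 3)

/-- At `p ∈ Σ`, `ν_M f p = -(d/dφ)|_{φ = π/2} f(sin φ • σ, cos φ)`. -/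
def nuM (f : E4 → ℝ) (p : E4) : ℝ :=
  -(deriv (fun t : ℝ => f (Real.sin t • p + Real.cos t • e4 3)) (π/2))

/-- At `p ∈ Σ`, `ν_N f p = -(d/dr)|_{r = 1} f (r • p)`. -/
def nuN (f : E4 → ℝ) (p : E4) : ℝ := -(deriv (fun r : ℝ => f (r • p)) 1)

/-- The closed upper half-ball `B⁴₊`. -/
def B4p : Set E4 := {x | ‖x‖ ≤ 1 ∧ 0 ≤ x 3}
/-- The upper half-sphere `M = S³₊`. -/
def Mhs : Set E4 := {x | ‖x‖ = 1 ∧ 0 ≤ x 3}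
/-- The flat boundary `N = B³`. -/
def Nfb : Set E4 := {x | ‖x‖ ≤ 1 ∧ x 3 = 0}
/-- The corner `Σ = S²`. -/
def Sig : Set E4 := {x | ‖x‖ = 1 ∧ x 3 = 0}

/-- `P₃^M u = (1/2) μ_M (Δu) + Δ_{S³}(μ_M u) - Δ_{S³}(u|_M)`. -/
def P3M (u : E4 → ℝ) (x : E4) : ℝ :=
  (1/2) * muM (lap u) x + sphLap (muM u) x - sphLap u x

/-- `P₃^N u = (1/2) μ_N (Δu) + Δ_{ℝ³}(μ_N u)`. -/
def P3N (u : E4 → ℝ) (x : E4) : ℝ :=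
  (1/2) * muN (lap u) x + lap3 (muN u) x


/-- A `C³`-up-to-the-boundary solution of the boundary value problem on the ball `B⁴`:
`u` is `C³` up to the closed ball (encoded as globally `C³`), four times continuously
differentiable and biharmonic in the open ball, with `P₃^{S³} u = 0` and `μ u = φ` on
`S³`.  (`P3M` is the operator `P₃^{S³}` and `muM` the inward normal derivative `μ`.) -/
def SolBallC3 (φ u : E4 → ℝ) : Prop :=
  ContDiff ℝ 3 u ∧
  ContDiffOn ℝ 4 u (Metric.ball 0 1) ∧
  (∀ x : E4, ‖x‖ < 1 → lap (lap u) x = 0) ∧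
  (∀ x : E4, ‖x‖ = 1 → P3M u x = 0) ∧
  (∀ x : E4, ‖x‖ = 1 → muM u x = φ x)

/-- The `i`-th partial derivative. -/
def pd (i : Fin 4) (f : E4 → ℝ) (x : E4) : ℝ := fderiv ℝ f x (e4 i)

lemma norm_e4 (i : Fin 4) : ‖e4 i‖ = 1 := by simp [e4]

lemma e4_apply (i j : Fin 4) : (e4 i) j = if j = i then 1 else 0 := by
  simp [e4]

lemma eq_sum_e4 (x : E4) : x = ∑ i, x i • e4 i := by
  ext j
  simp [e4_apply]

lemma fderiv_eq_sum_pd (f : E4 → ℝ) (x v : E4) : fderiv ℝ f x v = ∑ i, v i * pd i f x := by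
  conv_lhs => rw [eq_sum_e4 v]
  simp [pd]

lemma lap_eq_sum_pd (f : E4 → ℝ) (x : E4) : lap f x = ∑ i, pd i (pd i f) x := rfl

lemma Filter.EventuallyEq.pd_eq {f g : E4 → ℝ} {x : E4} (h : f =ᶠ[𝓝 x] g) (i : Fin 4) :
    pd i f =ᶠ[𝓝 x] pd i g := by
  filter_upwards [h.eventuallyEq_nhds] with y hy
  simp only [pd, hy.fderiv_eq]

lemma Filter.EventuallyEq.lap_eq {f g : E4 → ℝ} {x : E4} (h : f =ᶠ[𝓝 x] g) :
    lap f x = lap g x := by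
  simp only [lap_eq_sum_pd]
  exact Finset.sum_congr rfl fun i _ => ((h.pd_eq i).pd_eq i).eq_of_nhds

lemma ContDiffAt.pd {f : E4 → ℝ} {x : E4} {n m : WithTop ℕ∞} (h : ContDiffAt ℝ n f x)
    (hm : m + 1 ≤ n) (i : Fin 4) : ContDiffAt ℝ m (pd i f) x :=
  (h.fderiv_right hm).clm_apply contDiffAt_const

lemma ContDiffAt.lap {f : E4 → ℝ} {x : E4} {n m : WithTop ℕ∞} (h : ContDiffAt ℝ n f x)
    (hm : m + 1 + 1 ≤ n) : ContDiffAt ℝ m (lap f) x := by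
  have : _root_.lap f = fun y => ∑ i, _root_.pd i (_root_.pd i f) y := rfl
  rw [this]
  exact ContDiffAt.sum fun i _ => (h.pd hm i).pd le_rfl i

lemma hasFDerivAt_coord (i : Fin 4) (x : E4) :
    HasFDerivAt (fun y : E4 => y i) (EuclideanSpace.proj i : E4 →L[ℝ] ℝ) x :=
  (EuclideanSpace.proj i : E4 →L[ℝ] ℝ).hasFDerivAt

lemma contDiff_coord (i : Fin 4) {n : WithTop ℕ∞} : ContDiff ℝ n (fun y : E4 => y i) :=
  (EuclideanSpace.proj i : E4 →L[ℝ] ℝ).contDiff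

lemma pd_coord (i j : Fin 4) (x : E4) : pd i (fun y => y j) x = if j = i then 1 else 0 := by
  rw [pd, (hasFDerivAt_coord j x).fderiv]
  exact e4_apply i j

lemma pd_mul {f g : E4 → ℝ} {x : E4} (hf : DifferentiableAt ℝ f x) (hg : DifferentiableAt ℝ g x)
    (i : Fin 4) : pd i (fun y => f y * g y) x = f x * pd i g x + pd i f x * g x := by
  simp only [pd, fderiv_fun_mul hf hg]
  simp [mul_comm]

lemma pd_add {f g : E4 → ℝ} {x : E4} (hf : DifferentiableAt ℝ f x) (hg : DifferentiableAt ℝ g x)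
    (i : Fin 4) : pd i (fun y => f y + g y) x = pd i f x + pd i g x := by
  simp only [pd, fderiv_fun_add hf hg]
  simp

lemma pd_sum {ι : Type*} {s : Finset ι} {f : ι → E4 → ℝ} {x : E4}
    (hf : ∀ j ∈ s, DifferentiableAt ℝ (f j) x) (i : Fin 4) :
    pd i (fun y => ∑ j ∈ s, f j y) x = ∑ j ∈ s, pd i (f j) x := by
  simp only [pd, fderiv_fun_sum hf]
  simp

lemma pd_const_mul {f : E4 → ℝ} {x : E4} (hf : DifferentiableAt ℝ f x) (c : ℝ)
    (i : Fin 4) : pd i (fun y => c * f y) x = c * pd i f x := by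
  simp only [pd, fderiv_const_mul hf]
  simp

lemma pd_comm {f : E4 → ℝ} {x : E4} (hf : ContDiffAt ℝ 2 f x) (i j : Fin 4) :
    pd i (pd j f) x = pd j (pd i f) x := by
  have hd : DifferentiableAt ℝ (fderiv ℝ f) x :=
    (hf.fderiv_right (m := 1) (by norm_num)).differentiableAt (by norm_num)
  have h (a b : Fin 4) : pd a (pd b f) x = fderiv ℝ (fderiv ℝ f) x (e4 a) (e4 b) := by
    change fderiv ℝ (fun y => fderiv ℝ f y (e4 b)) x (e4 a) = _
    rw [fderiv_clm_apply hd (by fun_prop)]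
    simp
  rw [h, h]
  exact (hf.isSymmSndFDerivAt (by simp)) _ _

lemma lap_add {f g : E4 → ℝ} {x : E4} (hf : ContDiffAt ℝ 2 f x) (hg : ContDiffAt ℝ 2 g x) :
    lap (fun y => f y + g y) x = lap f x + lap g x := by
  simp only [lap_eq_sum_pd, ← Finset.sum_add_distrib]
  refine Finset.sum_congr rfl fun i _ => ?_
  have : pd i (fun y => f y + g y) =ᶠ[𝓝 x] fun y => pd i f y + pd i g y := by
    filter_upwards [hf.eventually (by simp), hg.eventually (by simp)] with y hy hy'
    exact pd_add (hy.differentiableAt (by simp)) (hy'.differentiableAt (by simp)) i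
  rw [(this.pd_eq i).eq_of_nhds]
  exact pd_add ((hf.pd (m := 1) (by norm_num) i).differentiableAt (by simp))
    ((hg.pd (m := 1) (by norm_num) i).differentiableAt (by simp)) i

lemma lap_const_mul {f : E4 → ℝ} {x : E4} (hf : ContDiffAt ℝ 2 f x) (c : ℝ) :
    lap (fun y => c * f y) x = c * lap f x := by
  simp only [lap_eq_sum_pd, Finset.mul_sum]
  refine Finset.sum_congr rfl fun i _ => ?_
  have : pd i (fun y => c * f y) =ᶠ[𝓝 x] fun y => c * pd i f y := by
    filter_upwards [hf.eventually (by simp)] with y hy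
    exact pd_const_mul (hy.differentiableAt (by simp)) c i
  rw [(this.pd_eq i).eq_of_nhds]
  exact pd_const_mul ((hf.pd (m := 1) (by norm_num) i).differentiableAt (by simp)) c i

lemma lap_mul {f g : E4 → ℝ} {x : E4} (hf : ContDiffAt ℝ 2 f x) (hg : ContDiffAt ℝ 2 g x) :
    lap (fun y => f y * g y) x
      = f x * lap g x + 2 * ∑ i, pd i f x * pd i g x + lap f x * g x := by
  simp only [lap_eq_sum_pd, Finset.mul_sum, Finset.sum_mul, ← Finset.sum_add_distrib]
  refine Finset.sum_congr rfl fun i _ => ?_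
  have : pd i (fun y => f y * g y) =ᶠ[𝓝 x] fun y => f y * pd i g y + pd i f y * g y := by
    filter_upwards [hf.eventually (by simp), hg.eventually (by simp)] with y hy hy'
    exact pd_mul (hy.differentiableAt (by simp)) (hy'.differentiableAt (by simp)) i
  have hf0 := hf.differentiableAt (by simp)
  have hg0 := hg.differentiableAt (by simp)
  have hf1 := (hf.pd (m := 1) (by norm_num) i).differentiableAt (by simp)
  have hg1 := (hg.pd (m := 1) (by norm_num) i).differentiableAt (by simp)
  rw [(this.pd_eq i).eq_of_nhds, pd_add (hf0.fun_mul hg1) (hf1.fun_mul hg0), pd_mul hf0 hg1,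
    pd_mul hf1 hg0]
  ring

lemma hasFDerivAt_one_sub_norm_sq (x : E4) :
    HasFDerivAt (fun y : E4 => 1 - ‖y‖ ^ 2) (-(2 • innerSL ℝ x)) x := by
  exact (hasStrictFDerivAt_norm_sq x).hasFDerivAt.const_sub 1

lemma contDiff_one_sub_norm_sq {n : WithTop ℕ∞} : ContDiff ℝ n (fun y : E4 => 1 - ‖y‖ ^ 2) :=
  contDiff_const.sub (contDiff_norm_sq ℝ)

lemma inner_e4 (x : E4) (i : Fin 4) : inner ℝ x (e4 i) = x i := by
  simp [e4, EuclideanSpace.inner_single_right]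

lemma pd_one_sub_norm_sq (i : Fin 4) :
    pd i (fun y : E4 => 1 - ‖y‖ ^ 2) = fun y => -2 * y i := by
  ext x
  rw [pd, (hasFDerivAt_one_sub_norm_sq x).fderiv]
  simp [inner_e4]

lemma lap_one_sub_norm_sq (x : E4) : lap (fun y : E4 => 1 - ‖y‖ ^ 2) x = -8 := by
  simp only [lap_eq_sum_pd, pd_one_sub_norm_sq]
  simp only [pd_const_mul (hasFDerivAt_coord _ x).differentiableAt, pd_coord]
  simp
  norm_num

lemma lap_one_sub_norm_sq_mul {f : E4 → ℝ} {x : E4} (hf : ContDiffAt ℝ 2 f x) :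
    lap (fun y => (1 - ‖y‖ ^ 2) * f y) x
      = (1 - ‖x‖ ^ 2) * lap f x - 4 * fderiv ℝ f x x - 8 * f x := by
  rw [lap_mul contDiff_one_sub_norm_sq.contDiffAt hf, lap_one_sub_norm_sq, fderiv_eq_sum_pd]
  simp only [pd_one_sub_norm_sq, mul_assoc, ← Finset.mul_sum]
  ring

lemma lap_fderiv_self {f : E4 → ℝ} {x : E4} (hf : ContDiffAt ℝ 3 f x) :
    lap (fun y => fderiv ℝ f y y) x = 2 * lap f x + fderiv ℝ (lap f) x x := by
  have hc (j : Fin 4) : ContDiffAt ℝ 2 (fun y : E4 => y j) x := (contDiff_coord j).contDiffAt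
  have h2 (j : Fin 4) : ContDiffAt ℝ 2 (pd j f) x := hf.pd (by norm_num) j
  have h1 (i j : Fin 4) : DifferentiableAt ℝ (pd i (pd j f)) x :=
    ((h2 j).pd (m := 1) (by norm_num) i).differentiableAt (by simp)
  have h1' (i j : Fin 4) : DifferentiableAt ℝ (pd i (fun y : E4 => y j)) x :=
    ((hc j).pd (m := 1) (by norm_num) i).differentiableAt (by simp)
  have e0 : (fun y => fderiv ℝ f y y) = fun y => ∑ j, y j * pd j f y := by
    ext y; exact fderiv_eq_sum_pd f y y
  have e1 (i : Fin 4) : pd i (fun y => fderiv ℝ f y y) =ᶠ[𝓝 x]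
      fun y => pd i f y + ∑ j, y j * pd j (pd i f) y := by
    filter_upwards [hf.eventually (by simp)] with y hy
    have hd (j : Fin 4) : DifferentiableAt ℝ (pd j f) y :=
      (hy.pd (m := 2) (by norm_num) j).differentiableAt (by simp)
    have hcy (j : Fin 4) : DifferentiableAt ℝ (fun z : E4 => z j) y :=
      (hasFDerivAt_coord j y).differentiableAt
    rw [e0, pd_sum fun j _ => (hcy j).fun_mul (hd j)]
    simp only [pd_mul (hcy _) (hd _), pd_coord, Finset.sum_add_distrib]
    rw [add_comm]
    congr 1
    · simp
    · exact Finset.sum_congr rfl fun j _ => by rw [pd_comm (hy.of_le (by norm_num))]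
  have e2 (i : Fin 4) : pd i (pd i (fun y => fderiv ℝ f y y)) x
      = 2 * pd i (pd i f) x + ∑ j, x j * pd j (pd i (pd i f)) x := by
    rw [((e1 i).pd_eq i).eq_of_nhds, pd_add ((h2 i).differentiableAt (by simp))
      (DifferentiableAt.fun_sum fun j _ => ((hc j).differentiableAt (by simp)).fun_mul (h1 j i)),
      pd_sum fun j _ => ((hc j).differentiableAt (by simp)).fun_mul (h1 j i)]
    simp only [pd_mul ((hc _).differentiableAt (by simp)) (h1 _ i), pd_coord,
      Finset.sum_add_distrib]
    have : ∑ j, (if j = i then 1 else 0) * pd j (pd i f) x = pd i (pd i f) x := by simp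
    rw [this, two_mul, add_assoc, add_comm (∑ j, _)]
    congr 2
    exact Finset.sum_congr rfl fun j _ => by rw [pd_comm (h2 i)]
  have e3 : fderiv ℝ (lap f) x x = ∑ i, ∑ j, x j * pd j (pd i (pd i f)) x := by
    rw [fderiv_eq_sum_pd, Finset.sum_comm]
    refine Finset.sum_congr rfl fun j _ => ?_
    rw [← Finset.mul_sum]
    congr 1
    exact pd_sum (fun i _ => h1 i i) j
  rw [lap_eq_sum_pd, e3]
  simp only [e2, Finset.sum_add_distrib, ← Finset.mul_sum]
  rfl

lemma hasDerivAt_comp_line {F : Type*} [NormedAddCommGroup F] [NormedSpace ℝ F] {f : E4 → F}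
    {x v : E4} {t : ℝ} (h : DifferentiableAt ℝ f (x + t • v)) :
    HasDerivAt (fun s : ℝ => f (x + s • v)) (fderiv ℝ f (x + t • v) v) t := by
  have h1 : HasDerivAt (fun s : ℝ => x + s • v) v t := by
    simpa using ((hasDerivAt_id t).smul_const v).const_add x
  exact h.hasFDerivAt.comp_hasDerivAt t h1

lemma pd_pd_nonpos_of_isLocalMax {f : E4 → ℝ} {z : E4} (hf : ContDiffAt ℝ 2 f z)
    (hm : IsLocalMax f z) (i : Fin 4) : pd i (pd i f) z ≤ 0 := by
  by_contra! hpos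
  have hline : Filter.Tendsto (fun t : ℝ => z + t • e4 i) (𝓝 0) (𝓝 z) := by
    have : Continuous fun t : ℝ => z + t • e4 i := by fun_prop
    simpa using this.tendsto 0
  have hd : deriv (fun t : ℝ => f (z + t • e4 i)) =ᶠ[𝓝 0] fun t => pd i f (z + t • e4 i) := by
    filter_upwards [hline.eventually (hf.eventually (by simp))] with t ht
    exact (hasDerivAt_comp_line (ht.differentiableAt (by simp))).deriv
  have hdd : deriv (deriv (fun t : ℝ => f (z + t • e4 i))) 0 = pd i (pd i f) z := by
    rw [hd.deriv_eq]
    have h1 : DifferentiableAt ℝ (pd i f) (z + (0 : ℝ) • e4 i) := by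
      simpa using (hf.pd (m := 1) (by norm_num) i).differentiableAt (by simp)
    rw [(hasDerivAt_comp_line h1).deriv]
    simp [pd]
  have hmax : IsLocalMax (fun t : ℝ => f (z + t • e4 i)) 0 := by
    have := hline.eventually hm
    simpa [IsLocalMax, IsMaxFilter] using this
  have hc : ContinuousAt (fun t : ℝ => f (z + t • e4 i)) 0 := by
    have h1 : ContinuousAt f (z + (0 : ℝ) • e4 i) := by simpa using hf.continuousAt
    exact ContinuousAt.comp (f := fun t : ℝ => z + t • e4 i) h1 (by fun_prop)
  have hmin := isLocalMin_of_deriv_deriv_pos (by rw [hdd]; exact hpos) hmax.deriv_eq_zero hc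
  have hconst : (fun t : ℝ => f (z + t • e4 i)) =ᶠ[𝓝 0] fun _ => f (z + (0 : ℝ) • e4 i) := by
    filter_upwards [hmin, hmax] with t h1 h2 using le_antisymm h2 h1
  have h0 : deriv (fun t : ℝ => f (z + t • e4 i)) =ᶠ[𝓝 0] fun _ => 0 := by
    filter_upwards [hconst.eventuallyEq_nhds] with t ht
    rw [ht.deriv_eq]; simp
  rw [← hdd, h0.deriv_eq] at hpos
  simp at hpos

/-- A weak maximum principle for the operators `a Δ + b ⟨x, ∇⟩`. -/
lemma le_of_nonneg_operator {a b f : E4 → ℝ} {ρ M : ℝ}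
    (hc : ContinuousOn f (Metric.closedBall 0 ρ)) (hf : ∀ x : E4, ‖x‖ < ρ → ContDiffAt ℝ 2 f x)
    (ha : ∀ x : E4, ‖x‖ < ρ → 0 ≤ a x)
    (hab : ∀ x : E4, ‖x‖ < ρ → 0 < 8 * a x + 2 * b x * ‖x‖ ^ 2)
    (hL : ∀ x : E4, ‖x‖ < ρ → 0 ≤ a x * lap f x + b x * fderiv ℝ f x x)
    (hbd : ∀ x : E4, ‖x‖ = ρ → f x ≤ M) {x : E4} (hx : ‖x‖ ≤ ρ) : f x ≤ M := by
  have key : ∀ ε : ℝ, 0 < ε → f x ≤ M + ε * ρ ^ 2 := by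
    intro ε hε
    set g : E4 → ℝ := fun y => f y + -ε * (1 - ‖y‖ ^ 2) with hg
    have hq (y : E4) : ContDiffAt ℝ 2 (fun y : E4 => -ε * (1 - ‖y‖ ^ 2)) y :=
      contDiffAt_const.mul contDiff_one_sub_norm_sq.contDiffAt
    have hgc : ContinuousOn g (Metric.closedBall 0 ρ) := hc.add (by fun_prop)
    obtain ⟨z, hz, hzmax⟩ := (isCompact_closedBall (0 : E4) ρ).exists_isMaxOn
      ⟨x, by simpa using hx⟩ hgc
    have hzn : ‖z‖ ≤ ρ := by simpa using hz
    have hxz : g x ≤ g z := hzmax (by simpa using hx)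
    have hzb : ‖z‖ = ρ := by
      by_contra hne
      have hlt : ‖z‖ < ρ := lt_of_le_of_ne hzn hne
      have hloc : IsLocalMax g z := hzmax.isLocalMax
        (Filter.mem_of_superset (Metric.isOpen_ball.mem_nhds (by simpa using hlt))
          Metric.ball_subset_closedBall)
      have hg2 : ContDiffAt ℝ 2 g z := (hf z hlt).add (hq z)
      have h1 : fderiv ℝ g z = 0 := hloc.fderiv_eq_zero
      have h2 : lap g z ≤ 0 :=
        Finset.sum_nonpos fun i _ => pd_pd_nonpos_of_isLocalMax hg2 hloc i
      have h3 : lap g z = lap f z + 8 * ε := by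
        rw [hg, lap_add (hf z hlt) (hq z), lap_const_mul contDiff_one_sub_norm_sq.contDiffAt,
          lap_one_sub_norm_sq]
        ring
      have h4 : fderiv ℝ g z z = fderiv ℝ f z z + 2 * ε * ‖z‖ ^ 2 := by
        have := ((hf z hlt).differentiableAt (by simp)).hasFDerivAt.add
          ((hasFDerivAt_one_sub_norm_sq z).const_mul (-ε))
        have h5 : fderiv ℝ g z = _ := this.fderiv
        rw [h5]
        simp
        ring
      have h6 : a z * lap g z + b z * fderiv ℝ g z z ≤ 0 := by
        rw [h1]
        simpa using mul_nonpos_of_nonneg_of_nonpos (ha z hlt) h2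
      rw [h3, h4] at h6
      have := mul_pos hε (hab z hlt)
      nlinarith [hL z hlt]
    have := hbd z hzb
    simp only [hg, hzb] at hxz
    nlinarith [mul_nonneg hε.le (sq_nonneg ‖x‖)]
  have ht : Filter.Tendsto (fun ε : ℝ => M + ε * ρ ^ 2) (𝓝[>] 0) (𝓝 M) := by
    have : Continuous fun ε : ℝ => M + ε * ρ ^ 2 := by fun_prop
    simpa using (this.tendsto 0).mono_left nhdsWithin_le_nhds
  exact ge_of_tendsto ht (Filter.eventually_of_mem self_mem_nhdsWithin key)

/-- Uniqueness for the Dirichlet problem of the operators `a Δ + b ⟨x, ∇⟩`. -/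
lemma eq_of_operator_eq_zero {a b f : E4 → ℝ} {ρ M : ℝ}
    (hc : ContinuousOn f (Metric.closedBall 0 ρ)) (hf : ∀ x : E4, ‖x‖ < ρ → ContDiffAt ℝ 2 f x)
    (ha : ∀ x : E4, ‖x‖ < ρ → 0 ≤ a x)
    (hab : ∀ x : E4, ‖x‖ < ρ → 0 < 8 * a x + 2 * b x * ‖x‖ ^ 2)
    (hL : ∀ x : E4, ‖x‖ < ρ → a x * lap f x + b x * fderiv ℝ f x x = 0)
    (hbd : ∀ x : E4, ‖x‖ = ρ → f x = M) {x : E4} (hx : ‖x‖ ≤ ρ) : f x = M := by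
  refine le_antisymm (le_of_nonneg_operator hc hf ha hab (fun y hy => (hL y hy).ge)
    (fun y hy => (hbd y hy).le) hx) ?_
  have h := le_of_nonneg_operator (a := a) (b := b) (f := fun y => -1 * f y) (M := -M)
    (continuousOn_const.mul hc)
    (fun y hy => contDiffAt_const.mul (hf y hy)) ha hab (fun y hy => ?_)
    (fun y hy => by rw [hbd y hy]; simp) hx
  · linarith
  · rw [lap_const_mul (hf y hy), fderiv_const_mul ((hf y hy).differentiableAt (by simp))]
    have := hL y hy
    simp
    linarith

lemma eq_of_harmonic {f : E4 → ℝ} {ρ M : ℝ}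
    (hc : ContinuousOn f (Metric.closedBall 0 ρ)) (hf : ∀ x : E4, ‖x‖ < ρ → ContDiffAt ℝ 2 f x)
    (hL : ∀ x : E4, ‖x‖ < ρ → lap f x = 0)
    (hbd : ∀ x : E4, ‖x‖ = ρ → f x = M) {x : E4} (hx : ‖x‖ ≤ ρ) : f x = M :=
  eq_of_operator_eq_zero (a := 1) (b := 0) hc hf (by simp) (by simp)
    (fun y hy => by simp [hL y hy]) hbd hx

lemma lap_sub {f g : E4 → ℝ} {x : E4} (hf : ContDiffAt ℝ 2 f x) (hg : ContDiffAt ℝ 2 g x) :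
    lap (fun y => f y - g y) x = lap f x - lap g x := by
  have h : (fun y => f y - g y) = fun y => f y + -1 * g y := by ext; ring
  rw [h, lap_add hf (contDiffAt_const.mul hg), lap_const_mul hg]
  ring

lemma Continuous.lap {f : E4 → ℝ} (hf : ContDiff ℝ 2 f) : Continuous (lap f) :=
  continuous_iff_continuousAt.2 fun x =>
    (hf.contDiffAt.lap (m := 0) (by norm_num [one_add_one_eq_two])).continuousAt

/-- A biharmonic function with vanishing Cauchy data `u`, `⟨x, ∇u⟩` on the sphere is zero: the
function `4 ⟨x, ∇u⟩ + (1 - |x|²) Δu` is harmonic, hence zero, and this is itself an elliptic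
equation without zeroth order term. -/
lemma eq_zero_of_biharmonic {u : E4 → ℝ} (h3 : ContDiff ℝ 3 u)
    (h4 : ContDiffOn ℝ 4 u (Metric.ball 0 1)) (hb : ∀ x : E4, ‖x‖ < 1 → lap (lap u) x = 0)
    (h0 : ∀ x : E4, ‖x‖ = 1 → u x = 0) (h1 : ∀ x : E4, ‖x‖ = 1 → fderiv ℝ u x x = 0)
    {x : E4} (hx : ‖x‖ ≤ 1) : u x = 0 := by
  have h4' (y : E4) (hy : ‖y‖ < 1) : ContDiffAt ℝ 4 u y :=
    h4.contDiffAt (Metric.isOpen_ball.mem_nhds (by simpa using hy))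
  have hu2 : ContDiff ℝ 2 u := h3.of_le (by norm_num)
  have hE (y : E4) (hy : ‖y‖ < 1) : ContDiffAt ℝ 2 (fun z => fderiv ℝ u z z) y :=
    ((h4' y hy).fderiv_right (m := 2) (by norm_num)).clm_apply contDiffAt_id
  have hl (y : E4) (hy : ‖y‖ < 1) : ContDiffAt ℝ 2 (lap u) y :=
    (h4' y hy).lap (by norm_num [add_assoc, one_add_one_eq_two])
  have hp (y : E4) : ContDiffAt ℝ 2 (fun z : E4 => 1 - ‖z‖ ^ 2) y :=
    contDiff_one_sub_norm_sq.contDiffAt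
  have hG : ∀ y : E4, ‖y‖ ≤ 1 → 4 * fderiv ℝ u y y + (1 - ‖y‖ ^ 2) * lap u y = 0 := by
    intro y hy
    refine eq_of_harmonic (f := fun y => 4 * fderiv ℝ u y y + (1 - ‖y‖ ^ 2) * lap u y)
      (ρ := 1) (M := 0) ?_ ?_ ?_ ?_ hy
    · have := Continuous.lap hu2
      have h5 : Continuous fun y => fderiv ℝ u y y :=
        (hu2.continuous_fderiv (by simp)).clm_apply continuous_id
      fun_prop
    · intro z hz
      exact (contDiffAt_const.mul (hE z hz)).add ((hp z).mul (hl z hz))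
    · intro z hz
      rw [lap_add (contDiffAt_const.mul (hE z hz)) ((hp z).mul (hl z hz)),
        lap_const_mul (hE z hz), lap_one_sub_norm_sq_mul (hl z hz), hb z hz,
        lap_fderiv_self ((h4' z hz).of_le (by norm_num))]
      ring
    · intro z hz
      simp [h1 z hz, hz]
  refine eq_of_operator_eq_zero (a := fun y => 1 - ‖y‖ ^ 2) (b := fun _ => 4) (M := 0)
    hu2.continuous.continuousOn (fun y _ => hu2.contDiffAt) ?_ ?_ ?_ h0 hx
  · intro y hy
    nlinarith [norm_nonneg y]
  · intro y hy
    nlinarith [norm_nonneg y]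
  · intro y hy
    linarith [hG y hy.le]

lemma SolBallC3.eqOn {φ u₁ u₂ : E4 → ℝ} (h1 : SolBallC3 φ u₁) (h2 : SolBallC3 φ u₂)
    (h1' : ∀ x : E4, ‖x‖ = 1 → u₁ x = 0) (h2' : ∀ x : E4, ‖x‖ = 1 → u₂ x = 0) :
    Set.EqOn u₁ u₂ (Metric.closedBall 0 1) := by
  intro x hx
  obtain ⟨a3, a4, ab, -, aφ⟩ := h1
  obtain ⟨b3, b4, bb, -, bφ⟩ := h2
  have hnhds (y : E4) (hy : ‖y‖ < 1) : Metric.ball (0 : E4) 1 ∈ 𝓝 y :=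
    Metric.isOpen_ball.mem_nhds (by simpa using hy)
  refine sub_eq_zero.1 (eq_zero_of_biharmonic (u := fun y => u₁ y - u₂ y) (a3.sub b3) (a4.sub b4)
    (fun y hy => ?_) (fun y hy => by simp [h1' y hy, h2' y hy]) (fun y hy => ?_)
    (by simpa using hx))
  · have e : lap (fun y => u₁ y - u₂ y) =ᶠ[𝓝 y] fun y => lap u₁ y - lap u₂ y :=
      Filter.Eventually.of_forall fun z => lap_sub (a3.contDiffAt.of_le (by norm_num))
        (b3.contDiffAt.of_le (by norm_num))
    rw [e.lap_eq, lap_sub, ab y hy, bb y hy, sub_zero]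
    · exact (a4.contDiffAt (hnhds y hy)).lap (by norm_num [add_assoc, one_add_one_eq_two])
    · exact (b4.contDiffAt (hnhds y hy)).lap (by norm_num [add_assoc, one_add_one_eq_two])
  · have e1 := aφ y hy
    have e2 := bφ y hy
    rw [muM] at e1 e2
    rw [fderiv_fun_sub (a3.differentiable (by simp) y) (b3.differentiable (by simp) y)]
    simp
    linarith

section

open MeasureTheory

/-- A rotation invariant finite measure on the unit sphere: the image of Lebesgue measure on the
unit ball under the radial projection. -/
def sphMeas : Measure E4 :=
  (volume.restrict (Metric.ball (0 : E4) 1)).map (fun y => ‖y‖⁻¹ • y)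

lemma measurable_normalize : Measurable (fun y : E4 => ‖y‖⁻¹ • y) :=
  (measurable_norm.inv).smul measurable_id

instance : IsFiniteMeasure (volume.restrict (Metric.ball (0 : E4) 1)) :=
  ⟨by simpa using measure_ball_lt_top⟩

instance : IsFiniteMeasure sphMeas := by
  unfold sphMeas; infer_instance

lemma norm_normalize {y : E4} (hy : y ≠ 0) : ‖‖y‖⁻¹ • y‖ = 1 := by
  rw [norm_smul, norm_inv, norm_norm, inv_mul_cancel₀ (norm_ne_zero_iff.2 hy)]

lemma ae_sphMeas : ∀ᵐ y ∂sphMeas, y ∈ Metric.sphere (0 : E4) 1 := by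
  refine (ae_map_iff measurable_normalize.aemeasurable
    (p := fun y => y ∈ Metric.sphere (0 : E4) 1) Metric.isClosed_sphere.measurableSet).2 ?_
  refine ae_restrict_of_ae ?_
  have h : ∀ᵐ y : E4 ∂volume, y ≠ 0 := by
    simp [ae_iff]
  filter_upwards [h] with y hy
  simpa using norm_normalize hy

lemma sphMeas_restrict : sphMeas.restrict (Metric.sphere (0 : E4) 1) = sphMeas :=
  Measure.restrict_eq_self_of_ae_mem ae_sphMeas

lemma sphMeas_real_univ_pos : 0 < sphMeas.real univ := by
  rw [measureReal_def, ENNReal.toReal_pos_iff]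
  refine ⟨?_, measure_lt_top _ _⟩
  rw [sphMeas, Measure.map_apply measurable_normalize MeasurableSet.univ]
  simpa using Metric.measure_ball_pos volume (0 : E4) one_pos

lemma measurePreserving_sphMeas (L : E4 ≃ₗᵢ[ℝ] E4) : MeasurePreserving L sphMeas sphMeas := by
  have hL : MeasurePreserving L (volume : Measure E4) volume := L.measurePreserving
  have hr := hL.restrict_preimage (s := Metric.ball (0 : E4) 1) Metric.isOpen_ball.measurableSet
  have hpre : L ⁻¹' Metric.ball (0 : E4) 1 = Metric.ball 0 1 := by
    ext y; simp
  rw [hpre] at hr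
  refine ⟨hL.measurable, ?_⟩
  have hcomm : (L : E4 → E4) ∘ (fun y : E4 => ‖y‖⁻¹ • y) = (fun y : E4 => ‖y‖⁻¹ • y) ∘ L := by
    ext1 y; simp
  conv_lhs => rw [sphMeas, Measure.map_map hL.measurable measurable_normalize, hcomm,
    ← Measure.map_map measurable_normalize hL.measurable, hr.map_eq]
  rfl

lemma integrable_sphMeas {F : Type*} [NormedAddCommGroup F] {f : E4 → F}
    (hf : ContinuousOn f (Metric.sphere (0 : E4) 1)) : Integrable f sphMeas := by
  rw [← sphMeas_restrict]
  exact hf.integrableOn_compact' (isCompact_sphere _ _) Metric.isClosed_sphere.measurableSet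

lemma integral_sphMeas_mono {f g : E4 → ℝ} (hf : ContinuousOn f (Metric.sphere (0 : E4) 1))
    (hg : ContinuousOn g (Metric.sphere (0 : E4) 1)) (h : ∀ y : E4, ‖y‖ = 1 → f y ≤ g y) :
    ∫ y, f y ∂sphMeas ≤ ∫ y, g y ∂sphMeas := by
  refine integral_mono_ae (integrable_sphMeas hf) (integrable_sphMeas hg) ?_
  filter_upwards [ae_sphMeas] with y hy using h y (by simpa using hy)

lemma integral_sphMeas_congr {F : Type*} [NormedAddCommGroup F] [NormedSpace ℝ F] {f g : E4 → F}
    (h : ∀ y : E4, ‖y‖ = 1 → f y = g y) :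
    ∫ y, f y ∂sphMeas = ∫ y, g y ∂sphMeas := by
  refine integral_congr_ae ?_
  filter_upwards [ae_sphMeas] with y hy using h y (by simpa using hy)

section Potential

variable {F : Type} [NormedAddCommGroup F] [NormedSpace ℝ F]

/-- The potential of the density `g` on the sphere with respect to the kernel `n (x - y)`. -/
def sphPot (n : E4 → F) (g : E4 → ℝ) (x : E4) : F := ∫ y, g y • n (x - y) ∂sphMeas

lemma sub_ne_zero_of_norm {x y : E4} (hx : ‖x‖ < 1) (hy : ‖y‖ = 1) : x - y ≠ 0 := by
  intro h
  rw [sub_eq_zero] at h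
  rw [h] at hx
  linarith

lemma one_sub_norm_le {x y : E4} (hy : ‖y‖ = 1) : 1 - ‖x‖ ≤ ‖x - y‖ := by
  have := norm_sub_norm_le y x
  rw [norm_sub_rev]
  linarith

lemma continuousOn_kernel {F : Type*} [TopologicalSpace F] {n : E4 → F} (hn : ContinuousOn n {0}ᶜ)
    {x : E4} (hx : ‖x‖ < 1) :
    ContinuousOn (fun y => n (x - y)) (Metric.sphere (0 : E4) 1) :=
  hn.comp (by fun_prop) fun y hy => sub_ne_zero_of_norm hx (by simpa using hy)

lemma integrable_kernel {n : E4 → F} (hn : ContinuousOn n {0}ᶜ) {g : E4 → ℝ}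
    (hg : ContinuousOn g (Metric.sphere (0 : E4) 1)) {x : E4} (hx : ‖x‖ < 1) :
    Integrable (fun y => g y • n (x - y)) sphMeas :=
  integrable_sphMeas (hg.smul (continuousOn_kernel hn hx))

lemma continuousOn_fderiv_kernel {n : E4 → F} {k : WithTop ℕ∞} (hn : ContDiffOn ℝ k n {0}ᶜ)
    (hk : 1 ≤ k) : ContinuousOn (fderiv ℝ n) {0}ᶜ :=
  hn.continuousOn_fderiv_of_isOpen isOpen_compl_singleton hk

lemma hasFDerivAt_sphPot {n : E4 → F} (hn : ContDiffOn ℝ 1 n {0}ᶜ) {g : E4 → ℝ}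
    (hg : ContinuousOn g (Metric.sphere (0 : E4) 1)) {x : E4} (hx : ‖x‖ < 1) :
    HasFDerivAt (sphPot n g) (sphPot (fderiv ℝ n) g x) x := by
  have hn' := continuousOn_fderiv_kernel hn le_rfl
  set ε : ℝ := (1 - ‖x‖) / 2 with hε
  have hε0 : 0 < ε := by linarith
  set K : Set E4 := {z | ε ≤ ‖z‖ ∧ ‖z‖ ≤ 2} with hK
  have hKc : IsCompact K := by
    refine (isCompact_closedBall (0 : E4) 2).of_isClosed_subset ?_ fun z hz => by simpa using hz.2
    exact (isClosed_le continuous_const continuous_norm).inter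
      (isClosed_le continuous_norm continuous_const)
  obtain ⟨M, hM⟩ := hKc.exists_bound_of_continuousOn (hn'.mono fun z hz => by
    have : 0 < ‖z‖ := hε0.trans_le hz.1
    simpa using this)
  obtain ⟨G, hG⟩ := (isCompact_sphere (0 : E4) 1).exists_bound_of_continuousOn hg
  have hball (z : E4) (hz : z ∈ Metric.ball x ε) : ‖z‖ < 1 - ε := by
    have h1 : ‖z - x‖ < ε := by simpa [dist_eq_norm] using hz
    have := norm_le_norm_add_norm_sub x z
    rw [norm_sub_rev] at this
    linarith
  refine hasFDerivAt_integral_of_dominated_of_fderiv_le (F := fun x y => g y • n (x - y))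
    (F' := fun x y => g y • fderiv ℝ n (x - y)) (bound := fun _ => |G| * |M|)
    (Metric.ball_mem_nhds x hε0) ?_ (integrable_kernel hn.continuousOn hg hx)
    (integrable_kernel hn' hg hx).aestronglyMeasurable ?_ (integrable_const _) ?_
  · filter_upwards [Metric.ball_mem_nhds x hε0] with z hz
    exact (integrable_kernel hn.continuousOn hg
      (by linarith [hball z hz])).aestronglyMeasurable
  · filter_upwards [ae_sphMeas] with y hy z hz
    have hyn : ‖y‖ = 1 := by simpa using hy
    rw [norm_smul]
    refine mul_le_mul ((hG y hy).trans (le_abs_self G)) ((hM _ ⟨?_, ?_⟩).trans (le_abs_self M))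
      (norm_nonneg _) (abs_nonneg _)
    · linarith [hball z hz, one_sub_norm_le (x := z) hyn]
    · linarith [hball z hz, norm_sub_le z y]
  · filter_upwards [ae_sphMeas] with y hy z hz
    have hyn : ‖y‖ = 1 := by simpa using hy
    have hz1 : ‖z‖ < 1 := by linarith [hball z hz]
    have h1 : DifferentiableAt ℝ n (z - y) :=
      (hn.differentiableOn (by simp)).differentiableAt
        (isOpen_compl_singleton.mem_nhds (sub_ne_zero_of_norm hz1 hyn))
    have h2 : HasFDerivAt (fun z => n (z - y)) (fderiv ℝ n (z - y)) z :=
      h1.hasFDerivAt.comp z ((hasFDerivAt_id z).sub_const y)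
    exact h2.const_smul (g y)

lemma norm_lt_one_mem_nhds {x : E4} (hx : ‖x‖ < 1) : {y : E4 | ‖y‖ < 1} ∈ 𝓝 x :=
  (isOpen_lt continuous_norm continuous_const).mem_nhds hx

lemma fderiv_sphPot {n : E4 → F} (hn : ContDiffOn ℝ 1 n {0}ᶜ) {g : E4 → ℝ}
    (hg : ContinuousOn g (Metric.sphere (0 : E4) 1)) {x : E4} (hx : ‖x‖ < 1) :
    fderiv ℝ (sphPot n g) =ᶠ[𝓝 x] sphPot (fderiv ℝ n) g := by
  filter_upwards [norm_lt_one_mem_nhds hx] with y hy using (hasFDerivAt_sphPot hn hg hy).fderiv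

lemma contDiffOn_sphPot (k : ℕ) {n : E4 → F} (hn : ContDiffOn ℝ (⊤ : ℕ∞) n {0}ᶜ) {g : E4 → ℝ}
    (hg : ContinuousOn g (Metric.sphere (0 : E4) 1)) :
    ContDiffOn ℝ k (sphPot n g) (Metric.ball 0 1) := by
  have h1 : ContDiffOn ℝ 1 n {0}ᶜ := hn.of_le (by exact_mod_cast le_top)
  induction k generalizing F with
  | zero =>
    rw [Nat.cast_zero, contDiffOn_zero]
    exact fun x hx =>
      (hasFDerivAt_sphPot h1 hg (by simpa using hx)).continuousAt.continuousWithinAt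
  | succ k ih =>
    rw [Nat.cast_succ, contDiffOn_succ_iff_fderiv_of_isOpen Metric.isOpen_ball]
    refine ⟨fun x hx =>
      (hasFDerivAt_sphPot h1 hg (by simpa using hx)).differentiableAt.differentiableWithinAt,
      by simp, ?_⟩
    have hn' : ContDiffOn ℝ (⊤ : ℕ∞) (fderiv ℝ n) {0}ᶜ :=
      hn.fderiv_of_isOpen isOpen_compl_singleton (by norm_cast)
    exact (ih hn' (hn'.of_le (by exact_mod_cast le_top))).congr fun x hx =>
      (hasFDerivAt_sphPot h1 hg (by simpa using hx)).fderiv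

lemma contDiffOn_top_sphPot {n : E4 → F} (hn : ContDiffOn ℝ (⊤ : ℕ∞) n {0}ᶜ) {g : E4 → ℝ}
    (hg : ContinuousOn g (Metric.sphere (0 : E4) 1)) :
    ContDiffOn ℝ (⊤ : ℕ∞) (sphPot n g) (Metric.ball 0 1) :=
  contDiffOn_infty.2 fun k => contDiffOn_sphPot k hn hg

lemma norm_iteratedFDeriv_sphPot_le (k : ℕ) {n : E4 → F} (hn : ContDiffOn ℝ (⊤ : ℕ∞) n {0}ᶜ)
    {g : E4 → ℝ} (hg : ContinuousOn g (Metric.sphere (0 : E4) 1)) {x : E4} (hx : ‖x‖ < 1) :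
    ‖iteratedFDeriv ℝ k (sphPot n g) x‖
      ≤ ∫ y, |g y| * ‖iteratedFDeriv ℝ k n (x - y)‖ ∂sphMeas := by
  induction k generalizing F with
  | zero =>
    simp only [norm_iteratedFDeriv_zero]
    refine (norm_integral_le_integral_norm _).trans (le_of_eq ?_)
    simp [norm_smul]
  | succ k ih =>
    have hn' : ContDiffOn ℝ (⊤ : ℕ∞) (fderiv ℝ n) {0}ᶜ :=
      hn.fderiv_of_isOpen isOpen_compl_singleton (by norm_cast)
    rw [← norm_iteratedFDeriv_fderiv]
    simp only [← norm_iteratedFDeriv_fderiv (n := k) (f := n)]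
    rw [((fderiv_sphPot (hn.of_le (by exact_mod_cast le_top)) hg hx).iteratedFDeriv ℝ k).eq_of_nhds]
    exact ih hn'

lemma pd_sphPot {n : E4 → ℝ} (hn : ContDiffOn ℝ 1 n {0}ᶜ) {g : E4 → ℝ}
    (hg : ContinuousOn g (Metric.sphere (0 : E4) 1)) {x : E4} (hx : ‖x‖ < 1) (i : Fin 4) :
    pd i (sphPot n g) x = sphPot (pd i n) g x := by
  rw [pd, (hasFDerivAt_sphPot hn hg hx).fderiv, sphPot,
    ContinuousLinearMap.integral_apply
      (integrable_kernel (continuousOn_fderiv_kernel hn le_rfl) hg hx)]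
  rfl

lemma lap_sphPot {n : E4 → ℝ} (hn : ContDiffOn ℝ (⊤ : ℕ∞) n {0}ᶜ) {g : E4 → ℝ}
    (hg : ContinuousOn g (Metric.sphere (0 : E4) 1)) {x : E4} (hx : ‖x‖ < 1) :
    lap (sphPot n g) x = sphPot (lap n) g x := by
  have h1 : ContDiffOn ℝ 1 n {0}ᶜ := hn.of_le (by exact_mod_cast le_top)
  have hm (i : Fin 4) : ContDiffOn ℝ 1 (pd i n) {0}ᶜ :=
    fun y hy => ((hn.contDiffAt (isOpen_compl_singleton.mem_nhds hy)).pd (m := 1)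
      (by norm_cast) i).contDiffWithinAt
  have hmm (i : Fin 4) : ContinuousOn (pd i (pd i n)) {0}ᶜ :=
    fun y hy => (((hm i).contDiffAt (isOpen_compl_singleton.mem_nhds hy)).pd (m := 0)
      (by simp) i).continuousAt.continuousWithinAt
  have e (i : Fin 4) : pd i (pd i (sphPot n g)) x = sphPot (pd i (pd i n)) g x := by
    have : pd i (sphPot n g) =ᶠ[𝓝 x] sphPot (pd i n) g := by
      filter_upwards [norm_lt_one_mem_nhds hx] with y hy using pd_sphPot h1 hg hy i
    rw [(this.pd_eq i).eq_of_nhds, pd_sphPot (hm i) hg hx]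
  simp only [lap_eq_sum_pd, e, sphPot]
  rw [← integral_finsetSum]
  · refine integral_congr_ae (Filter.Eventually.of_forall fun y => ?_)
    simp [Finset.mul_sum]
  · exact fun i _ => integrable_kernel (hmm i) hg hx

end Potential

lemma hasFDerivAt_norm_rpow_of_ne {z : E4} (hz : z ≠ 0) (s : ℝ) :
    HasFDerivAt (fun y : E4 => ‖y‖ ^ s) ((s * ‖z‖ ^ (s - 2)) • innerSL ℝ z) z := by
  have hz' : 0 < ‖z‖ := norm_pos_iff.2 hz
  have h := (hasStrictFDerivAt_norm_sq z).hasFDerivAt.rpow_const (p := s / 2)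
    (Or.inl (by positivity))
  have e (y : E4) (t : ℝ) : (‖y‖ ^ 2) ^ t = ‖y‖ ^ (2 * t) := by
    rw [rpow_mul (norm_nonneg y)]; norm_num
  simp only [e] at h
  have e1 : 2 * (s / 2) = s := by ring
  have e2 : 2 * (s / 2 - 1) = s - 2 := by ring
  rw [e2] at h
  simp only [e1] at h
  have e3 : (s * ‖z‖ ^ (s - 2)) • innerSL ℝ z
      = (s / 2 * ‖z‖ ^ (s - 2)) • 2 • innerSL ℝ z := by
    ext v
    simp
    ring
  rw [e3]
  exact h

lemma contDiffOn_norm_rpow (s : ℝ) {n : WithTop ℕ∞} :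
    ContDiffOn ℝ n (fun y : E4 => ‖y‖ ^ s) {0}ᶜ := fun _ hy =>
  ((contDiffAt_norm ℝ hy).rpow_const_of_ne (norm_ne_zero_iff.2 hy)).contDiffWithinAt

lemma pd_norm_rpow {z : E4} (hz : z ≠ 0) (s : ℝ) (i : Fin 4) :
    pd i (fun y : E4 => ‖y‖ ^ s) z = s * (‖z‖ ^ (s - 2) * z i) := by
  rw [pd, (hasFDerivAt_norm_rpow_of_ne hz s).fderiv]
  simp [inner_e4]
  ring

lemma lap_norm_rpow {z : E4} (hz : z ≠ 0) (s : ℝ) :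
    lap (fun y : E4 => ‖y‖ ^ s) z = s * (s + 2) * ‖z‖ ^ (s - 2) := by
  have h2 (i : Fin 4) : pd i (pd i (fun y : E4 => ‖y‖ ^ s)) z
      = s * (‖z‖ ^ (s - 2) + (s - 2) * (‖z‖ ^ (s - 2 - 2) * (z i) ^ 2)) := by
    have e : pd i (fun y : E4 => ‖y‖ ^ s) =ᶠ[𝓝 z] fun y => s * (‖y‖ ^ (s - 2) * y i) := by
      filter_upwards [isOpen_compl_singleton.mem_nhds hz] with y hy using pd_norm_rpow hy s i
    have hd := (hasFDerivAt_norm_rpow_of_ne hz (s - 2)).differentiableAt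
    have hc := (hasFDerivAt_coord i z).differentiableAt
    rw [(e.pd_eq i).eq_of_nhds, pd_const_mul (hd.fun_mul hc), pd_mul hd hc, pd_norm_rpow hz,
      pd_coord]
    simp only [if_true]
    ring
  rw [lap_eq_sum_pd]
  simp only [h2]
  rw [← Finset.mul_sum, Finset.sum_add_distrib, ← Finset.mul_sum, ← Finset.mul_sum,
    ← EuclideanSpace.real_norm_sq_eq]
  have : ‖z‖ ^ (s - 2) = ‖z‖ ^ (s - 2 - 2) * ‖z‖ ^ 2 := by
    rw [← rpow_natCast, ← rpow_add (norm_pos_iff.2 hz)]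
    congr 1; push_cast; ring
  rw [this]
  simp
  ring

/-- The Poisson integral, up to a multiplicative constant. -/
def poisson (g : E4 → ℝ) (x : E4) : ℝ :=
  (1 - ‖x‖ ^ 2) * sphPot (fun z : E4 => ‖z‖ ^ (-4 : ℝ)) g x

lemma contDiffAt_sphPot {n : E4 → ℝ} (hn : ContDiffOn ℝ (⊤ : ℕ∞) n {0}ᶜ) {g : E4 → ℝ}
    (hg : ContinuousOn g (Metric.sphere (0 : E4) 1)) {x : E4} (hx : ‖x‖ < 1) (k : ℕ) :
    ContDiffAt ℝ k (sphPot n g) x :=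
  (contDiffOn_sphPot k hn hg).contDiffAt (Metric.isOpen_ball.mem_nhds (by simpa using hx))

lemma contDiffAt_poisson {g : E4 → ℝ} (hg : ContinuousOn g (Metric.sphere (0 : E4) 1)) {x : E4}
    (hx : ‖x‖ < 1) (k : ℕ) : ContDiffAt ℝ k (poisson g) x :=
  contDiff_one_sub_norm_sq.contDiffAt.mul (contDiffAt_sphPot (contDiffOn_norm_rpow _) hg hx k)

lemma lap_poisson {g : E4 → ℝ} (hg : ContinuousOn g (Metric.sphere (0 : E4) 1)) {x : E4}
    (hx : ‖x‖ < 1) : lap (poisson g) x = 0 := by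
  set n : E4 → ℝ := fun z => ‖z‖ ^ (-4 : ℝ) with hn
  have hns : ContDiffOn ℝ (⊤ : ℕ∞) n {0}ᶜ := contDiffOn_norm_rpow _
  have h1 : ContDiffOn ℝ 1 n {0}ᶜ := contDiffOn_norm_rpow _
  have hF := integrable_kernel (continuousOn_fderiv_kernel h1 le_rfl) hg hx
  have hl : ContinuousOn (lap n) {0}ᶜ := fun y hy =>
    ((hns.contDiffAt (isOpen_compl_singleton.mem_nhds hy)).lap (m := 0)
      (by norm_cast)).continuousAt.continuousWithinAt
  have hf : fderiv ℝ (sphPot n g) x x = ∫ y, g y * fderiv ℝ n (x - y) x ∂sphMeas := by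
    rw [(hasFDerivAt_sphPot h1 hg hx).fderiv, sphPot, ContinuousLinearMap.integral_apply hF]
    rfl
  have hF' : Integrable (fun y => g y * fderiv ℝ n (x - y) x) sphMeas :=
    hF.apply_continuousLinearMap x
  have hI : Integrable (fun y => (1 - ‖x‖ ^ 2) * g y • lap n (x - y)
      - 4 * (g y * fderiv ℝ n (x - y) x)) sphMeas :=
    ((integrable_kernel hl hg hx).const_mul _).sub (hF'.const_mul _)
  change lap (fun y => (1 - ‖y‖ ^ 2) * sphPot n g y) x = 0
  rw [lap_one_sub_norm_sq_mul (by exact_mod_cast contDiffAt_sphPot hns hg hx 2),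
    lap_sphPot hns hg hx, hf]
  simp only [sphPot]
  rw [← integral_const_mul, ← integral_const_mul, ← integral_const_mul,
    ← integral_sub ((integrable_kernel hl hg hx).const_mul _) (hF'.const_mul _),
    ← integral_sub hI ((integrable_kernel hns.continuousOn hg hx).const_mul _)]
  rw [integral_sphMeas_congr (g := fun _ => 0), integral_zero]
  intro y hy
  have hz := sub_ne_zero_of_norm hx hy
  have e1 : fderiv ℝ n (x - y) x = -4 * ‖x - y‖ ^ (-6 : ℝ) * inner ℝ (x - y) x := by
    rw [(hasFDerivAt_norm_rpow_of_ne hz (-4)).fderiv]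
    rw [smul_apply, smul_eq_mul, innerSL_apply_apply]
    norm_num [-mul_eq_mul_left_iff, -mul_eq_mul_right_iff]
  have e2 : lap n (x - y) = 8 * ‖x - y‖ ^ (-6 : ℝ) := by
    rw [lap_norm_rpow hz]; norm_num
  have e3 : n (x - y) = ‖x - y‖ ^ (-6 : ℝ) * ‖x - y‖ ^ 2 := by
    rw [hn, ← rpow_natCast, ← rpow_add (norm_pos_iff.2 hz)]
    norm_num
  have e4 : ‖x - y‖ ^ 2 = ‖x‖ ^ 2 - 2 * inner ℝ x y + 1 := by
    rw [norm_sub_sq_real, hy]; norm_num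
  have e5 : inner ℝ (x - y) x = ‖x‖ ^ 2 - inner ℝ x y := by
    rw [inner_sub_left, real_inner_self_eq_norm_sq, real_inner_comm]
  simp only [e1, e2, e3, e4, e5, smul_eq_mul]
  ring

lemma exists_isometry_map_eq {x y : E4} (h : ‖x‖ = ‖y‖) : ∃ L : E4 ≃ₗᵢ[ℝ] E4, L x = y :=
  ⟨_, Submodule.reflection_sub h⟩

lemma sphPot_norm_rpow_eq {x y : E4} (h : ‖x‖ = ‖y‖) (s : ℝ) :
    sphPot (fun z : E4 => ‖z‖ ^ s) 1 x = sphPot (fun z : E4 => ‖z‖ ^ s) 1 y := by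
  obtain ⟨L, rfl⟩ := exists_isometry_map_eq h
  have h := (measurePreserving_sphMeas L).integral_comp L.toHomeomorph.measurableEmbedding
    (fun y => (1 : E4 → ℝ) y • ‖L x - y‖ ^ s)
  rw [sphPot, sphPot, ← h]
  simp [← map_sub]

lemma poisson_one {x : E4} (hx : ‖x‖ < 1) : poisson 1 x = sphMeas.real univ := by
  have hg : ContinuousOn (1 : E4 → ℝ) (Metric.sphere (0 : E4) 1) := continuousOn_const
  have h : poisson 1 0 = poisson 1 x :=
    eq_of_harmonic (f := poisson 1) (ρ := ‖x‖) (M := poisson 1 x)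
      (fun y hy => (contDiffAt_poisson hg (lt_of_le_of_lt (by simpa using hy) hx)
        0).continuousAt.continuousWithinAt)
      (fun y hy => by exact_mod_cast contDiffAt_poisson hg (hy.trans hx) 2)
      (fun y hy => lap_poisson hg (hy.trans hx))
      (fun y hy => by rw [poisson, poisson, sphPot_norm_rpow_eq hy, hy]) (by simp)
  rw [← h, poisson, sphPot, integral_sphMeas_congr (g := fun _ => (1 : ℝ))]
  · simp
  · intro y hy; simp [hy]

lemma integral_norm_rpow_neg_four_le {x : E4} (hx : ‖x‖ < 1) :
    ∫ y, ‖x - y‖ ^ (-4 : ℝ) ∂sphMeas ≤ sphMeas.real univ * (1 - ‖x‖)⁻¹ := by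
  have h := poisson_one hx
  have hc : 0 < sphMeas.real univ := sphMeas_real_univ_pos
  simp only [poisson, sphPot, Pi.one_apply, one_smul] at h
  have h0 : 0 ≤ ∫ y, ‖x - y‖ ^ (-4 : ℝ) ∂sphMeas := integral_nonneg fun y => by positivity
  rw [← div_eq_mul_inv, le_div_iff₀ (by linarith)]
  nlinarith [mul_nonneg (mul_nonneg h0 (norm_nonneg x)) (sub_nonneg.2 hx.le)]

lemma continuousOn_norm_rpow {x : E4} (hx : ‖x‖ < 1) (s : ℝ) :
    ContinuousOn (fun y : E4 => ‖x - y‖ ^ s) (Metric.sphere (0 : E4) 1) :=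
  continuousOn_kernel (n := fun z : E4 => ‖z‖ ^ s)
    (contDiffOn_norm_rpow s (n := 0)).continuousOn hx

lemma exists_integral_norm_rpow_le {β : ℝ} (hβ0 : 0 < β) (hβ1 : β < 1) :
    ∃ C : ℝ, 0 ≤ C ∧ ∀ x : E4, ‖x‖ < 1 →
      ∫ y, ‖x - y‖ ^ (β - 4) ∂sphMeas ≤ C * (1 - ‖x‖) ^ (β - 1) := by
  set c := sphMeas.real univ with hc
  have hc0 : 0 < c := sphMeas_real_univ_pos
  set A := (4 - β) * c / (1 - β) with hA
  have hA0 : 0 ≤ A := div_nonneg (mul_nonneg (by linarith) hc0.le) (by linarith)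
  refine ⟨c + A, by positivity, fun x hx => ?_⟩
  set n : E4 → ℝ := fun z => ‖z‖ ^ (β - 4) with hn
  have h1 : ContDiffOn ℝ 1 n {0}ᶜ := contDiffOn_norm_rpow _
  have hg : ContinuousOn (1 : E4 → ℝ) (Metric.sphere (0 : E4) 1) := continuousOn_const
  have hr0 := norm_nonneg x
  have htx (t : ℝ) (ht : t ∈ Icc (0 : ℝ) 1) : ‖t • x‖ < 1 ∧ ‖t • x‖ = t * ‖x‖ := by
    have e : ‖t • x‖ = t * ‖x‖ := by rw [norm_smul, norm_of_nonneg ht.1]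
    refine ⟨?_, e⟩
    rw [e]
    nlinarith [ht.1, ht.2]
  have hder (t : ℝ) (ht : t ∈ Icc (0 : ℝ) 1) : HasDerivAt (fun t : ℝ => sphPot n 1 (t • x))
      (sphPot (fderiv ℝ n) 1 (t • x) x) t := by
    have h2 : HasDerivAt (fun s : ℝ => s • x) x t := by
      simpa using (hasDerivAt_id t).smul_const x
    exact (hasFDerivAt_sphPot h1 hg (htx t ht).1).comp_hasDerivAt t h2
  have hbase (t : ℝ) (ht : t ∈ Icc (0 : ℝ) 1) : 0 < 1 - t * ‖x‖ := by
    have := htx t ht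
    linarith
  have hderB (t : ℝ) (ht : t ∈ Icc (0 : ℝ) 1) :
      HasDerivAt (fun t : ℝ => c + A * (1 - t * ‖x‖) ^ (β - 1))
        ((4 - β) * c * ‖x‖ * (1 - t * ‖x‖) ^ (β - 2)) t := by
    have h2 : HasDerivAt (fun t : ℝ => 1 - t * ‖x‖) (-‖x‖) t := by
      simpa using ((hasDerivAt_id t).mul_const ‖x‖).const_sub 1
    have h3 := ((h2.rpow_const (p := β - 1) (Or.inl (hbase t ht).ne')).const_mul A).const_add c
    have e : β - 1 - 1 = β - 2 := by ring
    have e2 : 1 - β ≠ 0 := by linarith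
    have e3 : (4 - β) * c * ‖x‖ * (1 - t * ‖x‖) ^ (β - 2)
        = A * (-‖x‖ * (β - 1) * (1 - t * ‖x‖) ^ (β - 1 - 1)) := by
      rw [e, hA]
      field_simp
      ring
    rw [e3]
    exact h3
  have hbound (t : ℝ) (ht : t ∈ Icc (0 : ℝ) 1) : ‖sphPot (fderiv ℝ n) 1 (t • x) x‖
      ≤ (4 - β) * c * ‖x‖ * (1 - t * ‖x‖) ^ (β - 2) := by
    obtain ⟨ht1, ht2⟩ := htx t ht
    have hb := hbase t ht
    calc ‖sphPot (fderiv ℝ n) 1 (t • x) x‖ ≤ ‖sphPot (fderiv ℝ n) 1 (t • x)‖ * ‖x‖ :=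
          ContinuousLinearMap.le_opNorm _ _
      _ ≤ (∫ y, ‖fderiv ℝ n (t • x - y)‖ ∂sphMeas) * ‖x‖ := by
          gcongr
          refine (norm_integral_le_integral_norm _).trans (le_of_eq ?_)
          simp
      _ ≤ (∫ y, (4 - β) * (1 - t * ‖x‖) ^ (β - 1) * ‖t • x - y‖ ^ (-4 : ℝ) ∂sphMeas) * ‖x‖ := by
          refine mul_le_mul_of_nonneg_right (integral_sphMeas_mono
            (g := fun y => (4 - β) * (1 - t * ‖x‖) ^ (β - 1) * ‖t • x - y‖ ^ (-4 : ℝ))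
            (continuousOn_kernel (continuousOn_fderiv_kernel h1 le_rfl) ht1).norm
            (continuousOn_const.mul (continuousOn_norm_rpow ht1 _)) fun y hy => ?_) (norm_nonneg x)
          have hz := sub_ne_zero_of_norm ht1 hy
          have hz0 := norm_pos_iff.2 hz
          rw [(hasFDerivAt_norm_rpow_of_ne hz (β - 4)).fderiv, norm_smul, innerSL_apply_norm,
            norm_mul, norm_of_nonpos (by linarith : β - 4 ≤ 0), norm_of_nonneg (by positivity)]
          have e1 : ‖t • x - y‖ ^ (β - 4 - 2) * ‖t • x - y‖
              = ‖t • x - y‖ ^ (β - 1) * ‖t • x - y‖ ^ (-4 : ℝ) := by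
            rw [← rpow_add hz0, ← rpow_add_one hz0.ne']
            congr 1; ring
          have e2 : ‖t • x - y‖ ^ (β - 1) ≤ (1 - t * ‖x‖) ^ (β - 1) := by
            refine rpow_le_rpow_of_nonpos hb ?_ (by linarith)
            rw [← ht2]
            exact one_sub_norm_le hy
          rw [mul_assoc, e1, neg_sub, mul_assoc]
          have : 0 ≤ 4 - β := by linarith
          gcongr
      _ ≤ ((4 - β) * (1 - t * ‖x‖) ^ (β - 1) * (c * (1 - t * ‖x‖)⁻¹)) * ‖x‖ := by
          rw [integral_const_mul]
          have := integral_norm_rpow_neg_four_le ht1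
          rw [ht2] at this
          have : 0 ≤ 4 - β := by linarith
          gcongr
      _ = (4 - β) * c * ‖x‖ * (1 - t * ‖x‖) ^ (β - 2) := by
          have e : (1 - t * ‖x‖) ^ (β - 2) = (1 - t * ‖x‖) ^ (β - 1) * (1 - t * ‖x‖)⁻¹ := by
            rw [← rpow_neg_one, ← rpow_add hb]
            congr 1; ring
          rw [e]; ring
  have hfin := image_norm_le_of_norm_deriv_right_le_deriv_boundary' (a := 0) (b := 1)
    (f := fun t : ℝ => sphPot n 1 (t • x))
    (fun t ht => (hder t ht).continuousAt.continuousWithinAt)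
    (fun t ht => (hder t (Ico_subset_Icc_self ht)).hasDerivWithinAt)
    (B := fun t : ℝ => c + A * (1 - t * ‖x‖) ^ (β - 1)) ?_
    (fun t ht => (hderB t ht).continuousAt.continuousWithinAt)
    (fun t ht => (hderB t (Ico_subset_Icc_self ht)).hasDerivWithinAt)
    (fun t ht => hbound t (Ico_subset_Icc_self ht)) (right_mem_Icc.2 zero_le_one)
  · simp only [one_smul, one_mul] at hfin
    have h2 : ∫ y, ‖x - y‖ ^ (β - 4) ∂sphMeas = sphPot n 1 x := by simp [sphPot, hn]
    have h3 : 1 ≤ (1 - ‖x‖) ^ (β - 1) :=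
      one_le_rpow_of_pos_of_le_one_of_nonpos (by linarith) (by linarith) (by linarith)
    rw [h2]
    refine (le_abs_self _).trans (hfin.trans ?_)
    nlinarith
  · have h2 : sphPot n 1 0 = c := by
      rw [sphPot, integral_sphMeas_congr (g := fun _ => (1 : ℝ))]
      · simp [hc]
      · intro y hy; simp [hy, hn]
    simp [h2, abs_of_pos hc0, hA0]

lemma exists_norm_iteratedFDeriv_le_of_homogeneous {F : Type} [NormedAddCommGroup F]
    [NormedSpace ℝ F] (k : ℕ) {f : E4 → F} (hf : ContDiffOn ℝ (⊤ : ℕ∞) f {0}ᶜ) {s : ℝ}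
    (hs : ∀ t : ℝ, 0 < t → ∀ z, f (t • z) = t ^ s • f z) :
    ∃ C : ℝ, 0 ≤ C ∧ ∀ z : E4, z ≠ 0 → ‖iteratedFDeriv ℝ k f z‖ ≤ C * ‖z‖ ^ (s - k) := by
  induction k generalizing F s with
  | zero =>
    obtain ⟨C, hC⟩ := (isCompact_sphere (0 : E4) 1).exists_bound_of_continuousOn
      (hf.continuousOn.mono fun z hz => by
        rintro rfl
        simp at hz)
    refine ⟨max C 0, le_max_right _ _, fun z hz => ?_⟩
    have hz0 : 0 < ‖z‖ := norm_pos_iff.2 hz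
    have h := hs ‖z‖ hz0 (‖z‖⁻¹ • z)
    rw [smul_smul, mul_inv_cancel₀ hz0.ne', one_smul] at h
    rw [norm_iteratedFDeriv_zero, h, norm_smul, norm_of_nonneg (by positivity), mul_comm]
    have := hC (‖z‖⁻¹ • z) (by simpa using norm_normalize hz)
    simp only [Nat.cast_zero, sub_zero]
    gcongr
    exact this.trans (le_max_left _ _)
  | succ k ih =>
    have hf' : ContDiffOn ℝ (⊤ : ℕ∞) (fderiv ℝ f) {0}ᶜ :=
      hf.fderiv_of_isOpen isOpen_compl_singleton (by norm_cast)
    have hs' : ∀ t : ℝ, 0 < t → ∀ z, fderiv ℝ f (t • z) = t ^ (s - 1) • fderiv ℝ f z := by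
      intro t ht z
      have h1 : (fun z => f (t • z)) = fun z => t ^ s • f z := funext fun z => hs t ht z
      have h2 := fderiv_comp_smul (f := f) (x := z) t
      rw [h1] at h2
      change fderiv ℝ (t ^ s • f) z = _ at h2
      rw [fderiv_const_smul_field] at h2
      rw [rpow_sub_one ht.ne', div_eq_inv_mul, mul_smul]
      change t ^ s • fderiv ℝ f z = _ at h2
      rw [h2, smul_smul, inv_mul_cancel₀ ht.ne', one_smul]
    obtain ⟨C, hC0, hC⟩ := ih hf' hs'
    refine ⟨C, hC0, fun z hz => ?_⟩
    rw [← norm_iteratedFDeriv_fderiv]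
    refine (hC z hz).trans (le_of_eq ?_)
    congr 2
    push_cast
    ring

lemma exists_norm_iteratedFDeriv_norm_rpow_le (k : ℕ) (s : ℝ) :
    ∃ C : ℝ, 0 ≤ C ∧ ∀ z : E4, z ≠ 0 →
      ‖iteratedFDeriv ℝ k (fun z : E4 => ‖z‖ ^ s) z‖ ≤ C * ‖z‖ ^ (s - k) :=
  exists_norm_iteratedFDeriv_le_of_homogeneous k (contDiffOn_norm_rpow s) fun t ht z => by
    rw [norm_smul, norm_of_nonneg ht.le, mul_rpow ht.le (norm_nonneg z), smul_eq_mul]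

lemma norm_sub_le_of_eq_smul {x y ζ : E4} (hx : ‖x‖ < 1) (hy : ‖y‖ = 1) (hζ : ‖ζ‖ = 1)
    (h : x = ‖x‖ • ζ) : ‖y - ζ‖ ≤ 2 * ‖x - y‖ := by
  have h1 : ‖x - ζ‖ = 1 - ‖x‖ := by
    have : x - ζ = (‖x‖ - 1) • ζ := by
      rw [sub_smul, ← h, one_smul]
    rw [this, norm_smul, hζ, mul_one, norm_of_nonpos (by linarith)]
    ring
  have h2 : y - ζ = (x - ζ) - (x - y) := by abel
  have h3 := norm_sub_le (x - ζ) (x - y)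
  rw [← h2] at h3
  linarith [one_sub_norm_le (x := x) hy]

lemma norm_sub_le_two {x y : E4} (hx : ‖x‖ < 1) (hy : ‖y‖ = 1) : ‖x - y‖ ≤ 2 := by
  have := norm_sub_le x y
  linarith

lemma exists_abs_poisson_sub_le : ∃ C : ℝ, 0 ≤ C ∧ ∀ (g : E4 → ℝ) (L : ℝ) (x ζ : E4),
    ContinuousOn g (Metric.sphere (0 : E4) 1) → 0 ≤ L → ‖x‖ < 1 → ‖ζ‖ = 1 → x = ‖x‖ • ζ →
    (∀ y : E4, ‖y‖ = 1 → |g y - g ζ| ≤ L * ‖y - ζ‖) →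
      |poisson g x - sphMeas.real univ * g ζ| ≤ C * L * (1 - ‖x‖) ^ (1 / 2 : ℝ) := by
  obtain ⟨C, hC0, hC⟩ := exists_integral_norm_rpow_le (β := 1 / 2) (by norm_num) (by norm_num)
  refine ⟨8 * C, by positivity, fun g L x ζ hg hL hx hζ hxζ h => ?_⟩
  have hp : 0 < 1 - ‖x‖ := by linarith
  have hp2 : 1 - ‖x‖ ^ 2 ≤ 2 * (1 - ‖x‖) := by nlinarith [norm_nonneg x]
  have hp3 : 0 ≤ 1 - ‖x‖ ^ 2 := by nlinarith [norm_nonneg x]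
  have h1 : ContinuousOn (fun _ : E4 => g ζ) (Metric.sphere (0 : E4) 1) := continuousOn_const
  have hk : ContinuousOn (fun z : E4 => ‖z‖ ^ (-4 : ℝ)) {0}ᶜ :=
    (contDiffOn_norm_rpow _ (n := 0)).continuousOn
  have e : poisson g x - sphMeas.real univ * g ζ
      = (1 - ‖x‖ ^ 2) * ∫ y, (g y - g ζ) * ‖x - y‖ ^ (-4 : ℝ) ∂sphMeas := by
    rw [← poisson_one hx, poisson, poisson, mul_assoc, mul_comm _ (g ζ), ← mul_sub]
    congr 1
    have a1 : Integrable (fun y => g y * ‖x - y‖ ^ (-4 : ℝ)) sphMeas := integrable_kernel hk hg hx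
    have a2 : Integrable (fun y => g ζ * ‖x - y‖ ^ (-4 : ℝ)) sphMeas := integrable_kernel hk h1 hx
    simp only [sphPot, sub_mul, smul_eq_mul]
    rw [integral_sub a1 a2, integral_const_mul]
    simp
  have h2 : ∀ y : E4, ‖y‖ = 1 →
      ‖(g y - g ζ) * ‖x - y‖ ^ (-4 : ℝ)‖ ≤ 4 * L * ‖x - y‖ ^ ((1 / 2 : ℝ) - 4) := by
    intro y hy
    have hz0 : 0 < ‖x - y‖ := norm_pos_iff.2 (sub_ne_zero_of_norm hx hy)
    rw [norm_mul, norm_of_nonneg (by positivity : 0 ≤ ‖x - y‖ ^ (-4 : ℝ)), Real.norm_eq_abs]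
    have e1 : ‖x - y‖ * ‖x - y‖ ^ (-4 : ℝ)
        = ‖x - y‖ ^ (1 / 2 : ℝ) * ‖x - y‖ ^ ((1 / 2 : ℝ) - 4) := by
      rw [← rpow_one_add' hz0.le (by norm_num), ← rpow_add hz0]
      norm_num
    have e2 : ‖x - y‖ ^ (1 / 2 : ℝ) ≤ 2 := by
      calc ‖x - y‖ ^ (1 / 2 : ℝ) ≤ 2 ^ (1 / 2 : ℝ) :=
            rpow_le_rpow hz0.le (norm_sub_le_two hx hy) (by norm_num)
        _ ≤ 2 ^ (1 : ℝ) := rpow_le_rpow_of_exponent_le (by norm_num) (by norm_num)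
        _ = 2 := by norm_num
    calc |g y - g ζ| * ‖x - y‖ ^ (-4 : ℝ)
        ≤ L * (2 * ‖x - y‖) * ‖x - y‖ ^ (-4 : ℝ) := by
          gcongr
          exact (h y hy).trans (by gcongr; exact norm_sub_le_of_eq_smul hx hy hζ hxζ)
      _ = 2 * L * (‖x - y‖ ^ (1 / 2 : ℝ) * ‖x - y‖ ^ ((1 / 2 : ℝ) - 4)) := by rw [← e1]; ring
      _ ≤ 2 * L * (2 * ‖x - y‖ ^ ((1 / 2 : ℝ) - 4)) := by gcongr
      _ = _ := by ring
  rw [e, abs_mul, abs_of_nonneg hp3]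
  have h3 : |∫ y, (g y - g ζ) * ‖x - y‖ ^ (-4 : ℝ) ∂sphMeas|
      ≤ 4 * L * (C * (1 - ‖x‖) ^ ((1 / 2 : ℝ) - 1)) := by
    rw [← Real.norm_eq_abs]
    refine (norm_integral_le_integral_norm _).trans ?_
    refine (integral_sphMeas_mono (g := fun y => 4 * L * ‖x - y‖ ^ ((1 / 2 : ℝ) - 4))
      ((hg.sub h1).mul (continuousOn_norm_rpow hx _)).norm
      (continuousOn_const.mul (continuousOn_norm_rpow hx _)) h2).trans ?_
    rw [integral_const_mul]
    exact mul_le_mul_of_nonneg_left (hC x hx) (by positivity)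
  calc (1 - ‖x‖ ^ 2) * |∫ y, (g y - g ζ) * ‖x - y‖ ^ (-4 : ℝ) ∂sphMeas|
      ≤ 2 * (1 - ‖x‖) * (4 * L * (C * (1 - ‖x‖) ^ ((1 / 2 : ℝ) - 1))) := by
        gcongr
    _ = 8 * C * L * ((1 - ‖x‖) * (1 - ‖x‖) ^ ((1 / 2 : ℝ) - 1)) := by ring
    _ = _ := by
        rw [← rpow_one_add' hp.le (by norm_num)]
        norm_num

lemma exists_smul_norm_eq (x : E4) : ∃ ζ : E4, ‖ζ‖ = 1 ∧ x = ‖x‖ • ζ := by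
  by_cases hx : x = 0
  · exact ⟨e4 0, norm_e4 0, by simp [hx]⟩
  · exact ⟨‖x‖⁻¹ • x, norm_normalize hx,
      by rw [smul_smul, mul_inv_cancel₀ (norm_ne_zero_iff.2 hx), one_smul]⟩

lemma tendsto_rpow_half_one_sub :
    Filter.Tendsto (fun ρ : ℝ => (1 - ρ) ^ (1 / 2 : ℝ)) (𝓝[<] 1) (𝓝 0) := by
  have h : Continuous fun ρ : ℝ => (1 - ρ) ^ (1 / 2 : ℝ) :=
    (continuous_const.sub continuous_id).rpow_const fun _ => Or.inr (by norm_num)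
  have := h.tendsto 1
  norm_num at this
  exact this.mono_left nhdsWithin_le_nhds

/-- The Poisson integral of a smooth function with constant Laplacian. -/
lemma poisson_eq_of_lap_eq {b : E4 → ℝ} (hb : ContDiff ℝ 2 b) {κ : ℝ}
    (hl : ∀ x, lap b x = 8 * κ) {x : E4} (hx : ‖x‖ < 1) :
    poisson b x = sphMeas.real univ * (b x + κ * (1 - ‖x‖ ^ 2)) := by
  set c := sphMeas.real univ with hc
  have hc0 : 0 < c := sphMeas_real_univ_pos
  set H : E4 → ℝ := fun x => b x + κ * (1 - ‖x‖ ^ 2) with hH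
  have hHs : ContDiff ℝ 2 H := hb.add (contDiff_const.mul contDiff_one_sub_norm_sq)
  have hcH (y : E4) : ContDiffAt ℝ 2 (fun y => c * H y) y := contDiffAt_const.mul hHs.contDiffAt
  have hg : ContinuousOn b (Metric.sphere (0 : E4) 1) := hb.continuous.continuousOn
  set D : E4 → ℝ := fun y => poisson b y - c * H y with hD
  have hDs (y : E4) (hy : ‖y‖ < 1) : ContDiffAt ℝ 2 D y :=
    ContDiffAt.sub (by exact_mod_cast contDiffAt_poisson hg hy 2) (hcH y)
  have hDl (y : E4) (hy : ‖y‖ < 1) : lap D y = 0 := by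
    rw [hD, lap_sub (by exact_mod_cast contDiffAt_poisson hg hy 2) (hcH y), lap_poisson hg hy,
      lap_const_mul hHs.contDiffAt, hH,
      lap_add hb.contDiffAt (contDiffAt_const.mul contDiff_one_sub_norm_sq.contDiffAt), hl,
      lap_const_mul contDiff_one_sub_norm_sq.contDiffAt, lap_one_sub_norm_sq]
    ring
  obtain ⟨K₁, hK₁⟩ := hb.contDiffOn.exists_lipschitzOnWith (by norm_num)
    (convex_closedBall (0 : E4) 1) (isCompact_closedBall _ _)
  obtain ⟨K₂, hK₂⟩ := hHs.contDiffOn.exists_lipschitzOnWith (by norm_num)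
    (convex_closedBall (0 : E4) 1) (isCompact_closedBall _ _)
  obtain ⟨C, hC0, hC⟩ := exists_abs_poisson_sub_le
  have hbd (y : E4) (hy : ‖y‖ < 1) : |D y| ≤ C * K₁ * (1 - ‖y‖) ^ (1 / 2 : ℝ)
      + c * (K₂ * (1 - ‖y‖)) := by
    obtain ⟨ζ, hζ, hyζ⟩ := exists_smul_norm_eq y
    have h1 := hC b K₁ y ζ hg K₁.2 hy hζ hyζ fun z hz => by
      simpa [Real.dist_eq, dist_eq_norm] using
        hK₁.dist_le_mul z (by simp [hz]) ζ (by simp [hζ])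
    have h2 : |b ζ - H y| ≤ K₂ * (1 - ‖y‖) := by
      have h3 := hK₂.dist_le_mul ζ (by simp [hζ]) y (by simpa using hy.le)
      have h4 : H ζ = b ζ := by simp [hH, hζ]
      have h5 : dist ζ y = 1 - ‖y‖ := by
        have : ζ - y = (1 - ‖y‖) • ζ := by rw [sub_smul, ← hyζ, one_smul]
        rw [dist_eq_norm, this, norm_smul, hζ, mul_one, norm_of_nonneg (by linarith)]
      rwa [h4, h5, Real.dist_eq] at h3
    have h6 : D y = (poisson b y - c * b ζ) + c * (b ζ - H y) := by simp only [hD]; ring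
    rw [h6]
    refine (abs_add_le _ _).trans (add_le_add h1 ?_)
    rw [abs_mul, abs_of_pos hc0]
    gcongr
  have key : ∀ s : ℝ, |s| ≤ 1 → s * D x ≤ 0 := by
    intro s hs
    have hlim : Filter.Tendsto (fun ρ : ℝ => C * K₁ * (1 - ρ) ^ (1 / 2 : ℝ)
        + c * (K₂ * (1 - ρ))) (𝓝[<] 1) (𝓝 0) := by
      have h1 : Filter.Tendsto (fun ρ : ℝ => c * (K₂ * (1 - ρ))) (𝓝[<] 1) (𝓝 0) := by
        have : Continuous fun ρ : ℝ => c * (K₂ * (1 - ρ)) := by fun_prop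
        have := this.tendsto 1
        norm_num at this
        exact this.mono_left nhdsWithin_le_nhds
      simpa using (tendsto_rpow_half_one_sub.const_mul (C * K₁)).add h1
    refine ge_of_tendsto hlim ?_
    filter_upwards [Ioo_mem_nhdsLT hx] with ρ hρ
    refine le_of_nonneg_operator (a := 1) (b := 0) (f := fun y => s * D y) (ρ := ρ)
      (fun y hy => ?_) (fun y hy => ?_) (by simp) (by simp) (fun y hy => ?_) (fun y hy => ?_)
      hρ.1.le
    · have hy' : ‖y‖ < 1 := lt_of_le_of_lt (by simpa using hy) hρ.2
      exact (continuousAt_const.mul (hDs y hy').continuousAt).continuousWithinAt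
    · exact contDiffAt_const.mul (hDs y (hy.trans hρ.2))
    · simp [lap_const_mul (hDs y (hy.trans hρ.2)), hDl y (hy.trans hρ.2)]
    · refine (le_abs_self _).trans ?_
      rw [abs_mul, ← hy]
      refine (mul_le_of_le_one_left (abs_nonneg _) hs).trans (hbd y ?_)
      rw [hy]; exact hρ.2
  have h1 := key 1 (by simp)
  have h2 := key (-1) (by simp)
  have h3 : D x = 0 := by linarith
  simpa [hD, sub_eq_zero] using h3

/-- The functions `1, x₀, …, x₃`. -/
def affCoord (o : Option (Fin 4)) (x : E4) : ℝ := o.elim 1 fun i => x i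

/-- The vectors such that `y - ζ = ∑ₒ affCoord o y • affVec ζ o`. -/
def affVec (ζ : E4) (o : Option (Fin 4)) : E4 := o.elim (-ζ) e4

lemma sub_eq_sum_affCoord (y ζ : E4) : y - ζ = ∑ o, affCoord o y • affVec ζ o := by
  rw [Fintype.sum_option]
  simp only [affCoord, affVec, Option.elim_none, Option.elim_some, one_smul]
  rw [← eq_sum_e4]
  abel

lemma norm_affVec {ζ : E4} (hζ : ‖ζ‖ = 1) (o : Option (Fin 4)) : ‖affVec ζ o‖ = 1 := by
  cases o with
  | none => simpa [affVec] using hζ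
  | some i => exact norm_e4 i

lemma contDiff_affCoord (o : Option (Fin 4)) {n : WithTop ℕ∞} : ContDiff ℝ n (affCoord o) := by
  cases o with
  | none => exact contDiff_const
  | some i => exact contDiff_coord i

lemma pd_affCoord (i : Fin 4) (o : Option (Fin 4)) (x : E4) :
    pd i (affCoord o) x = if o = some i then 1 else 0 := by
  cases o with
  | none =>
    have : affCoord none = fun _ => 1 := rfl
    simp [this, pd]
  | some j =>
    refine (pd_coord i j x).trans ?_
    simp

lemma lap_affCoord (o : Option (Fin 4)) (x : E4) : lap (affCoord o) x = 0 := by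
  rw [lap_eq_sum_pd]
  refine Finset.sum_eq_zero fun i _ => ?_
  have : pd i (affCoord o) = fun _ => if o = some i then 1 else 0 :=
    funext fun x => pd_affCoord i o x
  simp [this, pd]

lemma exists_lap_affCoord_mul (o o' : Option (Fin 4)) :
    ∃ κ : ℝ, ∀ x, lap (fun y => affCoord o y * affCoord o' y) x = 8 * κ := by
  refine ⟨1 / 4 * ∑ i : Fin 4, (if o = some i then 1 else 0) * if o' = some i then 1 else 0,
    fun x => ?_⟩
  rw [lap_mul (contDiff_affCoord o).contDiffAt (contDiff_affCoord o').contDiffAt]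
  simp only [lap_affCoord, pd_affCoord]
  ring

lemma norm_fderiv_fderiv_sub_le {f : E4 → ℝ} (x y : E4) :
    ‖fderiv ℝ (fderiv ℝ f) x - fderiv ℝ (fderiv ℝ f) y‖
      ≤ ‖iteratedFDeriv ℝ 2 f x - iteratedFDeriv ℝ 2 f y‖ := by
  refine ContinuousLinearMap.opNorm_le_bound₂ _ (norm_nonneg _) fun u v => ?_
  have h := (iteratedFDeriv ℝ 2 f x - iteratedFDeriv ℝ 2 f y).le_opNorm ![u, v]
  simp only [Fin.prod_univ_two, sub_apply, iteratedFDeriv_two_apply] at h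
  simpa [mul_assoc] using h

lemma abs_taylor_two_le {f : E4 → ℝ} {U : Set E4} (hU : IsOpen U) (hf : ContDiffOn ℝ 2 f U)
    {C α : NNReal} (hh : HolderOnWith C α (iteratedFDeriv ℝ 2 f) U) {ζ y : E4}
    (hs : segment ℝ ζ y ⊆ U) :
    |f y - (f ζ + fderiv ℝ f ζ (y - ζ) + 1 / 2 * fderiv ℝ (fderiv ℝ f) ζ (y - ζ) (y - ζ))|
      ≤ C * ‖y - ζ‖ ^ (2 + (α : ℝ)) := by
  set w := y - ζ with hw
  set D := fderiv ℝ f with hD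
  set D2 := fderiv ℝ D with hD2
  have hmem (t : ℝ) (ht : t ∈ Icc (0 : ℝ) 1) : ζ + t • w ∈ U := by
    refine hs ?_
    rw [segment_eq_image']
    exact ⟨t, ht, rfl⟩
  have hζ : ζ ∈ U := by simpa using hmem 0 (by simp)
  have hfd (x : E4) (hx : x ∈ U) : DifferentiableAt ℝ f x :=
    (hf.contDiffAt (hU.mem_nhds hx)).differentiableAt (by norm_num)
  have hDd (x : E4) (hx : x ∈ U) : DifferentiableAt ℝ D x :=
    ((hf.contDiffAt (hU.mem_nhds hx)).fderiv_right (m := 1) (by norm_num)).differentiableAt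
      (by norm_num)
  set M : ℝ := C * ‖w‖ ^ (2 + (α : ℝ)) with hM
  have hM0 : 0 ≤ M := by positivity
  have h2 (t : ℝ) (ht : t ∈ Icc (0 : ℝ) 1) : ‖D2 (ζ + t • w) w w - D2 ζ w w‖ ≤ M := by
    have h3 := hh.dist_le (hmem t ht) hζ
    rw [dist_eq_norm, dist_eq_norm, add_sub_cancel_left, norm_smul] at h3
    have h4 := (norm_fderiv_fderiv_sub_le (f := f) (ζ + t • w) ζ).trans h3
    have h5 : ‖t‖ * ‖w‖ ≤ ‖w‖ := by
      refine mul_le_of_le_one_left (norm_nonneg _) ?_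
      rw [norm_of_nonneg ht.1]
      exact ht.2
    calc ‖D2 (ζ + t • w) w w - D2 ζ w w‖ = ‖(D2 (ζ + t • w) - D2 ζ) w w‖ := by simp
      _ ≤ ‖D2 (ζ + t • w) - D2 ζ‖ * ‖w‖ * ‖w‖ := ContinuousLinearMap.le_opNorm₂ _ _ _
      _ ≤ (C * ‖w‖ ^ (α : ℝ)) * ‖w‖ * ‖w‖ := by
          gcongr
          exact h4.trans (by gcongr)
      _ = M := by
          rw [hM, rpow_add_of_nonneg (norm_nonneg w) zero_le_two (NNReal.coe_nonneg α)]
          norm_num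
          ring
  have h1 (t : ℝ) (ht : t ∈ Icc (0 : ℝ) 1) : ‖D (ζ + t • w) w - D ζ w - t * D2 ζ w w‖ ≤ M := by
    have hder (s : ℝ) (hs : s ∈ Icc (0 : ℝ) 1) :
        HasDerivAt (fun s : ℝ => D (ζ + s • w) w - D ζ w - s * D2 ζ w w)
          (D2 (ζ + s • w) w w - D2 ζ w w) s := by
      have a1 := (hasDerivAt_comp_line (hDd _ (hmem s hs))).clm_apply (hasDerivAt_const s w)
      have a2 := (a1.sub_const (D ζ w)).sub ((hasDerivAt_id s).mul_const (D2 ζ w w))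
      exact a2.congr_deriv (by simp [D2])
    have h := norm_image_sub_le_of_norm_deriv_le_segment' (f := fun s : ℝ =>
      D (ζ + s • w) w - D ζ w - s * D2 ζ w w) (C := M)
      (fun s hs => (hder s hs).hasDerivWithinAt) (fun s hs => h2 s (Ico_subset_Icc_self hs)) t ht
    simp only [zero_smul, add_zero, sub_self, zero_mul, sub_zero] at h
    exact h.trans (mul_le_of_le_one_right hM0 ht.2)
  have hder (s : ℝ) (hs : s ∈ Icc (0 : ℝ) 1) :
      HasDerivAt (fun s : ℝ => f (ζ + s • w) - f ζ - s * D ζ w - 1 / 2 * s ^ 2 * D2 ζ w w)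
        (D (ζ + s • w) w - D ζ w - s * D2 ζ w w) s := by
    have a1 := ((hasDerivAt_comp_line (hfd _ (hmem s hs))).sub_const (f ζ)).sub
      ((hasDerivAt_id s).mul_const (D ζ w))
    have a2 := a1.sub ((((hasDerivAt_id s).pow 2).const_mul (1 / 2)).mul_const (D2 ζ w w))
    refine a2.congr_deriv ?_
    simp [D]
  have h := norm_image_sub_le_of_norm_deriv_le_segment' (f := fun s : ℝ =>
    f (ζ + s • w) - f ζ - s * D ζ w - 1 / 2 * s ^ 2 * D2 ζ w w) (C := M)
    (fun s hs => (hder s hs).hasDerivWithinAt) (fun s hs => h1 s (Ico_subset_Icc_self hs)) 1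
    (by simp)
  simp only [zero_smul, add_zero, sub_self, zero_mul, sub_zero, one_smul, one_mul, mul_one,
    one_pow, ne_eq, OfNat.ofNat_ne_zero, not_false_eq_true, zero_pow, mul_zero] at h
  rw [← Real.norm_eq_abs]
  refine le_of_eq_of_le ?_ h
  congr 1
  rw [hw, add_sub_cancel]
  ring

/-- Uniform second order Taylor expansion at the points of the sphere, in terms of products of
two of the functions `1, x₀, …, x₃`. -/
lemma exists_taylor_affCoord {f : E4 → ℝ} {U : Set E4} (hU : IsOpen U)
    (hSU : Metric.sphere (0 : E4) 1 ⊆ U) (hf : ContDiffOn ℝ 2 f U)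
    {C α : NNReal} (hh : HolderOnWith C α (iteratedFDeriv ℝ 2 f) U) :
    ∃ A : ℝ, 0 ≤ A ∧ ∀ ζ : E4, ‖ζ‖ = 1 → ∃ a : Option (Fin 4) → Option (Fin 4) → ℝ,
      (∀ o o', |a o o'| ≤ A) ∧ ∀ y : E4, ‖y‖ = 1 →
        |f y - ∑ o, ∑ o', a o o' * (affCoord o y * affCoord o' y)|
          ≤ A * ‖y - ζ‖ ^ (2 + (α : ℝ)) := by
  set D := fderiv ℝ f with hD
  set D2 := fderiv ℝ D with hD2
  have hDc : ContDiffOn ℝ 1 D U := hf.fderiv_of_isOpen hU (by norm_num)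
  have hD2c : ContinuousOn D2 U := hDc.continuousOn_fderiv_of_isOpen hU le_rfl
  have hcpt := isCompact_sphere (0 : E4) 1
  obtain ⟨A₀, hA₀⟩ := hcpt.exists_bound_of_continuousOn (hf.continuousOn.mono hSU)
  obtain ⟨A₁, hA₁⟩ := hcpt.exists_bound_of_continuousOn (hDc.continuousOn.mono hSU)
  obtain ⟨A₂, hA₂⟩ := hcpt.exists_bound_of_continuousOn (f := D2) (hD2c.mono hSU)
  obtain ⟨δ, hδ, hδU⟩ := hcpt.exists_thickening_subset_open hU hSU
  have hmem (y : E4) (hy : ‖y‖ = 1) : y ∈ Metric.sphere (0 : E4) 1 := by simpa using hy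
  have hp0 : 0 ≤ A₀ := (norm_nonneg _).trans (hA₀ _ (hmem _ (norm_e4 0)))
  have hp1 : 0 ≤ A₁ := (norm_nonneg _).trans (hA₁ _ (hmem _ (norm_e4 0)))
  have hp2 : 0 ≤ A₂ := (norm_nonneg _).trans (hA₂ _ (hmem _ (norm_e4 0)))
  set B := 2 * A₀ + 2 * A₁ + 2 * A₂ with hB
  have hBn : 0 ≤ B := by positivity
  have hγ : 0 ≤ 2 + (α : ℝ) := by positivity
  have hδ' : 0 < δ ^ (2 + (α : ℝ)) := by positivity
  refine ⟨B + C + B / δ ^ (2 + (α : ℝ)), by positivity, fun ζ hζ => ?_⟩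
  refine ⟨fun o o' => 1 / 2 * D2 ζ (affVec ζ o) (affVec ζ o')
    + (if o' = none then D ζ (affVec ζ o) else 0)
    + (if o = none then if o' = none then f ζ else 0 else 0), fun o o' => ?_, fun y hy => ?_⟩
  · have h2 : |D2 ζ (affVec ζ o) (affVec ζ o')| ≤ A₂ := by
      have := (D2 ζ).le_opNorm₂ (affVec ζ o) (affVec ζ o')
      rw [norm_affVec hζ, norm_affVec hζ, mul_one, mul_one] at this
      exact this.trans (hA₂ _ (hmem _ hζ))
    have h1 : |D ζ (affVec ζ o)| ≤ A₁ := by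
      have := (D ζ).le_opNorm (affVec ζ o)
      rw [norm_affVec hζ, mul_one] at this
      exact this.trans (hA₁ _ (hmem _ hζ))
    have h0 : |f ζ| ≤ A₀ := hA₀ _ (hmem _ hζ)
    have h1' : |if o' = none then D ζ (affVec ζ o) else 0| ≤ A₁ := by
      split_ifs
      · exact h1
      · simpa using hp1
    have h0' : |if o = none then if o' = none then f ζ else 0 else 0| ≤ A₀ := by
      split_ifs
      · exact h0
      · simpa using hp0
      · simpa using hp0
    have h2' : |1 / 2 * D2 ζ (affVec ζ o) (affVec ζ o')| ≤ A₂ := by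
      rw [abs_mul]
      norm_num
      linarith
    have : 0 ≤ B / δ ^ (2 + (α : ℝ)) := by positivity
    have hC := C.2
    refine ((abs_add_le _ _).trans (add_le_add ((abs_add_le _ _).trans (add_le_add h2' h1'))
      h0')).trans ?_
    change 0 ≤ (C : ℝ) at hC
    linarith
  · set w := y - ζ with hw
    have hpoly : ∑ o, ∑ o', (1 / 2 * D2 ζ (affVec ζ o) (affVec ζ o')
        + (if o' = none then D ζ (affVec ζ o) else 0)
        + (if o = none then if o' = none then f ζ else 0 else 0))
          * (affCoord o y * affCoord o' y) = f ζ + D ζ w + 1 / 2 * D2 ζ w w := by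
      have e2 : D2 ζ w w = ∑ o, ∑ o', D2 ζ (affVec ζ o) (affVec ζ o')
          * (affCoord o y * affCoord o' y) := by
        rw [hw, sub_eq_sum_affCoord]
        simp only [map_sum, map_smul, sum_apply, smul_apply, smul_eq_mul,
          Finset.mul_sum]
        rw [Finset.sum_comm]
        exact Finset.sum_congr rfl fun o _ => Finset.sum_congr rfl fun o' _ => by ring
      have e1 : D ζ w = ∑ o, D ζ (affVec ζ o) * affCoord o y := by
        rw [hw, sub_eq_sum_affCoord]
        simp only [map_sum, map_smul, smul_eq_mul]
        exact Finset.sum_congr rfl fun o _ => by ring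
      have en : affCoord none y = 1 := rfl
      simp only [add_mul, Finset.sum_add_distrib, ite_mul, zero_mul, Finset.sum_ite_eq',
        Finset.sum_ite_irrel, Finset.sum_const_zero, Finset.mem_univ, if_true, en, mul_one]
      rw [e2, e1, Finset.mul_sum]
      simp only [Finset.mul_sum, mul_assoc]
      ring
    rw [hpoly]
    have hw0 := norm_nonneg w
    have hC : 0 ≤ (C : ℝ) := C.2
    have hwγ : 0 ≤ ‖w‖ ^ (2 + (α : ℝ)) := by positivity
    have hq : 0 ≤ B / δ ^ (2 + (α : ℝ)) := by positivity
    by_cases hlt : ‖w‖ < δ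
    · have hseg : segment ℝ ζ y ⊆ U := by
        refine Subset.trans ?_ ((Metric.ball_subset_thickening (hmem ζ hζ) δ).trans hδU)
        exact (convex_ball ζ δ).segment_subset (Metric.mem_ball_self hδ)
          (by rwa [Metric.mem_ball, dist_eq_norm])
      refine (abs_taylor_two_le hU hf hh hseg).trans ?_
      gcongr
      linarith
    · push Not at hlt
      have hw2 : ‖w‖ ≤ 2 := by
        have := norm_sub_le y ζ
        rw [hw]; linarith
      have b0 : |f ζ| ≤ A₀ := hA₀ _ (hmem _ hζ)
      have b0' : |f y| ≤ A₀ := hA₀ _ (hmem _ hy)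
      have b1 : |D ζ w| ≤ A₁ * 2 :=
        ((D ζ).le_opNorm w).trans (mul_le_mul (hA₁ _ (hmem _ hζ)) hw2 hw0 hp1)
      have b2 : |D2 ζ w w| ≤ A₂ * 2 * 2 :=
        ((D2 ζ).le_opNorm₂ w w).trans (mul_le_mul (mul_le_mul (hA₂ _ (hmem _ hζ)) hw2 hw0 hp2)
          hw2 hw0 (by positivity))
      have b3 : |f y - (f ζ + D ζ w + 1 / 2 * D2 ζ w w)| ≤ B := by
        rw [abs_le] at *
        constructor <;> linarith
      refine b3.trans ?_
      have b4 : δ ^ (2 + (α : ℝ)) ≤ ‖w‖ ^ (2 + (α : ℝ)) := by gcongr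
      calc B = B / δ ^ (2 + (α : ℝ)) * δ ^ (2 + (α : ℝ)) := by field_simp
        _ ≤ B / δ ^ (2 + (α : ℝ)) * ‖w‖ ^ (2 + (α : ℝ)) := by gcongr
        _ ≤ _ := by
          gcongr
          linarith

lemma exists_norm_iteratedFDeriv_le_of_contDiff {f : E4 → ℝ} (k : ℕ) (hf : ContDiff ℝ k f) :
    ∃ C : ℝ, 0 ≤ C ∧ ∀ x : E4, ‖x‖ ≤ 1 → ‖iteratedFDeriv ℝ k f x‖ ≤ C := by
  obtain ⟨C, hC⟩ := (isCompact_closedBall (0 : E4) 1).exists_bound_of_continuousOn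
    (hf.continuous_iteratedFDeriv le_rfl).continuousOn
  exact ⟨C, (norm_nonneg _).trans (hC 0 (by simp)), fun x hx => hC x (by simpa using hx)⟩

lemma exists_norm_iteratedFDeriv_pow_le (m i : ℕ) : ∃ C : ℝ, 0 ≤ C ∧ ∀ x : E4, ‖x‖ < 1 →
    ‖iteratedFDeriv ℝ i (fun y : E4 => (1 - ‖y‖ ^ 2) ^ m) x‖ ≤ C * (1 - ‖x‖) ^ (m - i) := by
  induction m generalizing i with
  | zero =>
    obtain ⟨C, hC0, hC⟩ := exists_norm_iteratedFDeriv_le_of_contDiff (f := fun _ => 1) i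
      contDiff_const
    exact ⟨C, hC0, fun x hx => by simpa using hC x hx.le⟩
  | succ m ih =>
    choose C hC0 hC using ih
    choose D hD0 hD using fun i : ℕ => exists_norm_iteratedFDeriv_le_of_contDiff
      (f := fun y : E4 => 1 - ‖y‖ ^ 2) i contDiff_one_sub_norm_sq
    refine ⟨∑ j ∈ Finset.range (i + 1), (i.choose j : ℝ) * (D j + 2) * C (i - j),
      Finset.sum_nonneg fun j _ => mul_nonneg (mul_nonneg (by positivity)
        (by linarith [hD0 j])) (hC0 _), fun x hx => ?_⟩
    have hx1 : 0 ≤ 1 - ‖x‖ := by linarith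
    have hx2 : 1 - ‖x‖ ≤ 1 := by linarith [norm_nonneg x]
    have e : (fun y : E4 => (1 - ‖y‖ ^ 2) ^ (m + 1))
        = fun y => (1 - ‖y‖ ^ 2) * (1 - ‖y‖ ^ 2) ^ m := funext fun y => pow_succ' _ _
    rw [e]
    refine (norm_iteratedFDeriv_mul_le (N := (⊤ : ℕ∞)) contDiff_one_sub_norm_sq
      (contDiff_one_sub_norm_sq.pow m) x (by exact_mod_cast le_top)).trans ?_
    rw [Finset.sum_mul]
    refine Finset.sum_le_sum fun j hj => ?_
    have hj' : j ≤ i := Nat.lt_succ_iff.1 (Finset.mem_range.1 hj)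
    have h1 := hC (i - j) x hx
    have h2 : ‖iteratedFDeriv ℝ j (fun y : E4 => 1 - ‖y‖ ^ 2) x‖ * (1 - ‖x‖) ^ (m - (i - j))
        ≤ (D j + 2) * (1 - ‖x‖) ^ (m + 1 - i) := by
      rcases Nat.eq_zero_or_pos j with rfl | hj0
      · rw [norm_iteratedFDeriv_zero, norm_of_nonneg (by nlinarith [norm_nonneg x]), Nat.sub_zero]
        calc (1 - ‖x‖ ^ 2) * (1 - ‖x‖) ^ (m - i) ≤ (2 * (1 - ‖x‖)) * (1 - ‖x‖) ^ (m - i) := by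
              gcongr
              nlinarith [norm_nonneg x]
          _ = 2 * (1 - ‖x‖) ^ (m - i + 1) := by ring
          _ ≤ 2 * (1 - ‖x‖) ^ (m + 1 - i) := by
              have := pow_le_pow_of_le_one hx1 hx2 (show m + 1 - i ≤ m - i + 1 by omega)
              linarith
          _ ≤ _ := by
              gcongr
              linarith [hD0 0]
      · have h3 := pow_le_pow_of_le_one hx1 hx2 (show m + 1 - i ≤ m - (i - j) by omega)
        have h4 := hD j x hx.le
        have h5 := hD0 j
        calc _ ≤ (D j + 2) * (1 - ‖x‖) ^ (m - (i - j)) := by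
              gcongr
              linarith
          _ ≤ _ := by gcongr
    calc _ ≤ (i.choose j : ℝ) * ‖iteratedFDeriv ℝ j (fun y : E4 => 1 - ‖y‖ ^ 2) x‖
          * (C (i - j) * (1 - ‖x‖) ^ (m - (i - j))) := by gcongr
      _ = (i.choose j : ℝ) * C (i - j) * (‖iteratedFDeriv ℝ j (fun y : E4 => 1 - ‖y‖ ^ 2) x‖
          * (1 - ‖x‖) ^ (m - (i - j))) := by ring
      _ ≤ (i.choose j : ℝ) * C (i - j) * ((D j + 2) * (1 - ‖x‖) ^ (m + 1 - i)) := by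
          have := hC0 (i - j)
          gcongr
      _ = _ := by ring

lemma exists_remainder_term_le {α β A : ℝ} (hA : 0 ≤ A) (hα1 : α ≤ 1) (hβ0 : 0 < β) (hβα : β < α)
    {m i : ℕ} (hi : i ≤ m + 2) : ∃ C : ℝ, 0 ≤ C ∧ ∀ (x ζ : E4) (R : E4 → ℝ),
      ‖x‖ < 1 → ‖ζ‖ = 1 → x = ‖x‖ • ζ → ContinuousOn R (Metric.sphere (0 : E4) 1) →
      (∀ y : E4, ‖y‖ = 1 → |R y| ≤ A * ‖y - ζ‖ ^ (2 + α)) →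
      ‖iteratedFDeriv ℝ i (fun y : E4 => (1 - ‖y‖ ^ 2) ^ m) x‖
        * ‖iteratedFDeriv ℝ (m + 2 - i) (sphPot (fun z : E4 => ‖z‖ ^ (-4 : ℝ)) R) x‖
        ≤ C * (1 - ‖x‖) ^ (β - 1) := by
  obtain ⟨C₁, hC₁0, hC₁⟩ := exists_norm_iteratedFDeriv_pow_le m i
  obtain ⟨C₂, hC₂0, hC₂⟩ := exists_norm_iteratedFDeriv_norm_rpow_le (m + 2 - i) (-4)
  obtain ⟨C₃, hC₃0, hC₃⟩ := exists_integral_norm_rpow_le hβ0 (by linarith : β < 1)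
  set e : ℝ := ((m - i : ℕ) : ℝ) - m + i + α - β with he
  have he0 : 0 ≤ e := by
    have : (m : ℝ) ≤ ((m - i : ℕ) : ℝ) + i := by
      exact_mod_cast (by omega : m ≤ m - i + i)
    linarith
  set B := C₁ * (A * 2 ^ (2 + α) * C₂ * 2 ^ e) with hB
  refine ⟨B * C₃, by positivity, fun x ζ R hx hζ hxζ hR hRy => ?_⟩
  have hx1 : 0 < 1 - ‖x‖ := by linarith
  set k := m + 2 - i with hk
  set K : E4 → ℝ := fun z : E4 => ‖z‖ ^ (-4 : ℝ) with hKdef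
  have hK : ContDiffOn ℝ (⊤ : ℕ∞) K {0}ᶜ := contDiffOn_norm_rpow _
  have hKc : ContinuousOn (iteratedFDeriv ℝ k K) {0}ᶜ := by
    have h1 : ContinuousOn (iteratedFDerivWithin ℝ k K {0}ᶜ) {0}ᶜ :=
      hK.continuousOn_iteratedFDerivWithin (by exact_mod_cast le_top)
        isOpen_compl_singleton.uniqueDiffOn
    exact h1.congr fun z hz => (iteratedFDerivWithin_of_isOpen k isOpen_compl_singleton hz).symm
  have hpt (y : E4) (hy : ‖y‖ = 1) : (1 - ‖x‖) ^ (m - i) * (|R y| * ‖iteratedFDeriv ℝ k K (x - y)‖)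
      ≤ A * 2 ^ (2 + α) * C₂ * 2 ^ e * ‖x - y‖ ^ (β - 4) := by
    have hz := sub_ne_zero_of_norm hx hy
    set d := ‖x - y‖ with hd
    have hd0 : 0 < d := norm_pos_iff.2 hz
    have hd2 : d ≤ 2 := norm_sub_le_two hx hy
    have a1 : (1 - ‖x‖) ^ (m - i) ≤ d ^ (((m - i : ℕ) : ℝ)) := by
      rw [rpow_natCast]
      exact pow_le_pow_left₀ hx1.le (one_sub_norm_le hy) _
    have a2 : |R y| ≤ A * (2 ^ (2 + α) * d ^ (2 + α)) := by
      refine (hRy y hy).trans ?_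
      rw [← mul_rpow zero_le_two hd0.le]
      have : 0 ≤ 2 + α := by linarith
      gcongr
      exact norm_sub_le_of_eq_smul hx hy hζ hxζ
    have a3 := hC₂ (x - y) hz
    have a4 : d ^ (((m - i : ℕ) : ℝ)) * (d ^ (2 + α) * d ^ (-4 - (k : ℝ)))
        = d ^ e * d ^ (β - 4) := by
      rw [← rpow_add hd0, ← rpow_add hd0, ← rpow_add hd0]
      congr 1
      rw [he, hk, Nat.cast_sub hi]
      push_cast
      ring
    have a5 : d ^ e ≤ 2 ^ e := rpow_le_rpow hd0.le hd2 he0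
    calc _ ≤ d ^ (((m - i : ℕ) : ℝ)) * (A * (2 ^ (2 + α) * d ^ (2 + α))
          * (C₂ * d ^ (-4 - (k : ℝ)))) := by gcongr
      _ = A * 2 ^ (2 + α) * C₂ * (d ^ (((m - i : ℕ) : ℝ))
          * (d ^ (2 + α) * d ^ (-4 - (k : ℝ)))) := by ring
      _ = A * 2 ^ (2 + α) * C₂ * (d ^ e * d ^ (β - 4)) := by rw [a4]
      _ ≤ A * 2 ^ (2 + α) * C₂ * (2 ^ e * d ^ (β - 4)) := by gcongr
      _ = _ := by ring
  have hcont : ContinuousOn (fun y => |R y| * ‖iteratedFDeriv ℝ k K (x - y)‖)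
      (Metric.sphere (0 : E4) 1) := hR.abs.mul (continuousOn_kernel hKc hx).norm
  calc _ ≤ C₁ * (1 - ‖x‖) ^ (m - i) * ∫ y, |R y| * ‖iteratedFDeriv ℝ k K (x - y)‖ ∂sphMeas :=
        mul_le_mul (hC₁ x hx) (norm_iteratedFDeriv_sphPot_le k hK hR hx) (norm_nonneg _)
          (by positivity)
    _ = C₁ * ∫ y, (1 - ‖x‖) ^ (m - i) * (|R y| * ‖iteratedFDeriv ℝ k K (x - y)‖) ∂sphMeas := by
        rw [integral_const_mul, mul_assoc]
    _ ≤ C₁ * ∫ y, A * 2 ^ (2 + α) * C₂ * 2 ^ e * ‖x - y‖ ^ (β - 4) ∂sphMeas :=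
        mul_le_mul_of_nonneg_left (integral_sphMeas_mono (continuousOn_const.mul hcont)
          (continuousOn_const.mul (continuousOn_norm_rpow hx _)) hpt) hC₁0
    _ = B * ∫ y, ‖x - y‖ ^ (β - 4) ∂sphMeas := by
        rw [integral_const_mul, hB]
        ring
    _ ≤ B * (C₃ * (1 - ‖x‖) ^ (β - 1)) := by
        have := hC₃ x hx
        gcongr
    _ = _ := by ring

lemma sphPot_sub {n : E4 → ℝ} (hn : ContinuousOn n {0}ᶜ) {f g : E4 → ℝ}
    (hf : ContinuousOn f (Metric.sphere (0 : E4) 1))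
    (hg : ContinuousOn g (Metric.sphere (0 : E4) 1)) {x : E4} (hx : ‖x‖ < 1) :
    sphPot n (fun y => f y - g y) x = sphPot n f x - sphPot n g x := by
  simp only [sphPot, sub_smul]
  exact integral_sub (integrable_kernel hn hf hx) (integrable_kernel hn hg hx)

lemma sphPot_sum {ι : Type*} [Fintype ι] {n : E4 → ℝ} (hn : ContinuousOn n {0}ᶜ) {f : ι → E4 → ℝ}
    (hf : ∀ i, ContinuousOn (f i) (Metric.sphere (0 : E4) 1)) (a : ι → ℝ) {x : E4} (hx : ‖x‖ < 1) :
    sphPot n (fun y => ∑ i, a i * f i y) x = ∑ i, a i * sphPot n (f i) x := by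
  simp only [sphPot, Finset.sum_smul, mul_smul]
  have hI (i : ι) : Integrable (fun y => a i • f i y • n (x - y)) sphMeas :=
    (integrable_kernel hn (hf i) hx).smul (a i)
  rw [integral_finsetSum _ fun i _ => hI i]
  exact Finset.sum_congr rfl fun i _ => integral_smul _ _

/-- The basic estimate: if the density has a uniform second order Taylor expansion with remainder
of order `2 + α`, then `(1 - |x|²) ^ m` times its potential satisfies a weighted estimate. -/
lemma exists_norm_iteratedFDeriv_pow_mul_sphPot_le {α β A : ℝ} (hA : 0 ≤ A) (hα1 : α ≤ 1)
    (hβ0 : 0 < β) (hβα : β < α) {m : ℕ} (hm : 1 ≤ m) {g : E4 → ℝ}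
    (hg : ContinuousOn g (Metric.sphere (0 : E4) 1))
    (hT : ∀ ζ : E4, ‖ζ‖ = 1 → ∃ a : Option (Fin 4) → Option (Fin 4) → ℝ,
      (∀ o o', |a o o'| ≤ A) ∧ ∀ y : E4, ‖y‖ = 1 →
        |g y - ∑ o, ∑ o', a o o' * (affCoord o y * affCoord o' y)| ≤ A * ‖y - ζ‖ ^ (2 + α)) :
    ∃ C : ℝ, 0 ≤ C ∧ ∀ x : E4, ‖x‖ < 1 →
      ‖iteratedFDeriv ℝ (m + 2)
        (fun y : E4 => (1 - ‖y‖ ^ 2) ^ m * sphPot (fun z : E4 => ‖z‖ ^ (-4 : ℝ)) g y) x‖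
        ≤ C * (1 - ‖x‖) ^ (β - 1) := by
  set K : E4 → ℝ := fun z : E4 => ‖z‖ ^ (-4 : ℝ) with hKdef
  have hK : ContDiffOn ℝ (⊤ : ℕ∞) K {0}ᶜ := contDiffOn_norm_rpow _
  set c := sphMeas.real univ with hc
  set b : Option (Fin 4) × Option (Fin 4) → E4 → ℝ :=
    fun o y => affCoord o.1 y * affCoord o.2 y with hb
  have hbs (o) : ContDiff ℝ (⊤ : ℕ∞) (b o) := (contDiff_affCoord _).mul (contDiff_affCoord _)
  choose κ hκ using fun o : Option (Fin 4) × Option (Fin 4) => exists_lap_affCoord_mul o.1 o.2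
  set q : Option (Fin 4) × Option (Fin 4) → E4 → ℝ := fun o y =>
    (1 - ‖y‖ ^ 2) ^ (m - 1) * (c * (b o y + κ o * (1 - ‖y‖ ^ 2))) with hq
  have hqs (o) : ContDiff ℝ (⊤ : ℕ∞) (q o) :=
    (contDiff_one_sub_norm_sq.pow _).mul (contDiff_const.mul
      ((hbs o).add (contDiff_const.mul contDiff_one_sub_norm_sq)))
  have hqs' (o) : ContDiff ℝ (m + 2 : ℕ) (q o) := contDiff_infty.1 (hqs o) (m + 2)
  have hqb (o) (y : E4) (hy : ‖y‖ < 1) : (1 - ‖y‖ ^ 2) ^ m * sphPot K (b o) y = q o y := by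
    have h := poisson_eq_of_lap_eq (b := b o) (contDiff_infty.1 (hbs o) 2)
      (hκ o) hy
    have h' : (1 - ‖y‖ ^ 2) * sphPot K (b o) y = c * (b o y + κ o * (1 - ‖y‖ ^ 2)) := h
    obtain ⟨l, rfl⟩ := Nat.exists_eq_add_of_le' hm
    simp only [hq]
    rw [Nat.add_sub_cancel, pow_succ, mul_assoc, h']
  choose D hD0 hD using fun o => exists_norm_iteratedFDeriv_le_of_contDiff (m + 2) (hqs' o)
  have hterm : ∀ i : ℕ, ∃ C : ℝ, 0 ≤ C ∧ ∀ (x ζ : E4) (R : E4 → ℝ), i ≤ m + 2 →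
      ‖x‖ < 1 → ‖ζ‖ = 1 → x = ‖x‖ • ζ → ContinuousOn R (Metric.sphere (0 : E4) 1) →
      (∀ y : E4, ‖y‖ = 1 → |R y| ≤ A * ‖y - ζ‖ ^ (2 + α)) →
      ‖iteratedFDeriv ℝ i (fun y : E4 => (1 - ‖y‖ ^ 2) ^ m) x‖
        * ‖iteratedFDeriv ℝ (m + 2 - i) (sphPot K R) x‖ ≤ C * (1 - ‖x‖) ^ (β - 1) := by
    intro i
    by_cases hi : i ≤ m + 2
    · obtain ⟨C, hC0, hC⟩ := exists_remainder_term_le hA hα1 hβ0 hβα hi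
      exact ⟨C, hC0, fun x ζ R _ => hC x ζ R⟩
    · exact ⟨0, le_rfl, fun x ζ R h => absurd h hi⟩
  choose E hE0 hE using hterm
  set S : ℝ := ∑ i ∈ Finset.range (m + 2 + 1), ((m + 2).choose i : ℝ) * E i with hS
  have hS0 : 0 ≤ S := Finset.sum_nonneg fun i _ => mul_nonneg (by positivity) (hE0 i)
  have hT0 : 0 ≤ ∑ o, A * D o := Finset.sum_nonneg fun o _ => mul_nonneg hA (hD0 o)
  refine ⟨∑ o, A * D o + S, by positivity, fun x hx => ?_⟩
  obtain ⟨ζ, hζ, hxζ⟩ := exists_smul_norm_eq x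
  obtain ⟨a, haA, ha⟩ := hT ζ hζ
  set R : E4 → ℝ := fun y => g y - ∑ o, a o.1 o.2 * b o y with hR
  have hsum : ContinuousOn (fun y => ∑ o, a o.1 o.2 * b o y) (Metric.sphere (0 : E4) 1) :=
    (continuous_finsetSum _ fun o _ => continuous_const.mul (hbs o).continuous).continuousOn
  have hRc : ContinuousOn R (Metric.sphere (0 : E4) 1) := hg.sub hsum
  have hRle (y : E4) (hy : ‖y‖ = 1) : |R y| ≤ A * ‖y - ζ‖ ^ (2 + α) := by
    refine le_of_eq_of_le ?_ (ha y hy)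
    simp only [hR, hb, Fintype.sum_prod_type]
  set P : E4 → ℝ := fun y => ∑ o, a o.1 o.2 * q o y with hP
  have hPs : ContDiff ℝ (m + 2 : ℕ) P := ContDiff.sum fun o _ => contDiff_const.mul (hqs' o)
  set T : E4 → ℝ := fun y => (1 - ‖y‖ ^ 2) ^ m * sphPot K R y with hTdef
  have hball : x ∈ Metric.ball (0 : E4) 1 := by simpa using hx
  have hpB : ContDiffOn ℝ (m + 2 : ℕ) (fun y : E4 => (1 - ‖y‖ ^ 2) ^ m) (Metric.ball 0 1) :=
    (contDiff_one_sub_norm_sq.pow m).contDiffOn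
  have hsB := contDiffOn_sphPot (m + 2) hK hRc
  have hTs : ContDiffAt ℝ (m + 2 : ℕ) T x :=
    (hpB.mul hsB).contDiffAt (Metric.isOpen_ball.mem_nhds hball)
  have hev : (fun y : E4 => (1 - ‖y‖ ^ 2) ^ m * sphPot K g y) =ᶠ[𝓝 x] P + T := by
    filter_upwards [norm_lt_one_mem_nhds hx] with y hy
    have hy' : ‖y‖ < 1 := hy
    have e1 : sphPot K R y = sphPot K g y - ∑ o, a o.1 o.2 * sphPot K (b o) y := by
      rw [hR, sphPot_sub hK.continuousOn hg hsum hy',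
        sphPot_sum (f := b) hK.continuousOn (fun o => (hbs o).continuous.continuousOn)
          (fun o => a o.1 o.2) hy']
    simp only [Pi.add_apply, hP, hTdef, e1, ← hqb _ y hy', mul_sub, Finset.mul_sum]
    rw [Finset.sum_congr rfl fun o _ => mul_left_comm (a o.1 o.2) ((1 - ‖y‖ ^ 2) ^ m) _]
    ring
  rw [(hev.iteratedFDeriv ℝ (m + 2)).eq_of_nhds, iteratedFDeriv_add_apply hPs.contDiffAt hTs]
  have h1 : ‖iteratedFDeriv ℝ (m + 2) P x‖ ≤ ∑ o, A * D o := by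
    have hd (o) : ContDiff ℝ (m + 2 : ℕ) (a o.1 o.2 • q o) := contDiff_const.smul (hqs' o)
    have e : iteratedFDeriv ℝ (m + 2) P = ∑ o, iteratedFDeriv ℝ (m + 2) (a o.1 o.2 • q o) :=
      iteratedFDeriv_sum fun o _ => hd o
    rw [e, Finset.sum_apply]
    refine (norm_sum_le _ _).trans (Finset.sum_le_sum fun o _ => ?_)
    rw [iteratedFDeriv_const_smul_apply (hqs' o).contDiffAt, norm_smul]
    exact mul_le_mul (haA _ _) (hD o x hx.le) (norm_nonneg _) hA
  have h2 : ‖iteratedFDeriv ℝ (m + 2) T x‖ ≤ S * (1 - ‖x‖) ^ (β - 1) := by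
    have h := norm_iteratedFDerivWithin_mul_le hpB hsB Metric.isOpen_ball.uniqueDiffOn hball
      (n := m + 2) le_rfl
    simp only [iteratedFDerivWithin_of_isOpen _ Metric.isOpen_ball hball] at h
    refine h.trans ?_
    rw [hS, Finset.sum_mul]
    refine Finset.sum_le_sum fun i hi => ?_
    rw [mul_assoc, mul_assoc]
    exact mul_le_mul_of_nonneg_left (hE i x ζ R (Nat.lt_succ_iff.1 (Finset.mem_range.1 hi)) hx hζ
      hxζ hRc hRle) (by positivity)
  have h3 : 1 ≤ (1 - ‖x‖) ^ (β - 1) :=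
    one_le_rpow_of_pos_of_le_one_of_nonpos (by linarith) (by linarith [norm_nonneg x])
      (by linarith)
  calc _ ≤ ∑ o, A * D o + S * (1 - ‖x‖) ^ (β - 1) := (norm_add_le _ _).trans (add_le_add h1 h2)
    _ ≤ (∑ o, A * D o) * (1 - ‖x‖) ^ (β - 1) + S * (1 - ‖x‖) ^ (β - 1) := by
        gcongr
        exact le_mul_of_one_le_right hT0 h3
    _ = _ := by ring

section Holder

variable {F : Type*} [NormedAddCommGroup F] [NormedSpace ℝ F]

lemma norm_sub_radial_le {f : E4 → F} {β C : ℝ} (hβ0 : 0 < β) (hβ1 : β ≤ 1) (hC : 0 ≤ C)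
    (hf : ∀ x : E4, ‖x‖ < 1 → DifferentiableAt ℝ f x)
    (hb : ∀ x : E4, ‖x‖ < 1 → ‖fderiv ℝ f x‖ ≤ C * (1 - ‖x‖) ^ (β - 1))
    {x : E4} (hx : ‖x‖ < 1) {s : ℝ} (hs0 : 0 ≤ s) (hs1 : s ≤ 1) :
    ‖f ((1 - s) • x) - f x‖ ≤ C / β * s ^ β := by
  set r := ‖x‖ with hr
  have hr0 : 0 ≤ r := norm_nonneg x
  have hnorm (t : ℝ) (ht : t ∈ Icc 0 s) : ‖(1 - t) • x‖ = (1 - t) * r := by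
    rw [norm_smul, norm_of_nonneg (by linarith [ht.2])]
  have hlt (t : ℝ) (ht : t ∈ Icc 0 s) : ‖(1 - t) • x‖ < 1 := by
    rw [hnorm t ht]
    nlinarith [ht.1]
  have hd (t : ℝ) (ht : t ∈ Icc 0 s) :
      HasDerivAt (fun t => f ((1 - t) • x) - f x) (fderiv ℝ f ((1 - t) • x) (-x)) t := by
    have h1 : HasDerivAt (fun t : ℝ => (1 - t) • x) (-x) t := by
      simpa using ((hasDerivAt_id t).const_sub 1).smul_const x
    exact (((hf _ (hlt t ht)).hasFDerivAt).comp_hasDerivAt t h1).sub_const _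
  have hpos (t : ℝ) (ht : t ∈ Icc 0 s) : 0 < 1 - r + t * r := by
    have := mul_nonneg ht.1 hr0
    linarith
  have hB (t : ℝ) (ht : t ∈ Icc 0 s) :
      HasDerivAt (fun t => C / β * ((1 - r + t * r) ^ β - (1 - r) ^ β))
        (C * r * (1 - r + t * r) ^ (β - 1)) t := by
    have h1 : HasDerivAt (fun t : ℝ => 1 - r + t * r) r t := by
      simpa using ((hasDerivAt_id t).mul_const r).const_add (1 - r)
    have h2 := ((h1.rpow_const (p := β) (Or.inl (hpos t ht).ne')).sub_const
      ((1 - r) ^ β)).const_mul (C / β)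
    have e : C / β * (r * β * (1 - r + t * r) ^ (β - 1)) = C * r * (1 - r + t * r) ^ (β - 1) := by
      rw [div_mul_eq_mul_div, div_eq_iff hβ0.ne']
      ring
    rwa [e] at h2
  have key := image_norm_le_of_norm_deriv_right_le_deriv_boundary'
    (f := fun t => f ((1 - t) • x) - f x) (a := 0) (b := s)
    (f' := fun t => fderiv ℝ f ((1 - t) • x) (-x))
    (B := fun t => C / β * ((1 - r + t * r) ^ β - (1 - r) ^ β))
    (B' := fun t => C * r * (1 - r + t * r) ^ (β - 1))
    (fun t ht => (hd t ht).continuousAt.continuousWithinAt)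
    (fun t ht => (hd t (Ico_subset_Icc_self ht)).hasDerivWithinAt) (by simp)
    (fun t ht => (hB t ht).continuousAt.continuousWithinAt)
    (fun t ht => (hB t (Ico_subset_Icc_self ht)).hasDerivWithinAt)
    (fun t ht => by
      have ht' := Ico_subset_Icc_self ht
      refine (ContinuousLinearMap.le_opNorm _ _).trans ?_
      have h1 := hb _ (hlt t ht')
      rw [hnorm t ht', show 1 - (1 - t) * r = 1 - r + t * r by ring] at h1
      rw [norm_neg]
      calc _ ≤ C * (1 - r + t * r) ^ (β - 1) * r := by gcongr
        _ = _ := by ring)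
    (right_mem_Icc.2 hs0)
  refine key.trans ?_
  have h2 : (1 - r + s * r) ^ β ≤ (1 - r) ^ β + (s * r) ^ β :=
    rpow_add_le_add_rpow (by linarith) (mul_nonneg hs0 hr0) hβ0.le hβ1
  have h3 : (s * r) ^ β ≤ s ^ β :=
    rpow_le_rpow (mul_nonneg hs0 hr0) (by nlinarith) hβ0.le
  have : 0 ≤ C / β := by positivity
  show C / β * ((1 - r + s * r) ^ β - (1 - r) ^ β) ≤ _
  gcongr
  linarith

/-- A function on the ball whose gradient is at most `C (1 - |x|) ^ (β - 1)` is `β`-Hölder. -/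
lemma exists_norm_sub_le_of_norm_fderiv_le {f : E4 → F} {β C : ℝ} (hβ0 : 0 < β) (hβ1 : β ≤ 1)
    (hC : 0 ≤ C) (hf : ∀ x : E4, ‖x‖ < 1 → DifferentiableAt ℝ f x)
    (hb : ∀ x : E4, ‖x‖ < 1 → ‖fderiv ℝ f x‖ ≤ C * (1 - ‖x‖) ^ (β - 1)) :
    ∃ C' : ℝ, 0 ≤ C' ∧ ∀ x y : E4, ‖x‖ < 1 → ‖y‖ < 1 → ‖f x - f y‖ ≤ C' * ‖x - y‖ ^ β := by
  refine ⟨2 * (C / β) + 2 * C, by positivity, fun x y hx hy => ?_⟩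
  rcases eq_or_ne x y with rfl | hxy
  · simp only [sub_self, norm_zero]
    positivity
  set s := ‖x - y‖ / 2 with hs
  have hs0 : 0 < s := by
    have := norm_pos_iff.2 (sub_ne_zero.2 hxy)
    positivity
  have hs1 : s ≤ 1 := by
    have := norm_sub_le x y
    linarith
  have hmem (z : E4) (hz : ‖z‖ < 1) : (1 - s) • z ∈ Metric.closedBall (0 : E4) (1 - s) := by
    rw [mem_closedBall_zero_iff, norm_smul, norm_of_nonneg (by linarith)]
    nlinarith
  have hsub (z : E4) (hz : z ∈ Metric.closedBall (0 : E4) (1 - s)) : s ≤ 1 - ‖z‖ := by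
    rw [mem_closedBall_zero_iff] at hz
    linarith
  have h1 := norm_sub_radial_le hβ0 hβ1 hC hf hb hx hs0.le hs1
  have h2 := norm_sub_radial_le hβ0 hβ1 hC hf hb hy hs0.le hs1
  have h3 : ‖f ((1 - s) • x) - f ((1 - s) • y)‖
      ≤ C * s ^ (β - 1) * ‖(1 - s) • x - (1 - s) • y‖ :=
    Convex.norm_image_sub_le_of_norm_fderiv_le (𝕜 := ℝ)
      (fun z hz => hf z (by linarith [hsub z hz]))
      (fun z hz => (hb z (by linarith [hsub z hz])).trans (mul_le_mul_of_nonneg_left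
        (rpow_le_rpow_of_nonpos hs0 (hsub z hz) (by linarith)) hC))
      (convex_closedBall _ _) (hmem y hy) (hmem x hx)
  have h4 : ‖(1 - s) • x - (1 - s) • y‖ ≤ 2 * s := by
    rw [← smul_sub, norm_smul, norm_of_nonneg (by linarith), hs]
    nlinarith [norm_nonneg (x - y)]
  have h5 : C * s ^ (β - 1) * ‖(1 - s) • x - (1 - s) • y‖ ≤ 2 * C * s ^ β := by
    calc _ ≤ C * s ^ (β - 1) * (2 * s) := by gcongr
      _ = 2 * C * (s ^ (β - 1) * s) := by ring
      _ = _ := by rw [← rpow_add_one hs0.ne', sub_add_cancel]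
  have h6 : s ^ β ≤ ‖x - y‖ ^ β :=
    rpow_le_rpow hs0.le (by rw [hs]; linarith [norm_nonneg (x - y)]) hβ0.le
  have h7 : ‖f x - f y‖ ≤ ‖f ((1 - s) • x) - f x‖ + ‖f ((1 - s) • x) - f ((1 - s) • y)‖
      + ‖f ((1 - s) • y) - f y‖ := by
    rw [norm_sub_rev (f ((1 - s) • x)) (f x)]
    refine le_of_eq_of_le ?_ ((norm_add_le _ _).trans (add_le_add_left (norm_add_le _ _) _))
    congr 1
    abel
  calc ‖f x - f y‖ ≤ (2 * (C / β) + 2 * C) * s ^ β := by linarith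
    _ ≤ _ := by gcongr

end Holder

/-- The linear form with coefficients `a`. -/
def linForm (a : Fin 4 → ℝ) : E4 →L[ℝ] ℝ := ∑ i, a i • EuclideanSpace.proj i

lemma linForm_apply (a : Fin 4 → ℝ) (v : E4) : linForm a v = ∑ i, a i * v i := by
  simp [linForm]

lemma fderiv_eq_linForm (f : E4 → ℝ) (x : E4) : fderiv ℝ f x = linForm fun i => pd i f x := by
  ext v
  rw [linForm_apply, fderiv_eq_sum_pd]
  exact Finset.sum_congr rfl fun i _ => mul_comm _ _

/-- `C^k` regularity up to the boundary of the unit ball: the partial derivatives of order at most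
`k` extend continuously to the closed ball. -/
def CK : ℕ → (E4 → ℝ) → Prop
  | 0, w => ContinuousOn w (Metric.closedBall 0 1)
  | k + 1, w => ContinuousOn w (Metric.closedBall 0 1) ∧ ∃ p : Fin 4 → E4 → ℝ,
      (∀ i, CK k (p i)) ∧ ∀ x : E4, ‖x‖ < 1 → HasFDerivAt w (linForm fun i => p i x) x

namespace CK

lemma continuousOn {k : ℕ} {w : E4 → ℝ} (h : CK k w) :
    ContinuousOn w (Metric.closedBall 0 1) := by
  cases k with
  | zero => exact h
  | succ k => exact h.1

lemma of_succ {k : ℕ} {w : E4 → ℝ} (h : CK (k + 1) w) : CK k w := by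
  induction k generalizing w with
  | zero => exact h.1
  | succ k ih =>
    obtain ⟨hc, p, hp, hd⟩ := h
    exact ⟨hc, p, fun i => ih (hp i), hd⟩

lemma const (k : ℕ) (c : ℝ) : CK k fun _ => c := by
  induction k generalizing c with
  | zero => exact continuousOn_const
  | succ k ih =>
    refine ⟨continuousOn_const, fun _ _ => 0, fun _ => ih 0, fun x _ => ?_⟩
    refine (hasFDerivAt_const c x).congr_fderiv ?_
    ext v
    simp [linForm_apply]

lemma coord (k : ℕ) (j : Fin 4) : CK k fun x => x j := by
  cases k with
  | zero => exact (contDiff_coord j (n := 0)).continuous.continuousOn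
  | succ k =>
    refine ⟨(contDiff_coord j (n := 0)).continuous.continuousOn, fun i _ => if i = j then 1 else 0,
      fun i => const k _, fun x _ => ?_⟩
    refine (hasFDerivAt_coord j x).congr_fderiv ?_
    ext v
    simp [linForm_apply]

lemma add {k : ℕ} {v w : E4 → ℝ} (hv : CK k v) (hw : CK k w) : CK k fun x => v x + w x := by
  induction k generalizing v w with
  | zero => exact ContinuousOn.add hv hw
  | succ k ih =>
    obtain ⟨hc, p, hp, hd⟩ := hv
    obtain ⟨hc', q, hq, hd'⟩ := hw
    refine ⟨hc.add hc', fun i x => p i x + q i x, fun i => ih (hp i) (hq i), fun x hx => ?_⟩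
    refine ((hd x hx).fun_add (hd' x hx)).congr_fderiv ?_
    ext v
    simp [linForm_apply, add_mul, Finset.sum_add_distrib]

lemma mul {k : ℕ} {v w : E4 → ℝ} (hv : CK k v) (hw : CK k w) : CK k fun x => v x * w x := by
  induction k generalizing v w with
  | zero => exact ContinuousOn.mul hv hw
  | succ k ih =>
    have hv0 := hv.of_succ
    have hw0 := hw.of_succ
    obtain ⟨hc, p, hp, hd⟩ := hv
    obtain ⟨hc', q, hq, hd'⟩ := hw
    refine ⟨hc.mul hc', fun i x => v x * q i x + p i x * w x,
      fun i => (ih hv0 (hq i)).add (ih (hp i) hw0), fun x hx => ?_⟩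
    refine ((hd x hx).fun_mul (hd' x hx)).congr_fderiv ?_
    ext z
    simp [linForm_apply, add_mul, Finset.sum_add_distrib, Finset.mul_sum, mul_assoc, mul_left_comm]

lemma sub {k : ℕ} {v w : E4 → ℝ} (hv : CK k v) (hw : CK k w) : CK k fun x => v x - w x := by
  have := hv.add ((const k (-1)).mul hw)
  simpa [sub_eq_add_neg] using this

lemma sum {k : ℕ} {w : Fin 4 → E4 → ℝ} (hw : ∀ i, CK k (w i)) : CK k fun x => ∑ i, w i x := by
  simp only [Fin.sum_univ_four]
  exact (((hw 0).add (hw 1)).add (hw 2)).add (hw 3)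

end CK

lemma exists_continuousOn_closedBall_of_holder {w : E4 → ℝ} {β C : ℝ} (hβ0 : 0 < β)
    (h : ∀ x y : E4, ‖x‖ < 1 → ‖y‖ < 1 → ‖w x - w y‖ ≤ C * ‖x - y‖ ^ β) :
    ∃ v : E4 → ℝ, ContinuousOn v (Metric.closedBall 0 1) ∧ ∀ x : E4, ‖x‖ < 1 → v x = w x := by
  have hcl : closure (Metric.ball (0 : E4) 1) = Metric.closedBall 0 1 :=
    closure_ball 0 one_ne_zero
  have ht0 : Filter.Tendsto (fun r : ℝ => C * r ^ β) (𝓝 0) (𝓝 0) := by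
    have : ContinuousAt (fun r : ℝ => C * r ^ β) 0 :=
      continuousAt_const.mul (continuousAt_id.rpow_const (Or.inr hβ0.le))
    simpa [ContinuousAt, zero_rpow hβ0.ne'] using this
  have huc : ∀ ε > 0, ∃ δ > 0, ∀ x y : E4, ‖x‖ < 1 → ‖y‖ < 1 → ‖x - y‖ < δ →
      ‖w x - w y‖ < ε := by
    intro ε hε
    obtain ⟨δ, hδ, hd⟩ := Metric.eventually_nhds_iff.1 (ht0.eventually (gt_mem_nhds hε))
    exact ⟨δ, hδ, fun x y hx hy hxy => (h x y hx hy).trans_lt (hd (by simpa using hxy))⟩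
  have hcont (x : E4) (hx : ‖x‖ < 1) : ContinuousAt w x := by
    rw [Metric.continuousAt_iff]
    intro ε hε
    obtain ⟨δ, hδ, hd⟩ := huc ε hε
    obtain ⟨δ', hδ', hd'⟩ := Metric.mem_nhds_iff.1 (norm_lt_one_mem_nhds hx)
    refine ⟨min δ δ', lt_min hδ hδ', fun {y} hy => ?_⟩
    rw [dist_eq_norm]
    exact hd y x (hd' (hy.trans_le (min_le_right _ _))) hx
      (by rw [← dist_eq_norm]; exact hy.trans_le (min_le_left _ _))
  refine ⟨extendFrom (Metric.ball 0 1) w, continuousOn_extendFrom hcl.ge fun x hx => ?_,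
    fun x hx => ?_⟩
  · have hne : (𝓝[Metric.ball (0 : E4) 1] x).NeBot := by
      rw [← mem_closure_iff_nhdsWithin_neBot, hcl]
      exact hx
    refine cauchy_map_iff_exists_tendsto.1 (Metric.cauchy_iff.2 ⟨hne.map _, fun ε hε => ?_⟩)
    obtain ⟨δ, hδ, hd⟩ := huc ε hε
    refine ⟨w '' (Metric.ball x (δ / 2) ∩ Metric.ball 0 1), Filter.image_mem_map
      (Filter.inter_mem (mem_nhdsWithin_of_mem_nhds (Metric.ball_mem_nhds _ (half_pos hδ)))
        self_mem_nhdsWithin), ?_⟩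
    rintro _ ⟨y, ⟨hy, hy1⟩, rfl⟩ _ ⟨z, ⟨hz, hz1⟩, rfl⟩
    rw [dist_eq_norm]
    refine hd y z (by simpa using hy1) (by simpa using hz1) ?_
    rw [← dist_eq_norm]
    linarith [dist_triangle_right y z x, Metric.mem_ball.1 hy, Metric.mem_ball.1 hz]
  · exact extendFrom_eq (hcl.ge (by simpa using hx.le)) ((hcont x hx).mono_left nhdsWithin_le_nhds)

lemma exists_CK_of_norm_iteratedFDeriv_le {w : E4 → ℝ} {β C : ℝ} (hβ0 : 0 < β) (hβ1 : β ≤ 1)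
    (hC : 0 ≤ C) (k : ℕ) (hw : ContDiffOn ℝ (k + 1 : ℕ) w (Metric.ball 0 1))
    (hb : ∀ x : E4, ‖x‖ < 1 → ‖iteratedFDeriv ℝ (k + 1) w x‖ ≤ C * (1 - ‖x‖) ^ (β - 1)) :
    ∃ v : E4 → ℝ, CK k v ∧ ∀ x : E4, ‖x‖ < 1 → v x = w x := by
  induction k generalizing w with
  | zero =>
    have hd (x : E4) (hx : ‖x‖ < 1) : DifferentiableAt ℝ w x :=
      (hw.contDiffAt (Metric.isOpen_ball.mem_nhds (by simpa using hx))).differentiableAt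
        (by norm_num)
    obtain ⟨C', _, hC'⟩ := exists_norm_sub_le_of_norm_fderiv_le hβ0 hβ1 hC hd
      (fun x hx => by simpa [norm_iteratedFDeriv_one] using hb x hx)
    exact exists_continuousOn_closedBall_of_holder hβ0 hC'
  | succ k ih =>
    have hwx (x : E4) (hx : ‖x‖ < 1) : ContDiffAt ℝ (k + 1 + 1 : ℕ) w x :=
      hw.contDiffAt (Metric.isOpen_ball.mem_nhds (by simpa using hx))
    have hd (x : E4) (hx : ‖x‖ < 1) : DifferentiableAt ℝ w x :=
      (hwx x hx).differentiableAt (by norm_cast)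
    have hp (i : Fin 4) : ∃ v : E4 → ℝ, CK k v ∧ ∀ x : E4, ‖x‖ < 1 → v x = pd i w x := by
      refine ih (fun x hx => ?_) fun x hx => ?_
      · exact ((hwx x (by simpa using hx)).pd (by norm_cast) i).contDiffWithinAt
      · have h1 : ContDiffAt ℝ (k + 1 : ℕ) (fderiv ℝ w) x :=
          (hwx x hx).fderiv_right (by norm_cast)
        refine (norm_iteratedFDeriv_clm_apply_const h1 le_rfl).trans ?_
        rw [norm_e4, one_mul, norm_iteratedFDeriv_fderiv]
        exact hb x hx
    choose p hpk hpe using hp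
    obtain ⟨B, hB⟩ : ∃ B : ℝ, ∀ x : E4, ‖x‖ < 1 → ‖fderiv ℝ w x‖ ≤ B := by
      choose D hD using fun i => (isCompact_closedBall (0 : E4) 1).exists_bound_of_continuousOn
        (hpk i).continuousOn
      refine ⟨∑ i, D i, fun x hx => ?_⟩
      rw [fderiv_eq_linForm, linForm]
      refine (norm_sum_le _ _).trans (Finset.sum_le_sum fun i _ => ?_)
      rw [norm_smul, ← hpe i x hx]
      have h1 : ‖(EuclideanSpace.proj i : E4 →L[ℝ] ℝ)‖ ≤ 1 :=
        ContinuousLinearMap.opNorm_le_bound _ zero_le_one fun v => by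
          simpa using PiLp.norm_apply_le v i
      have h2 := hD i x (by simpa using hx.le)
      nlinarith [norm_nonneg (p i x)]
    have hB0 : 0 ≤ B := (norm_nonneg _).trans (hB 0 (by simp))
    obtain ⟨C', _, hC'⟩ := exists_norm_sub_le_of_norm_fderiv_le (β := 1) one_pos le_rfl hB0 hd
      (fun x hx => by simpa using hB x hx)
    obtain ⟨v, hv, hve⟩ := exists_continuousOn_closedBall_of_holder one_pos hC'
    refine ⟨v, ⟨hv, p, hpk, fun x hx => ?_⟩, hve⟩
    have h1 := (hd x hx).hasFDerivAt
    rw [fderiv_eq_linForm] at h1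
    simp only [← hpe _ x hx] at h1
    exact h1.congr_of_eventuallyEq (by
      filter_upwards [norm_lt_one_mem_nhds hx] with y hy using hve y hy)

/-- A continuous function which is differentiable off the unit sphere is differentiable at a point
of the sphere near which the derivative extends continuously. -/
lemma hasFDerivAt_of_hasFDerivAt_off_sphere {f : E4 → ℝ} {g : E4 → E4 →L[ℝ] ℝ}
    (hf : Continuous f) {V : Set E4} (hV : IsOpen V) (hg : ContinuousOn g V)
    (hd : ∀ x ∈ V, ‖x‖ ≠ 1 → HasFDerivAt f (g x) x) {x : E4} (hxV : x ∈ V) (hx : ‖x‖ = 1) :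
    HasFDerivAt f (g x) x := by
  rw [hasFDerivAt_iff_isLittleO_nhds_zero, Asymptotics.isLittleO_iff]
  intro ε hε
  have hgx : ContinuousAt g x := hg.continuousAt (hV.mem_nhds hxV)
  obtain ⟨δ, hδ, hball⟩ := Metric.mem_nhds_iff.1 (Filter.inter_mem (hV.mem_nhds hxV)
    (Metric.tendsto_nhds.1 hgx ε hε))
  filter_upwards [Metric.ball_mem_nhds (0 : E4) hδ] with h hh
  rw [mem_ball_zero_iff] at hh
  have hmem (t : ℝ) (ht : t ∈ Icc (0 : ℝ) 1) : x + t • h ∈ Metric.ball x δ := by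
    rw [Metric.mem_ball, dist_eq_norm, add_sub_cancel_left, norm_smul, norm_of_nonneg ht.1]
    nlinarith [norm_nonneg h, ht.2]
  rcases eq_or_ne h 0 with rfl | h0
  · simp
  have hline : Continuous fun t : ℝ => x + t • h := by fun_prop
  have hgc : ContinuousOn (fun t : ℝ => g (x + t • h) h) (Icc 0 1) :=
    (hg.comp hline.continuousOn fun t ht => (hball (hmem t ht)).1).clm_apply continuousOn_const
  have hint : IntervalIntegrable (fun t : ℝ => g (x + t • h) h) volume 0 1 :=
    (hgc.mono (by rw [uIcc_of_le zero_le_one])).intervalIntegrable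
  have hftc : ∫ t in (0 : ℝ)..1, g (x + t • h) h = f (x + h) - f x := by
    have := integral_eq_of_hasDerivAt_off_countable_of_le (fun t : ℝ => f (x + t • h))
      (fun t => g (x + t • h) h) zero_le_one (s := {0, -2 * inner ℝ x h / ‖h‖ ^ 2})
      (by simp) (hf.comp hline).continuousOn (fun t ht => ?_) hint
    · simpa using this
    · have hl : HasDerivAt (fun t : ℝ => x + t • h) h t := by
        simpa using ((hasDerivAt_id t).smul_const h).const_add x
      refine (hd _ (hball (hmem t (Ioo_subset_Icc_self ht.1))).1 fun hn => ?_).comp_hasDerivAt t hl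
      refine ht.2 ?_
      have e : ‖x + t • h‖ ^ 2 = 1 + t * (2 * inner ℝ x h + t * ‖h‖ ^ 2) := by
        rw [norm_add_sq_real, hx, inner_smul_right, norm_smul, mul_pow, norm_eq_abs, sq_abs]
        ring
      rw [hn, one_pow, left_eq_add, mul_eq_zero] at e
      refine e.imp id fun e => ?_
      have : ‖h‖ ^ 2 ≠ 0 := by positivity
      rw [mem_singleton_iff, eq_div_iff this]
      linarith
  have hsub : f (x + h) - f x - g x h = ∫ t in (0 : ℝ)..1, (g (x + t • h) h - g x h) := by
    rw [intervalIntegral.integral_sub hint intervalIntegrable_const, hftc]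
    simp
  rw [hsub]
  have := intervalIntegral.norm_integral_le_of_norm_le_const (a := 0) (b := 1)
    (f := fun t : ℝ => g (x + t • h) h - g x h) (C := ε * ‖h‖) fun t ht => ?_
  · simpa using this
  · rw [uIoc_of_le zero_le_one] at ht
    have h1 := (hball (hmem t (Ioc_subset_Icc_self ht))).2
    have h2 : ‖g (x + t • h) - g x‖ ≤ ε := by
      rw [← dist_eq_norm]
      exact le_of_lt h1
    rw [← sub_apply]
    exact ((g (x + t • h) - g x).le_opNorm h).trans (by gcongr)

/-- The exponents of the reflections used in the extension across the unit sphere. -/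
def reflExp (l : Fin 4) : ℝ := -((l : ℝ) + 2)

/-- The reflections used in the extension across the unit sphere. -/
def sphRefl (l : Fin 4) (x : E4) : E4 := ‖x‖ ^ reflExp l • x

lemma sphRefl_apply (l : Fin 4) (x : E4) (j : Fin 4) :
    (sphRefl l x) j = ‖x‖ ^ reflExp l * x j := rfl

lemma sphRefl_of_norm_eq_one (l : Fin 4) {x : E4} (hx : ‖x‖ = 1) : sphRefl l x = x := by
  simp [sphRefl, hx]

lemma norm_sphRefl_lt_one (l : Fin 4) {x : E4} (hx : 1 < ‖x‖) : ‖sphRefl l x‖ < 1 := by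
  have h0 : 0 < ‖x‖ := by linarith
  rw [sphRefl, norm_smul, norm_of_nonneg (by positivity), ← rpow_add_one h0.ne']
  refine rpow_lt_one_of_one_lt_of_neg hx ?_
  have : (0 : ℝ) ≤ l := by positivity
  rw [reflExp]
  linarith

lemma norm_sphRefl_le_one (l : Fin 4) {x : E4} (hx : 1 ≤ ‖x‖) : ‖sphRefl l x‖ ≤ 1 := by
  rcases hx.eq_or_lt with h | h
  · rw [sphRefl_of_norm_eq_one l h.symm, ← h]
  · exact (norm_sphRefl_lt_one l h).le

lemma hasFDerivAt_sphRefl (l : Fin 4) {x : E4} (hx : x ≠ 0) :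
    HasFDerivAt (sphRefl l) (‖x‖ ^ reflExp l • ContinuousLinearMap.id ℝ E4
      + ((reflExp l * ‖x‖ ^ (reflExp l - 2)) • innerSL ℝ x).smulRight x) x :=
  (hasFDerivAt_norm_rpow_of_ne hx (reflExp l)).fun_smul (hasFDerivAt_id x)

lemma continuousOn_sphRefl (l : Fin 4) : ContinuousOn (sphRefl l) {0}ᶜ :=
  fun _ hx => (hasFDerivAt_sphRefl l hx).continuousAt.continuousWithinAt

/-- Hestenes' extension of a function across the unit sphere. -/
def glue (c : Fin 4 → ℝ) (w : E4 → ℝ) (x : E4) : ℝ :=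
  if ‖x‖ ≤ 1 then w x else ∑ l, c l * w (sphRefl l x)

lemma glue_of_norm_le_one (c : Fin 4 → ℝ) (w : E4 → ℝ) {x : E4} (hx : ‖x‖ ≤ 1) :
    glue c w x = w x := if_pos hx

lemma glue_of_one_lt_norm (c : Fin 4 → ℝ) (w : E4 → ℝ) {x : E4} (hx : 1 < ‖x‖) :
    glue c w x = ∑ l, c l * w (sphRefl l x) := if_neg hx.not_ge

lemma continuous_glue {c : Fin 4 → ℝ} (hc : ∑ l, c l = 1) {w : E4 → ℝ}
    (hw : ContinuousOn w (Metric.closedBall 0 1)) : Continuous (glue c w) := by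
  refine continuous_if_le continuous_norm continuous_const (hw.mono fun x hx => by simpa using hx)
    ?_ fun x hx => ?_
  · refine continuousOn_finsetSum _ fun l _ => continuousOn_const.mul (hw.comp
      ((continuousOn_sphRefl l).mono fun x hx => ?_) fun x hx => ?_)
    · rintro rfl
      norm_num at hx
    · simpa using norm_sphRefl_le_one l hx
  · simp only [sphRefl_of_norm_eq_one _ hx, ← Finset.sum_mul, hc, one_mul]

/-- The radial derivative in terms of the partial derivatives. -/
def radialPart (p : Fin 4 → E4 → ℝ) (x : E4) : ℝ := ∑ j, x j * p j x

/-- The angular derivatives in terms of the partial derivatives. -/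
def angularPart (p : Fin 4 → E4 → ℝ) (i j : Fin 4) (x : E4) : ℝ := x j * p i x - x i * p j x

lemma CK.radialPart {k : ℕ} {p : Fin 4 → E4 → ℝ} (hp : ∀ i, CK k (p i)) :
    CK k (radialPart p) := CK.sum fun j => (CK.coord k j).mul (hp j)

lemma CK.angularPart {k : ℕ} {p : Fin 4 → E4 → ℝ} (hp : ∀ i, CK k (p i)) (i j : Fin 4) :
    CK k (angularPart p i j) := ((CK.coord k j).mul (hp i)).sub ((CK.coord k i).mul (hp j))

/-- The partial derivatives of `glue c w` in terms of those of `w`. -/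
def gluePartial (c : Fin 4 → ℝ) (p : Fin 4 → E4 → ℝ) (i : Fin 4) (x : E4) : ℝ :=
  ‖x‖ ^ (-2 : ℝ) * (x i * glue (fun l => c l * (reflExp l + 1)) (radialPart p) x
    + ∑ j, x j * glue c (angularPart p i j) x)

lemma norm_rpow_neg_two_mul {x : E4} (hx : x ≠ 0) :
    ‖x‖ ^ (-2 : ℝ) * (x 0 ^ 2 + x 1 ^ 2 + x 2 ^ 2 + x 3 ^ 2) = 1 := by
  have h0 : 0 < ‖x‖ := norm_pos_iff.2 hx
  have h := EuclideanSpace.real_norm_sq_eq x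
  rw [Fin.sum_univ_four] at h
  rw [← h, rpow_neg h0.le]
  norm_cast
  exact inv_mul_cancel₀ (by positivity)

lemma linForm_gluePartial_of_norm_lt_one (c : Fin 4 → ℝ) (p : Fin 4 → E4 → ℝ) {x : E4}
    (h0 : x ≠ 0) (hx : ‖x‖ < 1) :
    (linForm fun i => gluePartial c p i x) = linForm fun i => p i x := by
  congr 1
  ext i
  simp only [gluePartial, glue_of_norm_le_one _ _ hx.le, radialPart, angularPart,
    Fin.sum_univ_four]
  linear_combination p i x * norm_rpow_neg_two_mul h0

lemma linForm_gluePartial_of_one_lt_norm (c : Fin 4 → ℝ) (p : Fin 4 → E4 → ℝ) {x : E4}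
    (hx : 1 < ‖x‖) (v : E4) :
    linForm (fun i => gluePartial c p i x) v
      = ∑ l, c l * linForm (fun i => p i (sphRefl l x)) (‖x‖ ^ reflExp l • v
        + (reflExp l * ‖x‖ ^ (reflExp l - 2) * inner ℝ x v) • x) := by
  have h0 : 0 < ‖x‖ := by linarith
  have hn := norm_rpow_neg_two_mul (norm_pos_iff.1 h0)
  have e (l : Fin 4) : ‖x‖ ^ (reflExp l - 2) = ‖x‖ ^ reflExp l * ‖x‖ ^ (-2 : ℝ) := by
    rw [← rpow_add h0, sub_eq_add_neg]
  have key (l : Fin 4) : linForm (fun i => p i (sphRefl l x)) (‖x‖ ^ reflExp l • v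
        + (reflExp l * ‖x‖ ^ (reflExp l - 2) * inner ℝ x v) • x)
      = ∑ i, v i * (‖x‖ ^ (-2 : ℝ) * (x i * ((reflExp l + 1) * radialPart p (sphRefl l x))
        + ∑ j, x j * angularPart p i j (sphRefl l x))) := by
    simp only [linForm_apply, radialPart, angularPart, e, Fin.sum_univ_four, PiLp.add_apply,
      PiLp.smul_apply, smul_eq_mul, sphRefl_apply, PiLp.inner_apply, RCLike.inner_apply,
      conj_trivial]
    linear_combination (-‖x‖ ^ reflExp l * (p 0 (sphRefl l x) * v 0 + p 1 (sphRefl l x) * v 1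
      + p 2 (sphRefl l x) * v 2 + p 3 (sphRefl l x) * v 3)) * hn
  simp only [key, linForm_apply, gluePartial, glue_of_one_lt_norm _ _ hx]
  simp only [Finset.mul_sum]
  rw [Finset.sum_comm]
  simp only [Fin.sum_univ_four]
  ring

lemma hasFDerivAt_glue {c : Fin 4 → ℝ} (hc : ∑ l, c l = 1)
    (hc1 : ∑ l, c l * (reflExp l + 1) = 1) {w : E4 → ℝ} {p : Fin 4 → E4 → ℝ}
    (hw : ContinuousOn w (Metric.closedBall 0 1)) (hp : ∀ i, CK 0 (p i))
    (hd : ∀ x : E4, ‖x‖ < 1 → HasFDerivAt w (linForm fun i => p i x) x) {x : E4} (hx : x ≠ 0) :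
    HasFDerivAt (glue c w) (linForm fun i => gluePartial c p i x) x := by
  have hoff : ∀ y ∈ ({0}ᶜ : Set E4), ‖y‖ ≠ 1 →
      HasFDerivAt (glue c w) (linForm fun i => gluePartial c p i y) y := by
    intro y hy0 hy
    rcases hy.lt_or_gt with hy | hy
    · rw [linForm_gluePartial_of_norm_lt_one c p hy0 hy]
      refine (hd y hy).congr_of_eventuallyEq ?_
      filter_upwards [norm_lt_one_mem_nhds hy] with z hz
      exact glue_of_norm_le_one c w (le_of_lt hz)
    · have h1 (l : Fin 4) := ((hd _ (norm_sphRefl_lt_one l hy)).comp y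
        (hasFDerivAt_sphRefl l hy0)).const_mul (c l)
      refine ((HasFDerivAt.fun_sum fun l (_ : l ∈ Finset.univ) => h1 l).congr_of_eventuallyEq
        ?_).congr_fderiv ?_
      · filter_upwards [(isOpen_lt continuous_const continuous_norm).mem_nhds hy] with z hz
        exact glue_of_one_lt_norm c w hz
      · ext v
        rw [linForm_gluePartial_of_one_lt_norm c p hy]
        simp [mul_add]
  by_cases hx1 : ‖x‖ = 1
  · refine hasFDerivAt_of_hasFDerivAt_off_sphere (g := fun x => linForm fun i => gluePartial c p i x)
      (continuous_glue hc hw) isOpen_compl_singleton ?_ hoff hx hx1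
    refine continuousOn_finsetSum _ fun i _ => ContinuousOn.fun_smul ?_ continuousOn_const
    refine (contDiffOn_norm_rpow (-2) (n := 0)).continuousOn.mul (ContinuousOn.add ?_ ?_)
    · exact ((contDiff_coord i (n := 0)).continuous.mul
        (continuous_glue hc1 (CK.radialPart hp))).continuousOn
    · exact (continuous_finsetSum _ fun j _ => (contDiff_coord j (n := 0)).continuous.mul
        (continuous_glue hc (CK.angularPart hp i j))).continuousOn
  · exact hoff x hx hx1

lemma contDiffOn_glue (k : ℕ) {c : Fin 4 → ℝ}
    (hc : ∀ m ≤ k, ∑ l, c l * (reflExp l + 1) ^ m = 1) {w : E4 → ℝ} (hw : CK k w) :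
    ContDiffOn ℝ k (glue c w) {0}ᶜ := by
  induction k generalizing c w with
  | zero =>
    have : Continuous (glue c w) := continuous_glue (by simpa using hc 0 le_rfl) hw
    simpa using this.continuousOn
  | succ k ih =>
    obtain ⟨hwc, p, hp, hd⟩ := hw
    have hp0 (i : Fin 4) : CK 0 (p i) := (hp i).continuousOn
    have hder {x : E4} (hx : x ∈ ({0}ᶜ : Set E4)) := hasFDerivAt_glue (c := c)
      (by simpa using hc 0 (by omega)) (by simpa using hc 1 (by omega)) hwc hp0 hd hx
    rw [Nat.cast_succ, contDiffOn_succ_iff_fderiv_of_isOpen isOpen_compl_singleton]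
    refine ⟨fun x hx => (hder hx).differentiableAt.differentiableWithinAt, by simp, ?_⟩
    refine ContDiffOn.congr ?_ fun x hx => (hder hx).fderiv
    refine ContDiffOn.sum fun i _ => ContDiffOn.fun_smul ?_ contDiffOn_const
    refine (contDiffOn_norm_rpow (-2)).mul (ContDiffOn.add ?_ ?_)
    · refine (contDiff_coord i).contDiffOn.mul (ih (fun m hm => ?_) (CK.radialPart hp))
      refine (Finset.sum_congr rfl fun l _ => ?_).trans (hc (m + 1) (by omega))
      ring
    · exact ContDiffOn.sum fun j _ => (contDiff_coord j).contDiffOn.mul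
        (ih (fun m hm => hc m (by omega)) (CK.angularPart hp i j))

/-- A function which is smooth in the ball and satisfies a weighted bound on its derivatives of
order `k + 1` is the restriction of a `C^k` function on the whole space. -/
lemma exists_contDiff_extension {w : E4 → ℝ} {β C : ℝ} (hβ0 : 0 < β) (hβ1 : β ≤ 1)
    (hC : 0 ≤ C) {k : ℕ} (hk : k ≤ 3) (hw : ContDiffOn ℝ (k + 1 : ℕ) w (Metric.ball 0 1))
    (hb : ∀ x : E4, ‖x‖ < 1 → ‖iteratedFDeriv ℝ (k + 1) w x‖ ≤ C * (1 - ‖x‖) ^ (β - 1)) :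
    ∃ v : E4 → ℝ, ContDiff ℝ k v ∧ ∀ x : E4, ‖x‖ < 1 → v x = w x := by
  obtain ⟨v, hv, hvw⟩ := exists_CK_of_norm_iteratedFDeriv_le hβ0 hβ1 hC k hw hb
  have heq (x : E4) (hx : ‖x‖ < 1) : glue ![10, -20, 15, -4] v x = w x := by
    rw [glue_of_norm_le_one _ _ hx.le, hvw x hx]
  refine ⟨glue ![10, -20, 15, -4] v, ?_, heq⟩
  rw [contDiff_iff_contDiffAt]
  intro x
  rcases eq_or_ne x 0 with rfl | hx
  · have h1 : ContDiffAt ℝ (k + 1 : ℕ) w 0 := hw.contDiffAt (Metric.ball_mem_nhds _ one_pos)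
    refine (h1.of_le (by norm_cast; omega)).congr_of_eventuallyEq ?_
    filter_upwards [norm_lt_one_mem_nhds (x := (0 : E4)) (by simp)] with y hy using heq y hy
  · refine (contDiffOn_glue k (fun m hm => ?_) hv).contDiffAt (isOpen_compl_singleton.mem_nhds hx)
    have hm3 : m ≤ 3 := by omega
    interval_cases m <;> simp [Fin.sum_univ_four, reflExp] <;> norm_num

lemma hasFDerivAt_normalize {z : E4} (hz : z ≠ 0) :
    HasFDerivAt (fun y : E4 => ‖y‖⁻¹ • y) (‖z‖⁻¹ • ContinuousLinearMap.id ℝ E4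
      + ((-1 * ‖z‖ ^ (-1 - 2 : ℝ)) • innerSL ℝ z).smulRight z) z := by
  have h1 := (hasFDerivAt_norm_rpow_of_ne hz (-1)).fun_smul (hasFDerivAt_id z)
  simpa only [rpow_neg_one, id] using h1

lemma pd_comp_normalize {f : E4 → ℝ} (hf : Differentiable ℝ f) {z : E4} (hz : z ≠ 0)
    (i : Fin 4) : pd i (fun y : E4 => f (‖y‖⁻¹ • y)) z
      = ‖z‖⁻¹ * (pd i f (‖z‖⁻¹ • z)
        - (‖z‖⁻¹ • z) i * fderiv ℝ f (‖z‖⁻¹ • z) (‖z‖⁻¹ • z)) := by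
  have hn : ‖z‖ ≠ 0 := norm_ne_zero_iff.2 hz
  have h2 := HasFDerivAt.comp (f := fun y : E4 => ‖y‖⁻¹ • y) z (hf (‖z‖⁻¹ • z)).hasFDerivAt
    (hasFDerivAt_normalize hz)
  have h3 : ‖z‖ ^ (-1 - 2 : ℝ) = ‖z‖⁻¹ ^ 3 := by
    rw [show (-1 - 2 : ℝ) = -(3 : ℕ) by norm_num, rpow_neg (norm_nonneg z), rpow_natCast, inv_pow]
  change fderiv ℝ (f ∘ fun y : E4 => ‖y‖⁻¹ • y) z (e4 i) = _
  rw [h2.fderiv]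
  simp only [ContinuousLinearMap.comp_apply, add_apply,
    smul_apply, ContinuousLinearMap.smulRight_apply, innerSL_apply_apply,
    inner_e4, map_add, map_smul, smul_eq_mul, pd, PiLp.smul_apply, h3,
    ContinuousLinearMap.id_apply]
  ring

/-- The spherical Laplacian in terms of the Euclidean Laplacian and the radial derivative. -/
lemma sphLap_eq {f : E4 → ℝ} (hf : ContDiff ℝ 2 f) {x : E4} (hx : ‖x‖ = 1) :
    sphLap f x = lap f x - fderiv ℝ (fun y => fderiv ℝ f y y) x x - 2 * fderiv ℝ f x x := by
  have hx0 : x ≠ 0 := norm_ne_zero_iff.1 (by simp [hx])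
  have hfd : Differentiable ℝ f := hf.differentiable (by norm_num)
  set E : E4 → ℝ := fun y => fderiv ℝ f y y with hE
  have hE1 : ContDiff ℝ 1 E := (hf.fderiv_right (by norm_num)).clm_apply contDiff_id
  have hEd := hE1.differentiable (by norm_num)
  have hpd (i : Fin 4) : Differentiable ℝ (pd i f) := fun y =>
    (hf.contDiffAt.pd (m := 1) (by norm_num) i).differentiableAt (by norm_num)
  have hcd (i : Fin 4) : Differentiable ℝ (fun y : E4 => y i) := fun y =>
    (hasFDerivAt_coord i y).differentiableAt
  set G : Fin 4 → E4 → ℝ := fun i y => pd i f y + -1 * (y i * E y) with hG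
  have hGd (i : Fin 4) : Differentiable ℝ (G i) := (hpd i).add (((hcd i).mul hEd).const_mul _)
  have e1 (i : Fin 4) : pd i (fun y : E4 => f (‖y‖⁻¹ • y)) =ᶠ[𝓝 x]
      fun y => ‖y‖ ^ (-1 : ℝ) * G i (‖y‖⁻¹ • y) := by
    filter_upwards [isOpen_ne.mem_nhds hx0] with y hy
    rw [pd_comp_normalize hfd hy, rpow_neg_one]
    simp only [hG, hE]
    ring
  have e2 (i : Fin 4) : pd i (pd i (fun y : E4 => f (‖y‖⁻¹ • y))) x
      = pd i (G i) x - x i * fderiv ℝ (G i) x x - x i * G i x := by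
    rw [((e1 i).pd_eq i).eq_of_nhds,
      pd_mul (hasFDerivAt_norm_rpow_of_ne hx0 (-1)).differentiableAt
        (DifferentiableAt.fun_comp' x (hGd i _) (hasFDerivAt_normalize hx0).differentiableAt),
      pd_comp_normalize (hGd i) hx0, pd_norm_rpow hx0]
    simp only [hx, inv_one, one_smul, one_rpow]
    ring
  have e3 : ∑ i, x i * fderiv ℝ (G i) x x + ∑ i, x i * G i x = -2 * E x := by
    have h1 : (fun y : E4 => (1 - ‖y‖ ^ 2) * E y) = fun y => ∑ i, y i * G i y := by
      ext y
      have : ‖y‖ ^ 2 = ∑ i, y i * y i := by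
        rw [EuclideanSpace.norm_sq_eq]; simp [sq]
      rw [this]
      simp only [hG, mul_add, Finset.sum_add_distrib, ← fderiv_eq_sum_pd]
      rw [sub_mul, one_mul, sub_eq_add_neg, Finset.sum_mul, ← Finset.sum_neg_distrib]
      congr 1
      exact Finset.sum_congr rfl fun i _ => by ring
    have h2 : fderiv ℝ (fun y : E4 => (1 - ‖y‖ ^ 2) * E y) x x = -2 * E x := by
      rw [fderiv_fun_mul (hasFDerivAt_one_sub_norm_sq x).differentiableAt (hEd x),
        (hasFDerivAt_one_sub_norm_sq x).fderiv]
      simp [hx]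
      ring
    rw [← h2, h1, fderiv_fun_sum fun i _ => ((hcd i) x).fun_mul (hGd i x)]
    simp only [sum_apply, ← Finset.sum_add_distrib]
    refine Finset.sum_congr rfl fun i _ => ?_
    rw [fderiv_fun_mul (hcd i x) (hGd i x), (hasFDerivAt_coord i x).fderiv]
    simp
    ring
  have e4 : ∑ i, pd i (G i) x = lap f x - fderiv ℝ E x x - 4 * E x := by
    have h (i : Fin 4) : pd i (G i) x = pd i (pd i f) x - x i * pd i E x - E x := by
      rw [pd_add (hpd i x) (((hcd i x).fun_mul (hEd x)).const_mul _),
        pd_const_mul ((hcd i x).fun_mul (hEd x)), pd_mul (hcd i x) (hEd x), pd_coord]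
      simp
      ring
    simp only [h, Finset.sum_sub_distrib, ← fderiv_eq_sum_pd, lap_eq_sum_pd]
    simp
  have e5 : ∑ i, pd i (pd i (fun y : E4 => f (‖y‖⁻¹ • y))) x
      = ∑ i, pd i (G i) x - (∑ i, x i * fderiv ℝ (G i) x x + ∑ i, x i * G i x) := by
    simp only [e2, Finset.sum_sub_distrib]
    ring
  rw [sphLap, lap_eq_sum_pd, e5, e3, e4]
  ring

lemma eq_of_eq_on_ball {F : Type*} [TopologicalSpace F] [T2Space F] {f g : E4 → F}
    (hf : Continuous f) (hg : Continuous g) (h : ∀ x : E4, ‖x‖ < 1 → f x = g x) {x : E4}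
    (hx : ‖x‖ ≤ 1) : f x = g x := by
  have h1 : EqOn f g (Metric.ball 0 1) := fun y hy => h y (by simpa using hy)
  have h2 := h1.closure hf hg
  rw [closure_ball _ one_ne_zero] at h2
  exact h2 (by simpa using hx)

lemma contDiffAt_comp_normalize {f : E4 → ℝ} {n : WithTop ℕ∞} (hf : ContDiff ℝ n f) {x : E4}
    (hx : x ≠ 0) : ContDiffAt ℝ n (fun y : E4 => f (‖y‖⁻¹ • y)) x :=
  hf.contDiffAt.comp x
    (((contDiffAt_norm ℝ hx).inv (norm_ne_zero_iff.2 hx)).smul contDiffAt_id)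

lemma sphLap_congr {f g : E4 → ℝ} (h : ∀ y : E4, ‖y‖ = 1 → f y = g y) {x : E4} (hx : x ≠ 0) :
    sphLap f x = sphLap g x := by
  apply Filter.EventuallyEq.lap_eq
  filter_upwards [isOpen_ne.mem_nhds hx] with y hy
  exact h _ (norm_normalize hy)

lemma eq_zero_of_eq_one_sub_norm_sq_mul {h U : E4 → ℝ} (hh : ContDiff ℝ 2 h)
    (hU : ContDiff ℝ 3 U) (hUh : ∀ y : E4, ‖y‖ < 1 → U y = (1 - ‖y‖ ^ 2) * h y)
    {x : E4} (hx : ‖x‖ = 1) : U x = 0 := by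
  rw [eq_of_eq_on_ball hU.continuous (contDiff_one_sub_norm_sq.mul hh).continuous hUh hx.le, hx]
  simp

lemma muM_of_eq_one_sub_norm_sq_mul {h U : E4 → ℝ} (hh : ContDiff ℝ 2 h)
    (hU : ContDiff ℝ 3 U) (hUh : ∀ y : E4, ‖y‖ < 1 → U y = (1 - ‖y‖ ^ 2) * h y)
    {x : E4} (hx : ‖x‖ = 1) : muM U x = 2 * h x := by
  have hp : ContDiff ℝ 2 fun y : E4 => (1 - ‖y‖ ^ 2) * h y := contDiff_one_sub_norm_sq.mul hh
  have h1 : fderiv ℝ U x = fderiv ℝ (fun y : E4 => (1 - ‖y‖ ^ 2) * h y) x := by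
    refine eq_of_eq_on_ball (hU.continuous_fderiv (by norm_num))
      (hp.continuous_fderiv (by norm_num)) (fun y hy => Filter.EventuallyEq.fderiv_eq ?_) hx.le
    filter_upwards [norm_lt_one_mem_nhds hy] with z hz using hUh z hz
  rw [muM, h1, fderiv_fun_mul (hasFDerivAt_one_sub_norm_sq x).differentiableAt
    (hh.differentiable (by norm_num) x), (hasFDerivAt_one_sub_norm_sq x).fderiv]
  simp [hx]
  ring

lemma lap_of_eq_one_sub_norm_sq_mul {h U : E4 → ℝ} (hh : ContDiff ℝ 2 h)
    (hl : ∀ y : E4, ‖y‖ < 1 → lap h y = 0)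
    (hUh : ∀ y : E4, ‖y‖ < 1 → U y = (1 - ‖y‖ ^ 2) * h y) {x : E4} (hx : ‖x‖ < 1) :
    lap U x = -8 * h x + -4 * fderiv ℝ h x x := by
  have h1 : U =ᶠ[𝓝 x] fun y => (1 - ‖y‖ ^ 2) * h y := by
    filter_upwards [norm_lt_one_mem_nhds hx] with z hz using hUh z hz
  rw [h1.lap_eq, lap_one_sub_norm_sq_mul hh.contDiffAt, hl x hx]
  ring

lemma P3M_of_eq_one_sub_norm_sq_mul {h U : E4 → ℝ} (hh : ContDiff ℝ 2 h)
    (hU : ContDiff ℝ 3 U) (hl : ∀ y : E4, ‖y‖ < 1 → lap h y = 0)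
    (hUh : ∀ y : E4, ‖y‖ < 1 → U y = (1 - ‖y‖ ^ 2) * h y) {x : E4} (hx : ‖x‖ = 1) :
    P3M U x = 0 := by
  have hx0 : x ≠ 0 := norm_ne_zero_iff.1 (by simp [hx])
  have hE : ContDiff ℝ 1 fun y => fderiv ℝ h y y :=
    (hh.fderiv_right (by norm_num)).clm_apply contDiff_id
  have h1 : ContDiff ℝ 1 h := hh.of_le (by norm_num)
  have hr : ContDiff ℝ 1 fun y => -8 * h y + -4 * fderiv ℝ h y y :=
    (contDiff_const.mul h1).add (contDiff_const.mul hE)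
  have hlU : ContDiff ℝ 1 (lap U) :=
    contDiff_iff_contDiffAt.2 fun y => hU.contDiffAt.lap (by norm_num)
  have hd : fderiv ℝ (lap U) x = fderiv ℝ (fun y => -8 * h y + -4 * fderiv ℝ h y y) x := by
    refine eq_of_eq_on_ball (hlU.continuous_fderiv (by norm_num))
      (hr.continuous_fderiv (by norm_num)) (fun y hy => Filter.EventuallyEq.fderiv_eq ?_) hx.le
    filter_upwards [norm_lt_one_mem_nhds hy] with z hz
      using lap_of_eq_one_sub_norm_sq_mul hh hl hUh hz
  have hd' : muM (lap U) x = 8 * fderiv ℝ h x x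
      + 4 * fderiv ℝ (fun y => fderiv ℝ h y y) x x := by
    have h1d := h1.differentiable one_ne_zero x
    have hEd := hE.differentiable one_ne_zero x
    rw [muM, hd, fderiv_fun_add (h1d.const_mul _) (hEd.const_mul _), fderiv_const_mul h1d,
      fderiv_const_mul hEd]
    simp
    ring
  have hlh : lap h x = 0 :=
    eq_of_eq_on_ball (Continuous.lap hh) continuous_const hl hx.le
  have hs1 : sphLap (muM U) x = 2 * sphLap h x := by
    rw [sphLap_congr (fun y hy => muM_of_eq_one_sub_norm_sq_mul hh hU hUh hy) hx0]
    exact lap_const_mul (contDiffAt_comp_normalize hh hx0) 2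
  have hs2 : sphLap U x = 0 := by
    rw [sphLap_congr (g := fun _ => 0)
      (fun y hy => eq_zero_of_eq_one_sub_norm_sq_mul hh hU hUh hy) hx0]
    simp [sphLap, lap]
  rw [P3M, hd', hs1, hs2, sphLap_eq hh hx, hlh]
  ring

lemma biharmonic_of_eq_one_sub_norm_sq_mul {h U : E4 → ℝ} (hh : ContDiff ℝ 2 h)
    (hl : ∀ y : E4, ‖y‖ < 1 → lap h y = 0)
    (hUh : ∀ y : E4, ‖y‖ < 1 → U y = (1 - ‖y‖ ^ 2) * h y) {x : E4} (hx : ‖x‖ < 1)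
    (h3 : ContDiffAt ℝ 3 h x) :
    lap (lap U) x = 0 := by
  have h1 : lap U =ᶠ[𝓝 x] fun y => -8 * h y + -4 * fderiv ℝ h y y := by
    filter_upwards [norm_lt_one_mem_nhds hx] with z hz
      using lap_of_eq_one_sub_norm_sq_mul hh hl hUh hz
  have hE : ContDiffAt ℝ 2 (fun y => fderiv ℝ h y y) x :=
    (h3.fderiv_right (by norm_num)).clm_apply contDiffAt_id
  have h0 : lap h =ᶠ[𝓝 x] fun _ => 0 := by
    filter_upwards [norm_lt_one_mem_nhds hx] with z hz using hl z hz
  rw [h1.lap_eq, lap_add (contDiffAt_const.mul hh.contDiffAt) (contDiffAt_const.mul hE),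
    lap_const_mul hh.contDiffAt, lap_const_mul hE, lap_fderiv_self h3, hl x hx, h0.fderiv_eq]
  simp

/-- A function with a second order Taylor expansion on the sphere is Lipschitz there. -/
lemma exists_abs_sub_le_of_taylor {g : E4 → ℝ} {A α : ℝ} (hA : 0 ≤ A) (hα : 0 ≤ α) {ζ : E4}
    (hζ : ‖ζ‖ = 1) {a : Option (Fin 4) → Option (Fin 4) → ℝ}
    (ha : ∀ y : E4, ‖y‖ = 1 →
      |g y - ∑ o, ∑ o', a o o' * (affCoord o y * affCoord o' y)| ≤ A * ‖y - ζ‖ ^ (2 + α)) :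
    ∃ L : ℝ, 0 ≤ L ∧ ∀ y : E4, ‖y‖ = 1 → |g y - g ζ| ≤ L * ‖y - ζ‖ := by
  set P : E4 → ℝ := fun y => ∑ o, ∑ o', a o o' * (affCoord o y * affCoord o' y) with hP
  have hPs : ContDiff ℝ 1 P := ContDiff.sum fun o _ => ContDiff.sum fun o' _ =>
    contDiff_const.mul ((contDiff_affCoord o).mul (contDiff_affCoord o'))
  obtain ⟨L, hL⟩ := (isCompact_closedBall (0 : E4) 1).exists_bound_of_continuousOn
    (hPs.continuous_fderiv one_ne_zero).continuousOn
  have hL0 : 0 ≤ L := (norm_nonneg _).trans (hL ζ (by simp [hζ]))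
  have hPζ : g ζ = P ζ := by
    have := ha ζ hζ
    rw [sub_self, norm_zero, zero_rpow (by positivity), mul_zero] at this
    exact sub_eq_zero.1 (abs_nonpos_iff.1 this)
  refine ⟨A * 2 ^ (1 + α) + L, by positivity, fun y hy => ?_⟩
  have h1 : |P y - P ζ| ≤ L * ‖y - ζ‖ := by
    simpa using (convex_closedBall (0 : E4) 1).norm_image_sub_le_of_norm_fderiv_le
      (fun z _ => hPs.differentiable one_ne_zero z) hL (x := ζ) (y := y) (by simp [hζ])
      (by simp [hy])
  have h2 : ‖y - ζ‖ ≤ 2 := (norm_sub_le _ _).trans (by rw [hy, hζ]; norm_num)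
  have h3 : ‖y - ζ‖ ^ (2 + α) ≤ 2 ^ (1 + α) * ‖y - ζ‖ := by
    rw [show 2 + α = (1 + α) + 1 by ring, rpow_add_one' (norm_nonneg _) (by positivity)]
    gcongr
  calc |g y - g ζ| = |(g y - P y) + (P y - P ζ)| := by rw [hPζ]; ring_nf
    _ ≤ |g y - P y| + |P y - P ζ| := abs_add_le _ _
    _ ≤ A * (2 ^ (1 + α) * ‖y - ζ‖) + L * ‖y - ζ‖ := by
      gcongr
      exact (ha y hy).trans (by gcongr)
    _ = _ := by ring

lemma eq_of_eq_poisson {g h : E4 → ℝ} (hg : ContinuousOn g (Metric.sphere (0 : E4) 1))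
    (hh : Continuous h) (hhg : ∀ x : E4, ‖x‖ < 1 → h x = poisson g x) {ζ : E4} (hζ : ‖ζ‖ = 1)
    {L : ℝ} (hL0 : 0 ≤ L) (hL : ∀ y : E4, ‖y‖ = 1 → |g y - g ζ| ≤ L * ‖y - ζ‖) :
    h ζ = sphMeas.real univ * g ζ := by
  obtain ⟨C, hC0, hC⟩ := exists_abs_poisson_sub_le
  have h1 : Filter.Tendsto (fun t : ℝ => h (t • ζ)) (𝓝[<] 1) (𝓝 (h ζ)) := by
    have : Continuous fun t : ℝ => h (t • ζ) := by fun_prop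
    simpa using (this.tendsto 1).mono_left nhdsWithin_le_nhds
  have h2 : Filter.Tendsto (fun t : ℝ => C * L * (1 - t) ^ (1 / 2 : ℝ)) (𝓝[<] 1) (𝓝 0) := by
    simpa using tendsto_rpow_half_one_sub.const_mul (C * L)
  have h3 : Filter.Tendsto (fun t : ℝ => h (t • ζ)) (𝓝[<] 1) (𝓝 (sphMeas.real univ * g ζ)) := by
    refine tendsto_iff_norm_sub_tendsto_zero.2 (squeeze_zero' (Filter.Eventually.of_forall
      fun t => norm_nonneg _) ?_ h2)
    filter_upwards [Ioo_mem_nhdsLT (zero_lt_one (α := ℝ))] with t ht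
    have hn : ‖t • ζ‖ = t := by rw [norm_smul, hζ, mul_one, norm_of_nonneg ht.1.le]
    have := hC g L (t • ζ) ζ hg hL0 (by rw [hn]; exact ht.2) hζ (by rw [hn]) hL
    rw [hn, ← hhg _ (by rw [hn]; exact ht.2)] at this
    exact this
  exact tendsto_nhds_unique h1 h3

lemma holderOnWith_of_norm_sub_le {F : Type*} [NormedAddCommGroup F] {f : E4 → F}
    (hf : Continuous f) {C β : ℝ} (hC : 0 ≤ C) (hβ : 0 < β)
    (h : ∀ x y : E4, ‖x‖ < 1 → ‖y‖ < 1 → ‖f x - f y‖ ≤ C * ‖x - y‖ ^ β) :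
    HolderOnWith C.toNNReal ⟨β, hβ.le⟩ f (Metric.closedBall 0 1) := by
  have hc : IsClosed {p : E4 × E4 | ‖f p.1 - f p.2‖ ≤ C * ‖p.1 - p.2‖ ^ β} :=
    isClosed_le (by fun_prop) (continuous_const.mul
      ((by fun_prop : Continuous fun p : E4 × E4 => ‖p.1 - p.2‖).rpow_const
        fun _ => Or.inr hβ.le))
  have hs : closure (Metric.ball (0 : E4) 1 ×ˢ Metric.ball (0 : E4) 1)
      ⊆ {p : E4 × E4 | ‖f p.1 - f p.2‖ ≤ C * ‖p.1 - p.2‖ ^ β} :=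
    closure_minimal (fun p hp => h _ _ (by simpa using hp.1) (by simpa using hp.2)) hc
  rw [closure_prod_eq, closure_ball _ one_ne_zero] at hs
  intro x hx y hy
  have := hs (mk_mem_prod hx hy)
  simp only [mem_ofPred_eq, ← dist_eq_norm] at this
  rw [edist_dist, edist_dist]
  change ENNReal.ofReal _ ≤ ENNReal.ofReal C * ENNReal.ofReal _ ^ β
  rw [ENNReal.ofReal_rpow_of_nonneg dist_nonneg hβ.le, ← ENNReal.ofReal_mul hC]
  exact ENNReal.ofReal_le_ofReal this

end

/-- Hölder data version on the ball: if `φ ∈ C^{2,α}(S³)` (its `0`-homogeneous extension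
is `C²` with `α`-Hölder second derivatives on a neighborhood of `S³`), then for any
`0 < β < α` there is a solution `u`, smooth in the open ball and of class `C^{3,β}` up
to the closed ball, which vanishes on `S³`; and among `C³` solutions vanishing on `S³`
it is unique. -/
theorem stmt3 (α β : ℝ) (hα0 : 0 < α) (hα1 : α ≤ 1) (hβ0 : 0 < β) (hβα : β < α)
    (φ : E4 → ℝ)
    (hφ : ∃ U : Set E4, IsOpen U ∧ Metric.sphere (0 : E4) 1 ⊆ U ∧
      ContDiffOn ℝ 2 (fun y : E4 => φ (‖y‖⁻¹ • y)) U ∧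
      ∃ C : NNReal, HolderOnWith C ⟨α, hα0.le⟩
        (iteratedFDeriv ℝ 2 (fun y : E4 => φ (‖y‖⁻¹ • y))) U) :
    (∃ u : E4 → ℝ, SolBallC3 φ u ∧ ContDiffOn ℝ (⊤ : ℕ∞) u (Metric.ball 0 1) ∧
      (∃ C : NNReal, HolderOnWith C ⟨β, hβ0.le⟩
        (iteratedFDeriv ℝ 3 u) (Metric.closedBall 0 1)) ∧
      (∀ x : E4, ‖x‖ = 1 → u x = 0)) ∧
    (∀ u₁ u₂ : E4 → ℝ, SolBallC3 φ u₁ → SolBallC3 φ u₂ →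
      (∀ x : E4, ‖x‖ = 1 → u₁ x = 0) → (∀ x : E4, ‖x‖ = 1 → u₂ x = 0) →
      Set.EqOn u₁ u₂ (Metric.closedBall 0 1)) := by
  refine ⟨?_, fun u₁ u₂ h1 h2 h1' h2' => h1.eqOn h2 h1' h2'⟩
  obtain ⟨V, hV, hSV, hΦ, C₀, hC₀⟩ := hφ
  set Φ : E4 → ℝ := fun y => φ (‖y‖⁻¹ • y) with hΦdef
  have hΦφ (y : E4) (hy : ‖y‖ = 1) : Φ y = φ y := by simp [hΦdef, hy]
  set c := sphMeas.real univ with hc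
  have hc0 : 0 < c := sphMeas_real_univ_pos
  set g : E4 → ℝ := fun y => (2 * c)⁻¹ * Φ y with hg
  have hgc : ContinuousOn g (Metric.sphere (0 : E4) 1) :=
    continuousOn_const.mul (hΦ.continuousOn.mono hSV)
  obtain ⟨A, hA0, hA⟩ := exists_taylor_affCoord hV hSV hΦ hC₀
  have hA' : 0 ≤ (2 * c)⁻¹ * A := by positivity
  have hT : ∀ ζ : E4, ‖ζ‖ = 1 → ∃ a : Option (Fin 4) → Option (Fin 4) → ℝ,
      (∀ o o', |a o o'| ≤ (2 * c)⁻¹ * A) ∧ ∀ y : E4, ‖y‖ = 1 →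
        |g y - ∑ o, ∑ o', a o o' * (affCoord o y * affCoord o' y)|
          ≤ (2 * c)⁻¹ * A * ‖y - ζ‖ ^ (2 + α) := by
    intro ζ hζ
    obtain ⟨a, ha, hay⟩ := hA ζ hζ
    refine ⟨fun o o' => (2 * c)⁻¹ * a o o', fun o o' => ?_, fun y hy => ?_⟩
    · rw [abs_mul, abs_of_pos (by positivity : (0 : ℝ) < (2 * c)⁻¹)]
      exact mul_le_mul_of_nonneg_left (ha o o') (by positivity)
    · simp only [mul_assoc (2 * c)⁻¹, ← Finset.mul_sum, hg, ← mul_sub]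
      rw [abs_mul, abs_of_pos (by positivity : (0 : ℝ) < (2 * c)⁻¹)]
      exact mul_le_mul_of_nonneg_left (hay y hy) (by positivity)
  have hβ1 : β ≤ 1 := hβα.le.trans hα1
  set N : E4 → ℝ := sphPot (fun z : E4 => ‖z‖ ^ (-4 : ℝ)) g with hN
  have hNs : ContDiffOn ℝ (⊤ : ℕ∞) N (Metric.ball 0 1) :=
    contDiffOn_top_sphPot (contDiffOn_norm_rpow _) hgc
  have hw (m : ℕ) : ContDiffOn ℝ (⊤ : ℕ∞) (fun y : E4 => (1 - ‖y‖ ^ 2) ^ m * N y)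
      (Metric.ball 0 1) := (contDiff_one_sub_norm_sq.pow m).contDiffOn.mul hNs
  obtain ⟨C₁, hC₁0, hC₁⟩ := exists_norm_iteratedFDeriv_pow_mul_sphPot_le hA' hα1 hβ0 hβα
    le_rfl hgc hT
  obtain ⟨C₂, hC₂0, hC₂⟩ := exists_norm_iteratedFDeriv_pow_mul_sphPot_le hA' hα1 hβ0 hβα
    one_le_two hgc hT
  obtain ⟨h, hh, hhw⟩ := exists_contDiff_extension hβ0 hβ1 hC₁0 (k := 2) (by norm_num)
    (contDiffOn_infty.1 (hw 1) 3) hC₁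
  obtain ⟨U, hU, hUw⟩ := exists_contDiff_extension hβ0 hβ1 hC₂0 (k := 3) le_rfl
    (contDiffOn_infty.1 (hw 2) 4) hC₂
  replace hh : ContDiff ℝ 2 h := hh
  replace hU : ContDiff ℝ 3 U := hU
  have hhp (x : E4) (hx : ‖x‖ < 1) : h x = poisson g x := by
    rw [hhw x hx, pow_one, poisson]
  have hhe (x : E4) (hx : ‖x‖ < 1) : h =ᶠ[𝓝 x] poisson g := by
    filter_upwards [norm_lt_one_mem_nhds hx] with z hz using hhp z hz
  have hl (x : E4) (hx : ‖x‖ < 1) : lap h x = 0 := by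
    rw [(hhe x hx).lap_eq, lap_poisson hgc hx]
  have hUh (x : E4) (hx : ‖x‖ < 1) : U x = (1 - ‖x‖ ^ 2) * h x := by
    rw [hUw x hx, hhw x hx]
    ring
  have hbd (x : E4) (hx : ‖x‖ = 1) : 2 * h x = φ x := by
    obtain ⟨a, -, ha⟩ := hT x hx
    obtain ⟨L, hL0, hL⟩ := exists_abs_sub_le_of_taylor hA' hα0.le hx ha
    rw [eq_of_eq_poisson hgc hh.continuous hhp hx hL0 hL, ← hc, hg, ← hΦφ x hx]
    field_simp
  have hUs : ContDiffOn ℝ (⊤ : ℕ∞) U (Metric.ball 0 1) :=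
    (hw 2).congr fun x hx => hUw x (by simpa using hx)
  refine ⟨U, ⟨hU, contDiffOn_infty.1 hUs 4, fun x hx => ?_,
    fun x hx => P3M_of_eq_one_sub_norm_sq_mul hh hU hl hUh hx,
    fun x hx => (muM_of_eq_one_sub_norm_sq_mul hh hU hUh hx).trans (hbd x hx)⟩, hUs, ?_,
    fun x hx => eq_zero_of_eq_one_sub_norm_sq_mul hh hU hUh hx⟩
  · exact biharmonic_of_eq_one_sub_norm_sq_mul hh hl hUh hx
      ((contDiffAt_poisson hgc hx 3).congr_of_eventuallyEq (hhe x hx))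
  · have hd (x : E4) (hx : ‖x‖ < 1) : DifferentiableAt ℝ (iteratedFDeriv ℝ 3 U) x :=
      ((contDiffOn_infty.1 hUs 4).contDiffAt
        (Metric.isOpen_ball.mem_nhds (by simpa using hx))).differentiableAt_iteratedFDeriv
        (by norm_num)
    obtain ⟨C, hC0, hC⟩ := exists_norm_sub_le_of_norm_fderiv_le hβ0 hβ1 hC₂0 hd fun x hx => by
      have he : U =ᶠ[𝓝 x] fun y : E4 => (1 - ‖y‖ ^ 2) ^ 2 * N y := by
        filter_upwards [norm_lt_one_mem_nhds hx] with z hz using hUw z hz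
      rw [norm_fderiv_iteratedFDeriv, (he.iteratedFDeriv ℝ 4).eq_of_nhds]
      exact hC₂ x hx
    exact ⟨C.toNNReal, holderOnWith_of_norm_sub_le
      (hU.continuous_iteratedFDeriv (by norm_num)) hC0 hβ0 hC⟩
end
end

section
/- Let k be a nonnegative integer and let f : [0,π] → ℝ be k times continuously differentiable (with one-sided derivatives at the endpoints). Define Φ : S³ → ℝ by Φ(x) := f(arccos(x₄)). Then Φ is k times continuously differentiable as a function on the sphere S³ (with its standard smooth manifold structure) if and only if every odd-order derivative of f of order at most k vanishes at both endpoints: f^{(j)}(0) = f^{(j)}(π) = 0 for all odd j ≤ k. -/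
noncomputable section

open Real Set
open scoped Manifold Topology

instance : Fact (Module.finrank ℝ E4 = 3 + 1) := ⟨by simp⟩

/-- A function on `ℝ` is flat of order `n` at `0` if it is `C^n` and all its derivatives of order
at most `n` vanish at `0`. -/
structure FlatAtZero (n : ℕ) (r : ℝ → ℝ) : Prop where
  contDiff : ContDiff ℝ n r
  iteratedDeriv_eq_zero : ∀ j ≤ n, iteratedDeriv j r 0 = 0

namespace FlatAtZero

variable {n : ℕ} {r φ : ℝ → ℝ}

lemma apply_zero (h : FlatAtZero n r) : r 0 = 0 := by
  simpa using h.iteratedDeriv_eq_zero 0 (Nat.zero_le _)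

lemma of_le {m : ℕ} (h : FlatAtZero n r) (hmn : m ≤ n) : FlatAtZero m r :=
  ⟨h.contDiff.of_le (by exact_mod_cast hmn), fun j hj => h.iteratedDeriv_eq_zero j (hj.trans hmn)⟩

protected lemma deriv (h : FlatAtZero (n + 1) r) : FlatAtZero n (deriv r) where
  contDiff := by
    have := h.contDiff
    push_cast at this
    exact (contDiff_succ_iff_deriv.1 this).2.2
  iteratedDeriv_eq_zero j hj := by
    rw [← iteratedDeriv_succ']
    exact h.iteratedDeriv_eq_zero _ (by omega)

lemma isLittleO (h : FlatAtZero n r) : r =o[𝓝 0] fun t => t ^ n := by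
  have key := taylor_isLittleO_univ (x₀ := 0) h.contDiff
  simp only [taylor_within_apply, iteratedDerivWithin_univ, sub_zero] at key
  refine key.congr_left fun t => ?_
  rw [Finset.sum_eq_zero, sub_zero]
  intro j hj
  rw [h.iteratedDeriv_eq_zero j (by simpa [Nat.lt_succ_iff] using hj), smul_zero]

lemma comp (h : FlatAtZero n r) (hφ : ContDiff ℝ n φ) (hφ0 : φ 0 = 0) :
    FlatAtZero n (r ∘ φ) where
  contDiff := h.contDiff.comp hφ
  iteratedDeriv_eq_zero j hj := by
    have hj' : (j : WithTop ℕ∞) ≤ n := by exact_mod_cast hj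
    set D : ℝ := 1 + ∑ i ∈ Finset.range (j + 1), ‖iteratedFDeriv ℝ i φ 0‖ with hD
    have hD1 : 1 ≤ D := le_add_of_nonneg_right (Finset.sum_nonneg fun _ _ => norm_nonneg _)
    have key := norm_iteratedFDeriv_comp_le (h.contDiff.of_le hj') (hφ.of_le hj')
      (n := j) le_rfl (0 : ℝ) (C := 0) (D := D) (fun i hi => ?_) (fun i hi hij => ?_)
    · rw [norm_iteratedFDeriv_eq_norm_iteratedDeriv] at key
      exact norm_le_zero_iff.1 (by simpa using key)
    · rw [norm_iteratedFDeriv_eq_norm_iteratedDeriv, hφ0,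
        h.iteratedDeriv_eq_zero i (hi.trans hj), norm_zero]
    · calc ‖iteratedFDeriv ℝ i φ 0‖
          ≤ ∑ i ∈ Finset.range (j + 1), ‖iteratedFDeriv ℝ i φ 0‖ :=
            Finset.single_le_sum (f := fun i => ‖iteratedFDeriv ℝ i φ 0‖)
              (fun _ _ => norm_nonneg _) (Finset.mem_range.2 (by omega))
        _ ≤ D := by linarith
        _ ≤ D ^ i := le_self_pow₀ hD1 (by omega)

end FlatAtZero

/-- A vector-valued function that is smooth away from the origin and positively homogeneous of
degree `-l`. -/
structure SmoothHomogeneous {E F : Type*} [NormedAddCommGroup E] [NormedSpace ℝ E]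
    [NormedAddCommGroup F] [NormedSpace ℝ F] (l : ℕ) (m : E → F) : Prop where
  contDiffAt : ∀ y, y ≠ 0 → ContDiffAt ℝ (⊤ : ℕ∞) m y
  smul_apply : ∀ c : ℝ, 0 < c → ∀ y, c ^ l • m (c • y) = m y

namespace SmoothHomogeneous

universe u

variable {E F : Type u} [NormedAddCommGroup E] [InnerProductSpace ℝ E]
  [NormedAddCommGroup F] [NormedSpace ℝ F] {l : ℕ} {m : E → F}

protected lemma fderiv (h : SmoothHomogeneous l m) : SmoothHomogeneous (l + 1) (fderiv ℝ m) where
  contDiffAt y hy := (h.contDiffAt y hy).fderiv_right (by simp)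
  smul_apply c hc y := by
    have hm : (fun y => c ^ l • m (c • y)) = m := funext (h.smul_apply c hc)
    conv_rhs => rw [← hm]
    rw [show (fun y => c ^ l • m (c • y)) = c ^ l • fun y => m (c • y) from rfl,
      fderiv_const_smul_field, Pi.smul_apply, fderiv_comp_smul, smul_smul, pow_succ]

lemma norm_fderiv_smulRight (h : SmoothHomogeneous l m) :
    SmoothHomogeneous l fun y => (fderiv ℝ (fun z : E => ‖z‖) y).smulRight (m y) where
  contDiffAt y hy := by
    have h1 : ContDiffAt ℝ (⊤ : ℕ∞) (fderiv ℝ (fun z : E => ‖z‖)) y :=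
      (contDiffAt_norm ℝ hy).fderiv_right (m := (⊤ : ℕ∞)) (n := (⊤ : ℕ∞)) (by simp)
    exact h1.smulRight (h.contDiffAt y hy)
  smul_apply c hc y := by
    have hn : (fun z : E => ‖c • z‖) = c • fun z : E => ‖z‖ := by
      ext z; simp [norm_smul, abs_of_pos hc]
    have h2 : c • fderiv ℝ (fun z : E => ‖z‖) (c • y)
        = c • fderiv ℝ (fun z : E => ‖z‖) y := by
      rw [← fderiv_comp_smul (f := fun z : E => ‖z‖), hn, fderiv_const_smul_field, Pi.smul_apply]
    have h3 := smul_right_injective _ hc.ne' h2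
    ext v
    simp only [h3, _root_.smul_apply, ContinuousLinearMap.smulRight_apply]
    rw [smul_comm, h.smul_apply c hc]

lemma exists_norm_le [FiniteDimensional ℝ E] (h : SmoothHomogeneous l m) :
    ∃ C, ∀ y, y ≠ 0 → ‖m y‖ * ‖y‖ ^ l ≤ C := by
  have hc : ContinuousOn m (Metric.sphere 0 1) := fun y hy =>
    (h.contDiffAt y (by rintro rfl; simp at hy)).continuousAt.continuousWithinAt
  obtain ⟨C, hC⟩ := (isCompact_sphere (0 : E) 1).exists_bound_of_continuousOn hc
  refine ⟨C, fun y hy => ?_⟩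
  have hy' : 0 < ‖y‖ := norm_pos_iff.2 hy
  have h1 := hC (‖y‖⁻¹ • y) (by simp [norm_smul, hy'.ne'])
  rw [← h.smul_apply _ (inv_pos.2 hy'), norm_smul]
  refine le_trans (le_of_eq ?_) h1
  simp only [norm_pow, norm_inv, norm_norm]
  rw [mul_right_comm, inv_pow, inv_mul_cancel₀ (pow_ne_zero _ hy'.ne'), one_mul]

end SmoothHomogeneous

namespace FlatAtZero

universe u

variable {E F : Type u} [NormedAddCommGroup E] [InnerProductSpace ℝ E] [FiniteDimensional ℝ E]
  [NormedAddCommGroup F] [NormedSpace ℝ F]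

lemma isLittleO_smul {k l : ℕ} {r : ℝ → ℝ} {m : E → F} (hr : FlatAtZero (k + l) r)
    (hm : SmoothHomogeneous l m) :
    (fun y => r ‖y‖ • m y) =o[𝓝 0] fun y => ‖y‖ ^ k := by
  obtain ⟨C, hC⟩ := hm.exists_norm_le
  have h1 : (fun y : E => r ‖y‖) =o[𝓝 0] fun y => ‖y‖ ^ (k + l) :=
    hr.isLittleO.comp_tendsto (by simpa using (continuous_norm (E := E)).tendsto 0)
  have h2 : (fun y : E => r ‖y‖ • m y) =o[𝓝[≠] 0] fun y => ‖y‖ ^ k := by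
    have h3 : (fun y : E => ‖y‖ ^ l • m y) =O[𝓝[≠] 0] fun _ => (1 : ℝ) := by
      refine Asymptotics.IsBigO.of_bound C ?_
      filter_upwards [self_mem_nhdsWithin] with y hy
      simpa [norm_smul, mul_comm] using hC y hy
    have h4 : (fun y : E => r ‖y‖ * (‖y‖ ^ l)⁻¹) =o[𝓝[≠] 0] fun y => ‖y‖ ^ k := by
      have h5 : (fun y : E => r ‖y‖ * (‖y‖ ^ l)⁻¹) =o[𝓝[≠] 0]
          fun y => ‖y‖ ^ (k + l) * (‖y‖ ^ l)⁻¹ :=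
        (h1.mono nhdsWithin_le_nhds).mul_isBigO (Asymptotics.isBigO_refl _ _)
      refine h5.congr' Filter.EventuallyEq.rfl ?_
      filter_upwards [self_mem_nhdsWithin] with y hy
      have : ‖y‖ ≠ 0 := norm_ne_zero_iff.2 hy
      rw [pow_add, mul_inv_cancel_right₀ (pow_ne_zero _ this)]
    refine (h4.smul_isBigO h3).congr' ?_ (by simp)
    filter_upwards [self_mem_nhdsWithin] with y hy
    have : ‖y‖ ≠ 0 := norm_ne_zero_iff.2 hy
    rw [smul_smul, inv_mul_cancel_right₀ (pow_ne_zero _ this)]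
  rw [Asymptotics.isLittleO_iff] at h2 ⊢
  intro c hc
  have := h2 hc
  rw [eventually_nhdsWithin_iff] at this
  filter_upwards [this] with y hy
  by_cases h0 : y = 0
  · subst h0
    simp only [norm_zero, hr.apply_zero, zero_smul]
    positivity
  · exact hy h0

protected lemma contDiff_smul {k l : ℕ} {r : ℝ → ℝ} {m : E → F} (hr : FlatAtZero (k + l) r)
    (hm : SmoothHomogeneous l m) : ContDiff ℝ k fun y => r ‖y‖ • m y := by
  induction k generalizing F l r with
  | zero =>
    rw [Nat.cast_zero, contDiff_zero, continuous_iff_continuousAt]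
    intro y
    by_cases hy : y = 0
    · subst hy
      have h := isLittleO_smul hr hm
      simp only [pow_zero, Asymptotics.isLittleO_one_iff] at h
      simpa [ContinuousAt, hr.apply_zero] using h
    · exact (hr.contDiff.continuous.comp continuous_norm).continuousAt.smul
        (hm.contDiffAt y hy).continuousAt
  | succ k ih =>
    have hr' : FlatAtZero (k + l) (deriv r) :=
      (hr.of_le (by omega : k + l + 1 ≤ k + 1 + l)).deriv
    have h1 := ih hr' hm.norm_fderiv_smulRight
    have h2 := ih (hr.of_le (by omega : k + (l + 1) ≤ k + 1 + l)) hm.fderiv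
    push_cast
    refine contDiff_succ_iff_hasFDerivAt.2 ⟨_, h1.add h2, fun y => ?_⟩
    by_cases hy : y = 0
    · subst hy
      simp only [norm_zero, hr'.apply_zero, hr.apply_zero, zero_smul, add_zero]
      rw [hasFDerivAt_iff_isLittleO_nhds_zero]
      have h := isLittleO_smul (hr.of_le (by omega : 1 + l ≤ k + 1 + l)) hm
      simp only [pow_one] at h
      simpa [hr.apply_zero] using h.of_norm_right
    · have hd : HasDerivAt r (deriv r ‖y‖) ‖y‖ :=
        (hr.contDiff.differentiable (by simp) _).hasDerivAt
      have hn : HasFDerivAt (fun z : E => ‖z‖) (fderiv ℝ (fun z : E => ‖z‖) y) y :=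
        ((contDiffAt_norm (n := 1) ℝ hy).differentiableAt (by simp)).hasFDerivAt
      have hmy : HasFDerivAt m (fderiv ℝ m y) y :=
        ((hm.contDiffAt y hy).differentiableAt (by simp)).hasFDerivAt
      refine ((hd.comp_hasFDerivAt y hn).smul hmy).congr_fderiv ?_
      ext v
      simp [smul_smul, add_comm]

end FlatAtZero

lemma contDiff_comp_norm {E : Type} [NormedAddCommGroup E] [InnerProductSpace ℝ E]
    [FiniteDimensional ℝ E] {k : ℕ} {h : ℝ → ℝ} (hh : ContDiff ℝ k h)
    (hodd : ∀ j ≤ k, Odd j → iteratedDeriv j h 0 = 0) : ContDiff ℝ k fun y : E => h ‖y‖ := by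
  set c : ℕ → ℝ := fun i => iteratedDeriv i h 0 / i.factorial with hc
  set p : ℝ → ℝ := fun t => ∑ i ∈ Finset.range (k + 1), c i * t ^ i with hp
  have hpc : ContDiff ℝ k p := by fun_prop
  have hflat : FlatAtZero k fun t => h t - p t := by
    refine ⟨hh.sub hpc, fun j hj => ?_⟩
    have hj' : (j : WithTop ℕ∞) ≤ k := by exact_mod_cast hj
    rw [iteratedDeriv_fun_sub (hh.of_le hj').contDiffAt (hpc.of_le hj').contDiffAt, hp,
      iteratedDeriv_fun_sum fun i _ => by fun_prop]
    simp only [iteratedDeriv_const_mul_field, iteratedDeriv_fun_pow_zero]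
    rw [Finset.sum_eq_single j]
    · have : (j.factorial : ℝ) ≠ 0 := by positivity
      simp [hc, this]
    · intro i _ hij
      simp [hij.symm]
    · intro hj2
      exact absurd (Finset.mem_range.2 (by omega)) hj2
  have h1 : ContDiff ℝ k fun y : E => h ‖y‖ - p ‖y‖ := by
    have hm : SmoothHomogeneous 0 fun _ : E => (1 : ℝ) :=
      ⟨fun _ _ => contDiffAt_const, fun _ _ _ => by simp⟩
    simpa using FlatAtZero.contDiff_smul (k := k) (l := 0) hflat hm
  have h2 : ContDiff ℝ k fun y : E => p ‖y‖ := by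
    refine ContDiff.sum fun i hi => ?_
    rcases Nat.even_or_odd' i with ⟨q, rfl | rfl⟩
    · simp only [pow_mul]
      exact contDiff_const.mul ((contDiff_norm_sq ℝ).pow q)
    · have : c (2 * q + 1) = 0 := by
        simp [hc, hodd _ (Nat.lt_succ_iff.1 (Finset.mem_range.1 hi)) (odd_two_mul_add_one q)]
      simpa [this] using contDiff_const
  simpa using h1.add h2

lemma iteratedDeriv_odd_comp_eq_zero {k : ℕ} {f φ : ℝ → ℝ} (hf : ContDiff ℝ k f)
    (hφ : ContDiff ℝ k φ) (hφodd : ∀ t, φ (-t) = -φ t)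
    (hodd : ∀ j ≤ k, Odd j → iteratedDeriv j f 0 = 0) {j : ℕ} (hjk : j ≤ k) (hj : Odd j) :
    iteratedDeriv j (f ∘ φ) 0 = 0 := by
  have hneg : ∀ g : ℝ → ℝ, ContDiff ℝ k g → ContDiff ℝ k fun t => g (-t) :=
    fun g hg => hg.comp contDiff_neg
  have hsub : ∀ (i : ℕ) (g : ℝ → ℝ), i ≤ k → ContDiff ℝ k g →
      iteratedDeriv i (fun t => g t - g (-t)) 0
        = iteratedDeriv i g 0 - (-1) ^ i * iteratedDeriv i g 0 := fun i g hi hg => by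
    have hi' : (i : WithTop ℕ∞) ≤ k := by exact_mod_cast hi
    rw [iteratedDeriv_fun_sub (hg.of_le hi').contDiffAt
      ((hneg g hg).of_le hi').contDiffAt, iteratedDeriv_comp_neg]
    simp
  have hd : FlatAtZero k fun t => f t - f (-t) := by
    refine ⟨hf.sub (hneg f hf), fun i hi => ?_⟩
    rw [hsub i f hi hf]
    rcases Nat.even_or_odd i with he | ho
    · simp [he.neg_one_pow]
    · simp [hodd i hi ho]
  have hφ0 : φ 0 = 0 := by
    have := hφodd 0
    rw [neg_zero] at this
    linarith
  have h1 := (hd.comp hφ hφ0).iteratedDeriv_eq_zero j hjk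
  have h2 := hsub j (f ∘ φ) hjk (hf.comp hφ)
  simp only [Function.comp_def, hφodd, hj.neg_one_pow] at h1 h2 ⊢
  linarith

lemma arccos_eq_two_mul_arctan {a s : ℝ} (ha : -1 < a) (hs : 0 ≤ s) (h : s ^ 2 + a ^ 2 = 1) :
    arccos a = 2 * arctan (s / (1 + a)) := by
  have ha' : 0 < 1 + a := by linarith
  have h0 : 0 ≤ arctan (s / (1 + a)) := arctan_nonneg.2 (by positivity)
  have h1 := arctan_lt_pi_div_two (s / (1 + a))
  rw [← arccos_cos (x := 2 * arctan (s / (1 + a))) (by linarith) (by linarith), cos_two_mul,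
    cos_sq_arctan]
  congr 1
  have h2 : 1 + (s / (1 + a)) ^ 2 = 2 / (1 + a) := by
    field_simp
    nlinarith
  rw [h2]
  field_simp
  ring

lemma contDiffAt_comp_arccos_stereographic {k : ℕ} {f : ℝ → ℝ} (hf : ContDiff ℝ k f)
    (hodd : ∀ j ≤ k, Odd j → iteratedDeriv j f 0 = 0) (x : E4) (hx : x 3 ≠ -1) :
    ContDiffAt ℝ k (fun y : E4 =>
      f (2 * arctan ‖(1 + y 3)⁻¹ • (y - y 3 • EuclideanSpace.single 3 (1 : ℝ))‖)) x := by
  have hφ : ContDiff ℝ k fun t : ℝ => 2 * arctan t := contDiff_const.mul contDiff_arctan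
  have hg := contDiff_comp_norm (E := E4) (hf.comp hφ) fun j hjk hj =>
    iteratedDeriv_odd_comp_eq_zero hf hφ (by simp) hodd hjk hj
  refine hg.contDiffAt.comp x (f := fun y : E4 =>
    (1 + y 3)⁻¹ • (y - y 3 • EuclideanSpace.single 3 (1 : ℝ))) ?_
  have h3 : ContDiffAt ℝ k (fun y : E4 => y 3) x := by fun_prop
  refine ((contDiffAt_const.add h3).inv ?_).smul (contDiffAt_id.sub (h3.smul contDiffAt_const))
  intro h
  exact hx (by linarith)

lemma norm_sub_smul_single_sq (x : E4) (hx : ‖x‖ = 1) :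
    ‖x - x 3 • EuclideanSpace.single 3 (1 : ℝ)‖ ^ 2 + x 3 ^ 2 = 1 := by
  have h := EuclideanSpace.norm_sq_eq x
  rw [hx] at h
  rw [EuclideanSpace.norm_sq_eq]
  simp only [Fin.sum_univ_four, norm_eq_abs, sq_abs] at h
  simp [Fin.sum_univ_four, ← h]

lemma arccos_eq_stereographic (x : E4) (hx : ‖x‖ = 1) (hx3 : x 3 ≠ -1) :
    arccos (x 3) =
      2 * arctan ‖(1 + x 3)⁻¹ • (x - x 3 • EuclideanSpace.single 3 (1 : ℝ))‖ := by
  have h := norm_sub_smul_single_sq x hx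
  have h1 : -1 < x 3 := lt_of_le_of_ne (by nlinarith [sq_nonneg (x 3 - 1)]) hx3.symm
  rw [arccos_eq_two_mul_arctan h1 (norm_nonneg _) h, norm_smul, norm_inv, norm_of_nonneg
    (by linarith), div_eq_inv_mul]

lemma contMDiffAt_comp_arccos {k : ℕ} {f : ℝ → ℝ} (hf : ContDiff ℝ k f)
    (hodd : ∀ j ≤ k, Odd j → iteratedDeriv j f 0 = 0) (x : Metric.sphere (0 : E4) 1)
    (hx : (x : E4) 3 ≠ -1) :
    ContMDiffAt (𝓡 3) 𝓘(ℝ, ℝ) k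
      (fun x : Metric.sphere (0 : E4) 1 => f (Real.arccos ((x : E4) 3))) x := by
  have h := (contDiffAt_comp_arccos_stereographic hf hodd x hx).contMDiffAt.comp x
    (contMDiff_coe_sphere (n := 3) x)
  refine h.congr_of_eventuallyEq ?_
  have hc : Continuous fun y : Metric.sphere (0 : E4) 1 => (y : E4) 3 := by fun_prop
  filter_upwards [hc.continuousAt.eventually_ne hx] with y hy
  simp only [Function.comp_apply]
  rw [arccos_eq_stereographic y (by simp) hy]

lemma iteratedDeriv_odd_eq_zero_of_reflect {g : ℝ → ℝ} (hg : ∀ t, g (-t) = g t) {j : ℕ}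
    (hj : Odd j) : iteratedDeriv j g 0 = 0 := by
  have h := iteratedDeriv_comp_neg j g 0
  simp only [hg, hj.neg_one_pow, neg_zero, smul_eq_mul] at h
  linarith

lemma iteratedDeriv_eq_of_eqOn_Icc {k : ℕ} {f g : ℝ → ℝ} {a b : ℝ} (hab : a < b)
    (hf : ContDiff ℝ k f) (hg : ContDiff ℝ k g) (hfg : EqOn f g (Icc a b)) {j : ℕ} (hj : j ≤ k)
    {x : ℝ} (hx : x ∈ Icc a b) : iteratedDeriv j f x = iteratedDeriv j g x := by
  have hj' : (j : WithTop ℕ∞) ≤ k := by exact_mod_cast hj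
  rw [← iteratedDerivWithin_eq_iteratedDeriv (uniqueDiffOn_Icc hab) (hf.of_le hj').contDiffAt hx,
    ← iteratedDerivWithin_eq_iteratedDeriv (uniqueDiffOn_Icc hab) (hg.of_le hj').contDiffAt hx,
    iteratedDerivWithin_congr hfg hx]

lemma contDiff_comp_arccos_cos {k : ℕ} {f : ℝ → ℝ}
    (h : ContMDiff (𝓡 3) 𝓘(ℝ, ℝ) k
      (fun x : Metric.sphere (0 : E4) 1 => f (Real.arccos ((x : E4) 3)))) :
    ContDiff ℝ k fun t => f (arccos (cos t)) := by
  set γ : ℝ → E4 := fun t =>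
    sin t • EuclideanSpace.single 0 (1 : ℝ) + cos t • EuclideanSpace.single 3 (1 : ℝ) with hγ
  have hγs : ContDiff ℝ k γ := by fun_prop
  have hγ1 : ∀ t, γ t ∈ Metric.sphere (0 : E4) 1 := fun t => by
    rw [mem_sphere_zero_iff_norm, ← sq_eq_sq₀ (norm_nonneg _) zero_le_one,
      EuclideanSpace.norm_sq_eq]
    simp [hγ, Fin.sum_univ_four]
  have h1 := h.comp (hγs.contMDiff.codRestrict_sphere (n := 3) hγ1)
  convert! contMDiff_iff_contDiff.1 h1 using 2 with t
  simp [hγ]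

/-- A `C^k` function `f : [0,π] → ℝ` (encoded, via Whitney extension, as a globally `C^k`
function on `ℝ`), viewed as the function `Φ(x) = f(arccos x₄)` of the polar angle on the
unit sphere `S³ ⊂ ℝ⁴`, is `C^k` on the sphere (with its standard smooth manifold
structure) if and only if all odd-order derivatives of `f` of order at most `k` vanish
at both endpoints `0` and `π`. -/
theorem stmt4 (k : ℕ) (f : ℝ → ℝ) (hf : ContDiff ℝ k f) :
    ContMDiff (𝓡 3) 𝓘(ℝ, ℝ) k
      (fun x : Metric.sphere (0 : E4) 1 => f (Real.arccos ((x : E4) 3))) ↔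
    (∀ j : ℕ, j ≤ k → Odd j → iteratedDeriv j f 0 = 0 ∧ iteratedDeriv j f π = 0) := by
  have hrefl : ∀ j t, iteratedDeriv j (fun s => f (π - s)) t
      = (-1) ^ j * iteratedDeriv j f (π - t) := fun j t => by
    simp [iteratedDeriv_comp_const_sub]
  constructor
  · intro h j hjk hj
    have hg := contDiff_comp_arccos_cos h
    have heq : EqOn f (fun t => f (arccos (cos t))) (Icc 0 π) := fun t ht => by
      simp only [arccos_cos ht.1 ht.2]
    rw [iteratedDeriv_eq_of_eqOn_Icc pi_pos hf hg heq hjk (left_mem_Icc.2 pi_pos.le),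
      iteratedDeriv_eq_of_eqOn_Icc pi_pos hf hg heq hjk (right_mem_Icc.2 pi_pos.le)]
    refine ⟨iteratedDeriv_odd_eq_zero_of_reflect (by simp) hj, ?_⟩
    have h1 : iteratedDeriv j (fun s => f (arccos (cos (π + s)))) 0 = 0 :=
      iteratedDeriv_odd_eq_zero_of_reflect
        (fun t => by rw [cos_add, cos_add]; simp) hj
    rw [iteratedDeriv_comp_const_add j (fun s => f (arccos (cos s)))] at h1
    simpa using h1
  · intro h x
    by_cases hx : (x : E4) 3 = -1
    · have h1 := contMDiffAt_comp_arccos (f := fun s => f (π - s))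
        (hf.comp (contDiff_const.sub contDiff_id))
        (fun j hjk hj => by simp [hrefl, (h j hjk hj).2]) (-x) (by simp [hx]; norm_num)
      have h2 := h1.comp x (contMDiff_neg_sphere (n := 3) x)
      refine h2.congr_of_eventuallyEq (Filter.Eventually.of_forall fun y => ?_)
      simp [arccos_neg]
    · exact contMDiffAt_comp_arccos hf (fun j hjk hj => (h j hjk hj).1) x hx
end
end
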